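/- arXiv:math/0306216 — 5 statements merged into one kernel-verified Lean document; each statement's English description precedes it below -/
import Mathlib

section
/- Let ρ ∈ (0,1), set σ = √(1−ρ²), α(ρ) = (ρ+σ)/2 and z_c = ρ/(1+σ), so that z_c ∈ (0,1). Define f : (0,1) → ℝ by f(z) = (α(ρ) − (1+ρ)/2)·log z + ((1−ρ)/2)·log(1−z) + ((1+ρ)/2)·log(1+z). Then f′(z_c) = 0 and f″(z_c) = 0; that is, z_c is a double critical point of f. -/
theorem hasDerivAt_log_combination (a b c : ℝ) {z : ℝ} (hz : z ∈ Set.Ioo (0 : ℝ) 1) :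
    HasDerivAt (fun x => a * Real.log x + b * Real.log (1 - x) + c * Real.log (1 + x))
      (a / z - b / (1 - z) + c / (1 + z)) z := by
  have h0 : z ≠ 0 := hz.1.ne'
  have h1 : 1 - z ≠ 0 := (sub_pos.2 hz.2).ne'
  have h2 : 1 + z ≠ 0 := by linarith [hz.1]
  have key := (((Real.hasDerivAt_log h0).const_mul a).add
    ((((hasDerivAt_id z).const_sub 1).log h1).const_mul b)).add
    ((((hasDerivAt_id z).const_add 1).log h2).const_mul c)
  refine key.congr_deriv ?_
  simp only [id_eq]
  ring

theorem hasDerivAt_partial_fractions (a b c : ℝ) {z : ℝ} (hz : z ∈ Set.Ioo (0 : ℝ) 1) :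
    HasDerivAt (fun x => a / x - b / (1 - x) + c / (1 + x))
      (-a / z ^ 2 - b / (1 - z) ^ 2 - c / (1 + z) ^ 2) z := by
  have h0 : z ≠ 0 := hz.1.ne'
  have h1 : 1 - z ≠ 0 := (sub_pos.2 hz.2).ne'
  have h2 : 1 + z ≠ 0 := by linarith [hz.1]
  have key := (((hasDerivAt_const z a).div (hasDerivAt_id z) h0).sub
    ((hasDerivAt_const z b).div ((hasDerivAt_id z).const_sub 1) h1)).add
    ((hasDerivAt_const z c).div ((hasDerivAt_id z).const_add 1) h2)
  refine key.congr_deriv ?_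
  simp only [id_eq]
  ring

theorem deriv_deriv_log_combination (a b c : ℝ) {z : ℝ} (hz : z ∈ Set.Ioo (0 : ℝ) 1) :
    deriv (deriv fun x => a * Real.log x + b * Real.log (1 - x) + c * Real.log (1 + x)) z =
      -a / z ^ 2 - b / (1 - z) ^ 2 - c / (1 + z) ^ 2 := by
  rw [Filter.EventuallyEq.deriv_eq (f := fun x => a / x - b / (1 - x) + c / (1 + x))]
  · exact (hasDerivAt_partial_fractions a b c hz).deriv
  · filter_upwards [isOpen_Ioo.mem_nhds hz] with x hx
    exact (hasDerivAt_log_combination a b c hx).deriv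


/-- The saddle-point computation underlying the asymptotic analysis of the extended
Krawtchouk kernel: with `α(ρ) = (ρ + √(1-ρ²))/2` and `z_c = ρ/(1 + √(1-ρ²))`,
the point `z_c` lies in `(0,1)` and is a double critical point of
`f(z) = (α(ρ) − (1+ρ)/2)·log z + ((1−ρ)/2)·log(1−z) + ((1+ρ)/2)·log(1+z)`. -/
theorem stmt_1 (ρ : ℝ) (hρ : ρ ∈ Set.Ioo (0 : ℝ) 1) :
    let σ := Real.sqrt (1 - ρ ^ 2)
    let α := (ρ + σ) / 2
    let zc := ρ / (1 + σ)
    let f : ℝ → ℝ := fun z =>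
      (α - (1 + ρ) / 2) * Real.log z + ((1 - ρ) / 2) * Real.log (1 - z) +
        ((1 + ρ) / 2) * Real.log (1 + z)
    zc ∈ Set.Ioo (0 : ℝ) 1 ∧ deriv f zc = 0 ∧ deriv (deriv f) zc = 0 := by
  intro σ α zc f
  obtain ⟨h0, h1⟩ := hρ
  have hσ : 0 ≤ σ := Real.sqrt_nonneg _
  have hσ2 : σ ^ 2 = 1 - ρ ^ 2 := Real.sq_sqrt (by nlinarith)
  have hzρ : zc * (1 + σ) = ρ := div_mul_cancel₀ _ (by positivity)
  have hz : zc ∈ Set.Ioo (0 : ℝ) 1 :=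
    ⟨by positivity, (div_lt_one (by positivity)).2 (by linarith)⟩
  have hq : 1 + zc ^ 2 ≠ 0 := by positivity
  -- `zc` rationally parametrizes the quarter circle `ρ ^ 2 + σ ^ 2 = 1`.
  have hσz : σ = (1 - zc ^ 2) / (1 + zc ^ 2) := by
    rw [eq_div_iff hq]
    refine mul_left_cancel₀ (show 1 + σ ≠ 0 by positivity) ?_
    linear_combination hσ2 + (zc * (1 + σ) + ρ) * hzρ
  have hρz : ρ = 2 * zc / (1 + zc ^ 2) := by
    rw [← hzρ, hσz]
    field_simp
    ring
  have ha : α - (1 + ρ) / 2 = -zc ^ 2 / (1 + zc ^ 2) := by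
    simp only [α]
    rw [hσz]
    field_simp
    ring
  have hb : (1 - ρ) / 2 = (1 - zc) ^ 2 / (2 * (1 + zc ^ 2)) := by
    rw [hρz]
    field_simp
    ring
  have hc : (1 + ρ) / 2 = (1 + zc) ^ 2 / (2 * (1 + zc ^ 2)) := by
    rw [hρz]
    field_simp
    ring
  have hz0 : zc ≠ 0 := hz.1.ne'
  have hz1 : 1 - zc ≠ 0 := (sub_pos.2 hz.2).ne'
  have hz2 : 1 + zc ≠ 0 := by linarith [hz.1]
  refine ⟨hz, ?_, ?_⟩
  · rw [(hasDerivAt_log_combination _ _ _ hz).deriv, ha, hb, hc]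
    field_simp
    ring
  · rw [deriv_deriv_log_combination _ _ _ hz, ha, hb, hc]
    field_simp
    ring
end

section
/- Fix δ > 0 and real numbers τ, τ′, ξ, ξ′ and η > 0 with τ − τ′ + 2η > 0. For each positive integer n set ρ = 1/√2 + 2^{−1/6}τn^{−1/3}, ρ′ = 1/√2 + 2^{−1/6}τ′n^{−1/3}, r = n(1+ρ)/2, s = n(1+ρ′)/2, x = nα(ρ) + 2^{−5/6}ξn^{1/3}, y = nα(ρ′) + 2^{−5/6}ξ′n^{1/3}, and define contours z(t) = z_c(ρ) + (η+it)/(dn^{1/3}) for t ∈ ℝ and w(t′) = (z_c(ρ′) − η/(dn^{1/3}))·e^{it′/(d′n^{1/3})} for |t′| ≤ πd′n^{1/3}. Let Ω_n = {(t, t′) ∈ ℝ × [−πd′n^{1/3}, πd′n^{1/3}] : |t| ≥ n^{1/3−δ}, |t′| ≥ n^{1/3−δ}}. Then lim_{n→∞} ∫_{Ω_n} [z′(t)·w′(t′) / (w(t′)·(z(t) − w(t′)))] · [F_{s,y}(w(t′))/F_{r,x}(z(t))] · (√2−1)^{x−y+2(s−r)} dt dt′ = 0, uniformly for ξ, ξ′,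 τ, τ′ in a compact set. -/
open Filter MeasureTheory

/-- `α(ρ) = (ρ + √(1-ρ²))/2`. -/
noncomputable def alphaF (ρ : ℝ) : ℝ := (ρ + Real.sqrt (1 - ρ ^ 2)) / 2

/-- `z_c(ρ) = ρ/(1 + √(1-ρ²))`. -/
noncomputable def zcF (ρ : ℝ) : ℝ := ρ / (1 + Real.sqrt (1 - ρ ^ 2))

/-- `d = 2^{-5/6}(1 + √2)`. -/
noncomputable def dC : ℝ := (2 : ℝ) ^ (-(5 : ℝ) / 6) * (1 + Real.sqrt 2)

/-- `d' = 2^{-5/6}`. -/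
noncomputable def dC' : ℝ := (2 : ℝ) ^ (-(5 : ℝ) / 6)

/-- `F_{r,x}(z) = exp((x−r)·Log z + (n−r)·Log(1−z) + r·Log(1+z))`, using the principal
branch of the complex logarithm. -/
noncomputable def Fc (n r x : ℝ) (z : ℂ) : ℂ :=
  Complex.exp (((x - r : ℝ) : ℂ) * Complex.log z + ((n - r : ℝ) : ℂ) * Complex.log (1 - z) +
    ((r : ℝ) : ℂ) * Complex.log (1 + z))

/-- A positive multiple of `log |F|` for `ρ = 2q/(1+q²)` and `ξ = 0`; it has a double critical
point at `q`. -/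
noncomputable def phase (q : ℝ) (z : ℂ) : ℝ :=
  -2 * q ^ 2 * Real.log ‖z‖ + (1 - q) ^ 2 * Real.log ‖1 - z‖ + (1 + q) ^ 2 * Real.log ‖1 + z‖

lemma norm_Fc (n r x : ℝ) (z : ℂ) :
    ‖Fc n r x z‖ =
      Real.exp ((x - r) * Real.log ‖z‖ + (n - r) * Real.log ‖1 - z‖ + r * Real.log ‖1 + z‖) := by
  simp [Fc, Complex.norm_exp, Complex.log_re]

lemma log_norm_add_mul_I (a u : ℝ) :
    Real.log ‖(a + u * Complex.I : ℂ)‖ = Real.log (a ^ 2 + u ^ 2) / 2 := by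
  rw [Complex.norm_add_mul_I, Real.log_sqrt (by positivity)]

lemma phase_vertical_eq (q a u : ℝ) :
    phase q (a + u * Complex.I) =
      (-2 * q ^ 2 * Real.log (a ^ 2 + u ^ 2) + (1 - q) ^ 2 * Real.log ((1 - a) ^ 2 + u ^ 2)
        + (1 + q) ^ 2 * Real.log ((1 + a) ^ 2 + u ^ 2)) / 2 := by
  have h1 : (1 - (a + u * Complex.I) : ℂ) = ((1 - a : ℝ) : ℂ) + ((-u : ℝ) : ℂ) * Complex.I := by
    push_cast; ring
  have h2 : (1 + (a + u * Complex.I) : ℂ) = ((1 + a : ℝ) : ℂ) + (u : ℂ) * Complex.I := by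
    push_cast; ring
  rw [phase, h1, h2, log_norm_add_mul_I, log_norm_add_mul_I, log_norm_add_mul_I]
  ring_nf

/-- Along a vertical line slightly to the right of `q` the phase increases. -/
lemma phase_vertical_lower {q h : ℝ} (hq : 2 / 5 ≤ q) (hq' : q ≤ 43 / 100) (hh : 0 < h)
    (hh' : h ≤ 1 / 50) (u : ℝ) :
    phase q ((q + h : ℝ) : ℂ) + h / 8 * Real.log (1 + u ^ 2)
      ≤ phase q ((q + h : ℝ) + u * Complex.I) := by
  set a := q + h with ha
  have hda : a - q = h := by rw [ha]; ring
  set G : ℝ → ℝ := fun v =>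
    -2 * q ^ 2 * Real.log (a ^ 2 + v) + (1 - q) ^ 2 * Real.log ((1 - a) ^ 2 + v)
        + (1 + q) ^ 2 * Real.log ((1 + a) ^ 2 + v) - h / 4 * Real.log (1 + v) with hG
  have hder : ∀ v, 0 ≤ v → HasDerivAt G (-2 * q ^ 2 * (1 / (a ^ 2 + v))
      + (1 - q) ^ 2 * (1 / ((1 - a) ^ 2 + v)) + (1 + q) ^ 2 * (1 / ((1 + a) ^ 2 + v))
      - h / 4 * (1 / (1 + v))) v := by
    intro v hv
    have key : ∀ c : ℝ, 0 < c → HasDerivAt (fun v => Real.log (c + v)) (1 / (c + v)) v := by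
      intro c hc
      exact ((hasDerivAt_id v).const_add c).log (by simp only [id]; positivity)
    have h1a : 0 < (1 - a) ^ 2 := by have : 0 < 1 - a := by linarith
                                     positivity
    have h0a : 0 < a ^ 2 := by have : 0 < a := by linarith
                               positivity
    exact ((((key _ h0a).const_mul _).add ((key _ h1a).const_mul _)).add
      ((key _ (by have : 0 < 1 + a := by linarith
                  positivity)).const_mul _)).sub ((key 1 one_pos).const_mul _)
  have hmono : MonotoneOn G (Set.Ici 0) := by
    refine monotoneOn_of_deriv_nonneg (convex_Ici 0)
      (fun v hv => (hder v hv).continuousAt.continuousWithinAt)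
      (fun v hv => (hder v (interior_subset hv)).differentiableAt.differentiableWithinAt) ?_
    intro v hv
    have hv0 : 0 ≤ v := interior_subset hv
    rw [(hder v hv0).deriv]
    have p1 : 0 < a ^ 2 + v := by have : 0 < a := by linarith
                                  positivity
    have p2 : 0 < (1 - a) ^ 2 + v := by have : 0 < 1 - a := by linarith
                                        positivity
    have p3 : 0 < (1 + a) ^ 2 + v := by have : 0 < 1 + a := by linarith
                                        positivity
    have hsum : -2 * q ^ 2 * (1 / (a ^ 2 + v))
      + (1 - q) ^ 2 * (1 / ((1 - a) ^ 2 + v)) + (1 + q) ^ 2 * (1 / ((1 + a) ^ 2 + v))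
      = (2 * v ^ 2 + (4 * a ^ 2 + 2 - 2 * q ^ 2 - 8 * q * a) * v
          + 2 * (a - q) * ((a + q - 2 * q * a ^ 2) + a ^ 2 * (a - q)))
        / ((a ^ 2 + v) * ((1 - a) ^ 2 + v) * ((1 + a) ^ 2 + v)) := by
      field_simp
      ring
    rw [hsum, hda, mul_one_div, sub_nonneg, div_le_div_iff₀ (by positivity) (by positivity)]
    have hal : 2 / 5 ≤ a := by linarith
    have hau : a ≤ 9 / 20 := by linarith
    have c1 : 1 / 2 ≤ 4 * a ^ 2 + 2 - 2 * q ^ 2 - 8 * q * a := by nlinarith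
    have c0 : 1 / 2 ≤ (a + q - 2 * q * a ^ 2) + a ^ 2 * h := by
      have : q * a ^ 2 ≤ 43 / 100 * (9 / 20) ^ 2 := by gcongr
      have : 0 ≤ a ^ 2 * h := by positivity
      linarith
    have hN : h * (1 + v) ^ 2 ≤ 2 * v ^ 2 + (4 * a ^ 2 + 2 - 2 * q ^ 2 - 8 * q * a) * v
          + 2 * h * ((a + q - 2 * q * a ^ 2) + a ^ 2 * h) := by
      have e1 := mul_le_mul_of_nonneg_right c1 hv0
      have e2 := mul_le_mul_of_nonneg_left c0 hh.le
      nlinarith [mul_le_mul_of_nonneg_right hh' hv0, mul_le_mul_of_nonneg_right hh' (sq_nonneg v)]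
    have hD : (a ^ 2 + v) * ((1 - a) ^ 2 + v) * ((1 + a) ^ 2 + v)
        ≤ (1 + v) * (1 + v) * (4 * (1 + v)) := by
      have e1 : a ^ 2 ≤ 1 := by nlinarith
      have e2 : (1 - a) ^ 2 ≤ 1 := by nlinarith
      have e3 : (1 + a) ^ 2 ≤ 4 := by nlinarith
      gcongr
      linarith
    calc h / 4 * ((a ^ 2 + v) * ((1 - a) ^ 2 + v) * ((1 + a) ^ 2 + v))
        ≤ h / 4 * ((1 + v) * (1 + v) * (4 * (1 + v))) := by gcongr
      _ = h * (1 + v) ^ 2 * (1 + v) := by ring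
      _ ≤ _ := by gcongr
  have hle := hmono (Set.mem_Ici.2 le_rfl) (Set.mem_Ici.2 (sq_nonneg u)) (sq_nonneg u)
  have e0 := phase_vertical_eq q a 0
  have eu := phase_vertical_eq q a u
  simp only [Complex.ofReal_zero, zero_mul, add_zero] at e0
  rw [e0, eu]
  simp only [hG, add_zero, Real.log_one] at hle
  norm_num at hle ⊢
  linarith

lemma phase_circle_eq {b : ℝ} (hb : 0 < b) (q φ : ℝ) :
    phase q (b * Complex.exp (φ * Complex.I)) =
      -2 * q ^ 2 * Real.log b + ((1 - q) ^ 2 * Real.log (1 + b ^ 2 - 2 * b * Real.cos φ)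
        + (1 + q) ^ 2 * Real.log (1 + b ^ 2 + 2 * b * Real.cos φ)) / 2 := by
  have hw : (b * Complex.exp (φ * Complex.I) : ℂ)
      = ((b * Real.cos φ : ℝ) : ℂ) + ((b * Real.sin φ : ℝ) : ℂ) * Complex.I := by
    rw [Complex.exp_mul_I]; push_cast; ring
  have hn : ‖(b * Complex.exp (φ * Complex.I) : ℂ)‖ = b := by
    rw [norm_mul, Complex.norm_exp_ofReal_mul_I, mul_one, Complex.norm_real, Real.norm_eq_abs,
      abs_of_pos hb]
  have hs := Real.sin_sq_add_cos_sq φ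
  rw [phase, hn, hw]
  have h1 : (1 - (((b * Real.cos φ : ℝ) : ℂ) + ((b * Real.sin φ : ℝ) : ℂ) * Complex.I))
      = ((1 - b * Real.cos φ : ℝ) : ℂ) + ((-(b * Real.sin φ) : ℝ) : ℂ) * Complex.I := by
    push_cast; ring
  have h2 : (1 + (((b * Real.cos φ : ℝ) : ℂ) + ((b * Real.sin φ : ℝ) : ℂ) * Complex.I))
      = ((1 + b * Real.cos φ : ℝ) : ℂ) + ((b * Real.sin φ : ℝ) : ℂ) * Complex.I := by
    push_cast; ring
  have h3 : (1 - b * Real.cos φ) ^ 2 + (-(b * Real.sin φ)) ^ 2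
      = 1 + b ^ 2 - 2 * b * Real.cos φ := by linear_combination b ^ 2 * hs
  have h4 : (1 + b * Real.cos φ) ^ 2 + (b * Real.sin φ) ^ 2
      = 1 + b ^ 2 + 2 * b * Real.cos φ := by linear_combination b ^ 2 * hs
  rw [h1, h2, log_norm_add_mul_I, log_norm_add_mul_I, h3, h4]
  ring

/-- Along a circle of radius slightly smaller than `q` the phase decreases away from the positive
real axis. -/
lemma phase_circle_upper {q h : ℝ} (hq : 2 / 5 ≤ q) (hq' : q ≤ 43 / 100) (hh : 0 < h)
    (hh' : h ≤ 1 / 50) (φ : ℝ) :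
    phase q ((q - h : ℝ) * Complex.exp (φ * Complex.I))
      ≤ phase q ((q - h : ℝ) : ℂ) - h / 2 * (1 - Real.cos φ) := by
  set b := q - h with hb
  have hdb : q - b = h := by rw [hb]; ring
  have hb0 : 19 / 50 ≤ b := by linarith
  have hb1 : b ≤ 43 / 100 := by linarith
  set S : ℝ → ℝ := fun k => (1 - q) ^ 2 * Real.log (1 + b ^ 2 - 2 * b * k)
        + (1 + q) ^ 2 * Real.log (1 + b ^ 2 + 2 * b * k) - h * k with hS
  have pos1 : ∀ k ∈ Set.Icc (-1 : ℝ) 1, 0 < 1 + b ^ 2 - 2 * b * k := by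
    intro k hk
    nlinarith [mul_nonneg (by linarith : (0:ℝ) ≤ b) (sub_nonneg.2 hk.2), sq_nonneg (1 - b)]
  have pos2 : ∀ k ∈ Set.Icc (-1 : ℝ) 1, 0 < 1 + b ^ 2 + 2 * b * k := by
    intro k hk
    nlinarith [mul_nonneg (by linarith : (0:ℝ) ≤ b) (neg_le_iff_add_nonneg.1 hk.1),
      sq_nonneg (1 - b)]
  have hder : ∀ k ∈ Set.Icc (-1 : ℝ) 1, HasDerivAt S
      ((1 - q) ^ 2 * (-(2 * b) / (1 + b ^ 2 - 2 * b * k))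
        + (1 + q) ^ 2 * (2 * b / (1 + b ^ 2 + 2 * b * k)) - h) k := by
    intro k hk
    have d1 : HasDerivAt (fun k => 1 + b ^ 2 - 2 * b * k) (-(2 * b)) k := by
      simpa using ((hasDerivAt_id k).const_mul (2 * b)).const_sub (1 + b ^ 2)
    have d2 : HasDerivAt (fun k => 1 + b ^ 2 + 2 * b * k) (2 * b) k := by
      simpa using ((hasDerivAt_id k).const_mul (2 * b)).const_add (1 + b ^ 2)
    have d3 : HasDerivAt (fun k => h * k) h k := by
      simpa using (hasDerivAt_id k).const_mul h
    exact (((d1.log (pos1 k hk).ne').const_mul _).add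
      ((d2.log (pos2 k hk).ne').const_mul _)).sub d3
  have hmono : MonotoneOn S (Set.Icc (-1) 1) := by
    refine monotoneOn_of_deriv_nonneg (convex_Icc _ _)
      (fun v hv => (hder v hv).continuousAt.continuousWithinAt)
      (fun v hv => (hder v (interior_subset hv)).differentiableAt.differentiableWithinAt) ?_
    intro k hk
    have hk' : k ∈ Set.Icc (-1 : ℝ) 1 := interior_subset hk
    rw [(hder k hk').deriv]
    have p1 := pos1 k hk'
    have p2 := pos2 k hk'
    have hsum : (1 - q) ^ 2 * (-(2 * b) / (1 + b ^ 2 - 2 * b * k))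
        + (1 + q) ^ 2 * (2 * b / (1 + b ^ 2 + 2 * b * k))
        = 2 * b * (4 * (q - b) * (1 - q * b) + 4 * b * (1 + q ^ 2) * (1 - k))
          / ((1 + b ^ 2 - 2 * b * k) * (1 + b ^ 2 + 2 * b * k)) := by
      field_simp
      ring
    rw [hsum, hdb, sub_nonneg, le_div_iff₀ (by positivity)]
    have hD : (1 + b ^ 2 - 2 * b * k) * (1 + b ^ 2 + 2 * b * k) ≤ 2 := by
      have : b ^ 2 ≤ (43 / 100) ^ 2 := by gcongr
      nlinarith [sq_nonneg (b * k), sq_nonneg b]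
    have hqb : 1 - q * b ≥ 4 / 5 := by
      have : q * b ≤ 43 / 100 * (43 / 100) := by gcongr
      linarith
    have h5 : 0 ≤ 4 * b * (1 + q ^ 2) * (1 - k) := by
      have : 0 ≤ 1 - k := by linarith [hk'.2]
      positivity
    calc h * ((1 + b ^ 2 - 2 * b * k) * (1 + b ^ 2 + 2 * b * k)) ≤ h * 2 := by gcongr
      _ ≤ 2 * (19 / 50) * (4 * h * (4 / 5)) := by linarith
      _ ≤ 2 * b * (4 * h * (1 - q * b)) := by gcongr
      _ ≤ _ := by gcongr; linarith
  have hle := hmono ⟨Real.neg_one_le_cos φ, Real.cos_le_one φ⟩ ⟨by norm_num, le_rfl⟩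
    (Real.cos_le_one φ)
  have e0 := phase_circle_eq (by linarith : 0 < b) q 0
  simp only [Complex.ofReal_zero, zero_mul, Complex.exp_zero, mul_one, Real.cos_zero] at e0
  rw [e0, phase_circle_eq (by linarith)]
  simp only [hS, mul_one] at hle
  linarith

lemma phase_ofReal (q a : ℝ) :
    phase q (a : ℂ) =
      -2 * q ^ 2 * Real.log a + (1 - q) ^ 2 * Real.log (1 - a) + (1 + q) ^ 2 * Real.log (1 + a) := by
  have h1 : (1 - (a : ℂ)) = ((1 - a : ℝ) : ℂ) := by push_cast; ring
  have h2 : (1 + (a : ℂ)) = ((1 + a : ℝ) : ℂ) := by push_cast; ring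
  rw [phase, h1, h2]
  simp only [Complex.norm_real, Real.norm_eq_abs, Real.log_abs]

/-- The phase is flat to second order at its double critical point `q`. -/
lemma abs_phase_sub_le {q a b e : ℝ} (hq : 2 / 5 ≤ q) (hq' : q ≤ 43 / 100)
    (he : e ≤ 1 / 25) (ha : |a - q| ≤ e) (hb : |b - q| ≤ e) :
    |phase q (a : ℂ) - phase q (b : ℂ)| ≤ 20 * e ^ 3 := by
  have he0 : 0 ≤ e := (abs_nonneg _).trans ha
  rw [abs_le] at ha hb
  set T : ℝ → ℝ := fun a =>
    -2 * q ^ 2 * Real.log a + (1 - q) ^ 2 * Real.log (1 - a) + (1 + q) ^ 2 * Real.log (1 + a)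
    with hT
  have hder : ∀ v ∈ Set.Icc (q - e) (q + e),
      HasDerivWithinAt T (-2 * (v - q) ^ 2 / (v * (1 - v ^ 2))) (Set.Icc (q - e) (q + e)) v := by
    intro v hv
    have v0 : 0 < v := by linarith [hv.1]
    have v1 : 0 < 1 - v := by linarith [hv.2]
    have v2 : 0 < 1 + v := by linarith
    have d1 := (((hasDerivAt_id v).log v0.ne').const_mul (-2 * q ^ 2)).add
      (((((hasDerivAt_id v).const_sub 1).log v1.ne').const_mul ((1 - q) ^ 2))) |>.add
      (((((hasDerivAt_id v).const_add 1).log v2.ne').const_mul ((1 + q) ^ 2)))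
    refine (HasDerivAt.congr_deriv (f := T) d1 ?_).hasDerivWithinAt
    have : 1 - v ^ 2 = (1 - v) * (1 + v) := by ring
    simp only [id]
    rw [this]
    field_simp
    ring
  have hbound : ∀ v ∈ Set.Icc (q - e) (q + e),
      ‖-2 * (v - q) ^ 2 / (v * (1 - v ^ 2))‖ ≤ 10 * e ^ 2 := by
    intro v hv
    have v0 : 9 / 25 ≤ v := by linarith [hv.1]
    have v1 : v ≤ 47 / 100 := by linarith [hv.2]
    have hsq : v ^ 2 ≤ (47 / 100) ^ 2 := by gcongr
    have hden : 1 / 5 ≤ v * (1 - v ^ 2) := by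
      calc (1 / 5 : ℝ) ≤ 9 / 25 * (1 - (47 / 100) ^ 2) := by norm_num
        _ ≤ _ := by gcongr
    have hvq : (v - q) ^ 2 ≤ e ^ 2 := sq_le_sq' (by linarith [hv.1]) (by linarith [hv.2])
    rw [norm_div, norm_mul, Real.norm_of_nonneg (sq_nonneg (v - q)),
      Real.norm_of_nonneg (by linarith : 0 ≤ v * (1 - v ^ 2)), div_le_iff₀ (by linarith)]
    norm_num
    nlinarith [mul_le_mul_of_nonneg_left hden (sq_nonneg e)]
  have := (convex_Icc (q - e) (q + e)).norm_image_sub_le_of_norm_hasDerivWithin_le hder hbound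
    (x := b) (y := a) ⟨by linarith, by linarith⟩ ⟨by linarith, by linarith⟩
  rw [phase_ofReal, phase_ofReal]
  rw [Real.norm_eq_abs, Real.norm_eq_abs] at this
  have hab : |a - b| ≤ 2 * e := abs_le.2 ⟨by linarith, by linarith⟩
  calc _ ≤ 10 * e ^ 2 * |a - b| := this
    _ ≤ 10 * e ^ 2 * (2 * e) := by gcongr
    _ = 20 * e ^ 3 := by ring

lemma sqrt_two_sub_one_bounds : 41 / 100 < √2 - 1 ∧ √2 - 1 < 42 / 100 :=
  ⟨by linarith [Real.lt_sqrt_of_sq_lt (show (1.41 : ℝ) ^ 2 < 2 by norm_num)],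
    by linarith [(Real.sqrt_lt' (by norm_num : (0 : ℝ) < 1.42)).2 (by norm_num : (2 : ℝ) < 1.42 ^ 2)]⟩

lemma log_one_add_mul_le {p x : ℝ} (hp : 1 ≤ p) (hx : 0 ≤ x) :
    Real.log (1 + p * x) ≤ p * Real.log (1 + x) := by
  rw [← Real.log_rpow (by positivity)]
  exact Real.log_le_log (by positivity) (one_add_mul_self_le_rpow_one_add (by linarith) hp)

lemma abs_log_sub_log_le {a b : ℝ} (ha : 2 / 5 ≤ a) (hb : 2 / 5 ≤ b) :
    |Real.log a - Real.log b| ≤ 3 * |a - b| := by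
  have key : ∀ a b : ℝ, 2 / 5 ≤ a → 2 / 5 ≤ b → Real.log a - Real.log b ≤ 3 * |a - b| := by
    intro a b ha hb
    rw [← Real.log_div (by linarith) (by linarith)]
    have hb0 : 0 < b := by linarith
    calc Real.log (a / b) ≤ a / b - 1 := Real.log_le_sub_one_of_pos (by positivity)
      _ = (a - b) / b := by field_simp
      _ ≤ |a - b| / b := by gcongr; exact le_abs_self _
      _ ≤ 3 * |a - b| := by
        rw [div_le_iff₀ hb0]
        nlinarith [abs_nonneg (a - b)]
  rw [abs_le]
  have := key b a hb ha
  rw [abs_sub_comm] at this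
  exact ⟨by linarith, key a b ha hb⟩

lemma log_norm_vertical_sub_le {a : ℝ} (ha : 2 / 5 ≤ a) (ha' : a ≤ 1) (u : ℝ) :
    |Real.log ‖(a + u * Complex.I : ℂ)‖ - Real.log a| ≤ 4 * Real.log (1 + u ^ 2) := by
  have ha0 : 0 < a := by linarith
  have hL : 0 ≤ Real.log (1 + u ^ 2) := Real.log_nonneg (by nlinarith [sq_nonneg u])
  have h1 : a ^ 2 + u ^ 2 = a ^ 2 * (1 + (1 / a ^ 2) * u ^ 2) := by field_simp
  have h2 : (1 : ℝ) ≤ 1 / a ^ 2 := by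
    rw [le_div_iff₀ (by positivity)]; nlinarith
  have h3 : 1 / a ^ 2 ≤ 8 := by
    rw [div_le_iff₀ (by positivity)]; nlinarith
  have h4 : Real.log ‖(a + u * Complex.I : ℂ)‖ - Real.log a
      = Real.log (1 + (1 / a ^ 2) * u ^ 2) / 2 := by
    rw [log_norm_add_mul_I, h1, Real.log_mul (by positivity) (by positivity), Real.log_pow]
    push_cast; ring
  rw [h4, abs_of_nonneg]
  · have := log_one_add_mul_le h2 (sq_nonneg u)
    nlinarith [mul_le_mul_of_nonneg_right h3 hL]
  · have : 0 ≤ Real.log (1 + (1 / a ^ 2) * u ^ 2) :=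
      Real.log_nonneg (by have : 0 ≤ (1 / a ^ 2) * u ^ 2 := by positivity
                          linarith)
    positivity

lemma mul_quotient_bounds {q m : ℝ} (hq : 2 / 5 ≤ q) (hq' : q ≤ 43 / 100) (hm : 0 ≤ m) :
    m / 3 ≤ m / (2 * (1 + q ^ 2)) ∧ m / (2 * (1 + q ^ 2)) ≤ m := by
  constructor
  · gcongr
    nlinarith
  · exact div_le_self hm (by nlinarith [sq_nonneg q])

/-- The estimate along the vertical contour on the scale `m = n^{1/3}`. -/
lemma vertical_estimate {A B H : ℝ} (hA : 0 ≤ A) (hB : 0 ≤ B) (hH : 0 < H) :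
    ∃ C c, 0 < c ∧ ∀ᶠ m : ℝ in atTop, ∀ q X : ℝ, |q - (√2 - 1)| ≤ A / m → |X| ≤ B * m → ∀ u : ℝ,
      Real.log (1 + c * m ^ 2 * u ^ 2) - C ≤
        m ^ 3 / (2 * (1 + q ^ 2)) *
          (phase q ((q + H / m : ℝ) + u * Complex.I) - phase q ((√2 - 1 : ℝ) : ℂ))
        + X * (Real.log ‖((q + H / m : ℝ) + u * Complex.I : ℂ)‖ - Real.log (√2 - 1)) := by
  refine ⟨20 * (A + H) ^ 3 + 3 * B * (A + H), H / 48, by positivity, ?_⟩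
  filter_upwards [eventually_ge_atTop 1, eventually_ge_atTop (100 * (A + H)),
    eventually_ge_atTop (192 * B / H), eventually_ge_atTop (48 / H)] with m hm1 hm2 hm3 hm4
  intro q X hq hX u
  have hm : 0 < m := by linarith
  obtain ⟨hz0, hz0'⟩ := sqrt_two_sub_one_bounds
  have he : (A + H) / m ≤ 1 / 100 := by rw [div_le_iff₀ hm]; linarith
  have hAH : A / m + H / m = (A + H) / m := by ring
  have hAm : 0 ≤ A / m := by positivity
  have hHm : 0 < H / m := by positivity
  have hqz := abs_le.1 hq
  have hq1 : 2 / 5 ≤ q := by linarith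
  have hq2 : q ≤ 43 / 100 := by linarith
  set z : ℂ := ((q + H / m : ℝ) + u * Complex.I : ℂ) with hz
  set L := Real.log (1 + u ^ 2) with hLdef
  have hL : 0 ≤ L := Real.log_nonneg (by nlinarith [sq_nonneg u])
  have h1 := phase_vertical_lower hq1 hq2 hHm (by linarith) u
  have h2 := abs_le.1 (abs_phase_sub_le (a := q + H / m) (b := √2 - 1) (e := (A + H) / m) hq1 hq2
    (by linarith) (by rw [add_sub_cancel_left, abs_of_pos hHm]; linarith)
    (by rw [abs_sub_comm]; linarith))
  have h3 : H / m / 8 * L - 20 * ((A + H) / m) ^ 3 ≤ phase q z - phase q ((√2 - 1 : ℝ) : ℂ) := by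
    linarith [h2.1]
  obtain ⟨k1, k2⟩ := mul_quotient_bounds hq1 hq2 (by positivity : 0 ≤ m ^ 3)
  have h4 : m ^ 2 * H / 24 * L - 20 * (A + H) ^ 3 ≤ m ^ 3 / (2 * (1 + q ^ 2)) *
      (phase q z - phase q ((√2 - 1 : ℝ) : ℂ)) := by
    calc m ^ 2 * H / 24 * L - 20 * (A + H) ^ 3
        = m ^ 3 / 3 * (H / m / 8 * L) - m ^ 3 * (20 * ((A + H) / m) ^ 3) := by
          field_simp
          ring
      _ ≤ m ^ 3 / (2 * (1 + q ^ 2)) * (H / m / 8 * L)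
          - m ^ 3 / (2 * (1 + q ^ 2)) * (20 * ((A + H) / m) ^ 3) := by gcongr
      _ = m ^ 3 / (2 * (1 + q ^ 2)) * (H / m / 8 * L - 20 * ((A + H) / m) ^ 3) := by ring
      _ ≤ _ := by gcongr
  have h5 : |Real.log ‖z‖ - Real.log (√2 - 1)| ≤ 4 * L + 3 * ((A + H) / m) := by
    have e1 := log_norm_vertical_sub_le (a := q + H / m) (by linarith) (by linarith) u
    have e2 := abs_log_sub_log_le (a := q + H / m) (b := √2 - 1) (by linarith) (by linarith)
    have e3 : |q + H / m - (√2 - 1)| ≤ (A + H) / m := abs_le.2 ⟨by linarith, by linarith⟩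
    have e4 := abs_sub_le (Real.log ‖z‖) (Real.log (q + H / m)) (Real.log (√2 - 1))
    linarith
  have h6 : -(4 * B * m * L + 3 * B * (A + H)) ≤ X * (Real.log ‖z‖ - Real.log (√2 - 1)) := by
    refine neg_le_of_abs_le ?_
    rw [abs_mul]
    calc _ ≤ B * m * (4 * L + 3 * ((A + H) / m)) := by gcongr
      _ = _ := by field_simp
  have h7 : 4 * B * m * L ≤ m ^ 2 * H / 48 * L := by
    gcongr
    rw [div_le_iff₀ hH] at hm3
    nlinarith
  have h8 : 1 ≤ H / 48 * m ^ 2 := by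
    rw [div_le_iff₀ hH] at hm4
    nlinarith
  have h9 := log_one_add_mul_le h8 (sq_nonneg u)
  rw [← hLdef] at h9
  linarith

/-- The estimate along the circular contour on the scale `m = n^{1/3}`. -/
lemma circle_estimate {A B H : ℝ} (hA : 0 ≤ A) (hB : 0 ≤ B) (hH : 0 < H) :
    ∃ C c, 0 < c ∧ ∀ᶠ m : ℝ in atTop, ∀ q X : ℝ, |q - (√2 - 1)| ≤ A / m → |X| ≤ B * m →
      ∀ φ : ℝ, |φ| ≤ Real.pi →
      m ^ 3 / (2 * (1 + q ^ 2)) *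
          (phase q ((q - H / m : ℝ) * Complex.exp (φ * Complex.I)) - phase q ((√2 - 1 : ℝ) : ℂ))
        + X * (Real.log ‖((q - H / m : ℝ) * Complex.exp (φ * Complex.I) : ℂ)‖ - Real.log (√2 - 1))
      ≤ C - Real.log (1 + c * m ^ 2 * φ ^ 2) := by
  refine ⟨20 * (A + H) ^ 3 + 3 * B * (A + H), H / 48, by positivity, ?_⟩
  filter_upwards [eventually_ge_atTop 1, eventually_ge_atTop (100 * (A + H))] with m hm1 hm2
  intro q X hq hX φ hφ
  have hm : 0 < m := by linarith
  obtain ⟨hz0, hz0'⟩ := sqrt_two_sub_one_bounds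
  have he : (A + H) / m ≤ 1 / 100 := by rw [div_le_iff₀ hm]; linarith
  have hAH : A / m + H / m = (A + H) / m := by ring
  have hAm : 0 ≤ A / m := by positivity
  have hHm : 0 < H / m := by positivity
  have hqz := abs_le.1 hq
  have hq1 : 2 / 5 ≤ q := by linarith
  have hq2 : q ≤ 43 / 100 := by linarith
  set w : ℂ := ((q - H / m : ℝ) * Complex.exp (φ * Complex.I) : ℂ) with hw
  have hnorm : ‖w‖ = q - H / m := by
    rw [hw, norm_mul, Complex.norm_exp_ofReal_mul_I, mul_one, Complex.norm_real,
      Real.norm_of_nonneg (by linarith)]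
  have h1 := phase_circle_upper hq1 hq2 hHm (by linarith) φ
  have h2 := abs_le.1 (abs_phase_sub_le (a := q - H / m) (b := √2 - 1) (e := (A + H) / m) hq1 hq2
    (by linarith) (by rw [sub_sub_cancel_left, abs_neg, abs_of_pos hHm]; linarith)
    (by rw [abs_sub_comm]; linarith))
  have hcos : φ ^ 2 / 8 ≤ 1 - Real.cos φ := by
    have e1 := Real.cos_le_one_sub_mul_cos_sq hφ
    have e2 : 1 / 8 ≤ 2 / Real.pi ^ 2 := by
      rw [div_le_div_iff₀ (by norm_num) (by positivity)]
      nlinarith [Real.pi_le_four, Real.pi_pos]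
    nlinarith [mul_le_mul_of_nonneg_right e2 (sq_nonneg φ)]
  have h3 : phase q w - phase q ((√2 - 1 : ℝ) : ℂ)
      ≤ 20 * ((A + H) / m) ^ 3 - H / m / 2 * (φ ^ 2 / 8) := by
    have := mul_le_mul_of_nonneg_left hcos (by positivity : 0 ≤ H / m / 2)
    linarith [h2.2]
  obtain ⟨k1, k2⟩ := mul_quotient_bounds hq1 hq2 (by positivity : 0 ≤ m ^ 3)
  have h4 : m ^ 3 / (2 * (1 + q ^ 2)) * (phase q w - phase q ((√2 - 1 : ℝ) : ℂ))
      ≤ 20 * (A + H) ^ 3 - H / 48 * m ^ 2 * φ ^ 2 := by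
    calc _ ≤ m ^ 3 / (2 * (1 + q ^ 2)) *
          (20 * ((A + H) / m) ^ 3 - H / m / 2 * (φ ^ 2 / 8)) := by gcongr
      _ = m ^ 3 / (2 * (1 + q ^ 2)) * (20 * ((A + H) / m) ^ 3)
          - m ^ 3 / (2 * (1 + q ^ 2)) * (H / m / 2 * (φ ^ 2 / 8)) := by ring
      _ ≤ m ^ 3 * (20 * ((A + H) / m) ^ 3) - m ^ 3 / 3 * (H / m / 2 * (φ ^ 2 / 8)) := by gcongr
      _ = _ := by
          field_simp
          ring
  have h6 : X * (Real.log ‖w‖ - Real.log (√2 - 1)) ≤ 3 * B * (A + H) := by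
    refine le_of_abs_le ?_
    rw [abs_mul, hnorm]
    have e2 := abs_log_sub_log_le (a := q - H / m) (b := √2 - 1) (by linarith) (by linarith)
    have e3 : |q - H / m - (√2 - 1)| ≤ (A + H) / m := abs_le.2 ⟨by linarith, by linarith⟩
    calc _ ≤ B * m * (3 * ((A + H) / m)) := by gcongr; linarith
      _ = _ := by field_simp
  have h9 : Real.log (1 + H / 48 * m ^ 2 * φ ^ 2) ≤ H / 48 * m ^ 2 * φ ^ 2 := by
    linarith [Real.log_le_sub_one_of_pos (by positivity : 0 < 1 + H / 48 * m ^ 2 * φ ^ 2)]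
  linarith

lemma norm_Fc_eq {ρ : ℝ} (hρ0 : -1 < ρ) (hρ1 : ρ < 1) (n X : ℝ) (z : ℂ) :
    ‖Fc n (n * (1 + ρ) / 2) (n * alphaF ρ + X) z‖ =
      Real.exp (n * Real.log (2 - √2)
        + Real.log (√2 - 1) * (n * alphaF ρ + X - 2 * (n * (1 + ρ) / 2))
        + (n / (2 * (1 + zcF ρ ^ 2)) * (phase (zcF ρ) z - phase (zcF ρ) ((√2 - 1 : ℝ) : ℂ))
          + X * (Real.log ‖z‖ - Real.log (√2 - 1)))) := by
  obtain ⟨hz0, hz0'⟩ := sqrt_two_sub_one_bounds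
  have hs2 : √2 ^ 2 = 2 := Real.sq_sqrt (by norm_num)
  have hlog : Real.log (1 + (√2 - 1)) = Real.log (2 - √2) - Real.log (√2 - 1) := by
    rw [← Real.log_div (by linarith) (by linarith)]
    congr 1
    rw [eq_div_iff (by linarith)]
    linear_combination hs2
  have h1m : 1 - (√2 - 1) = 2 - √2 := by ring
  have hpos : 0 < 1 - ρ ^ 2 := by nlinarith
  have hS : √(1 - ρ ^ 2) ^ 2 = 1 - ρ ^ 2 := Real.sq_sqrt hpos.le
  have hS0 : 0 < √(1 - ρ ^ 2) := Real.sqrt_pos.2 hpos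
  rw [norm_Fc, phase_ofReal, phase, h1m, hlog, alphaF, zcF]
  set S := √(1 - ρ ^ 2)
  have hne : 1 + S ≠ 0 := by positivity
  have hq1 : 2 * (1 + (ρ / (1 + S)) ^ 2) = 4 / (1 + S) := by
    field_simp
    linear_combination 2 * hS
  have hq2 : (ρ / (1 + S)) ^ 2 = (1 - S) / (1 + S) := by
    field_simp
    linear_combination hS
  have hq3 : (1 - ρ / (1 + S)) ^ 2 = 2 * (1 - ρ) / (1 + S) := by
    field_simp
    linear_combination hS
  have hq4 : (1 + ρ / (1 + S)) ^ 2 = 2 * (1 + ρ) / (1 + S) := by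
    field_simp
    linear_combination hS
  rw [hq1, hq3, hq4, hq2]
  congr 1
  field_simp
  ring

lemma hasStrictDerivAt_zcF : HasStrictDerivAt zcF (2 * (√2 - 1)) (1 / √2) := by
  have hs2 : √2 ^ 2 = 2 := Real.sq_sqrt (by norm_num)
  have hs0 : 0 < √2 := by positivity
  have hval : 1 - (1 / √2) ^ 2 = (1 / √2) ^ 2 := by
    rw [div_pow, hs2]; norm_num
  have hroot : √(1 - (1 / √2) ^ 2) = 1 / √2 := by
    rw [hval, Real.sqrt_sq (by positivity)]
  have h1 : HasStrictDerivAt (fun ρ : ℝ => 1 - ρ ^ 2) (-(2 * (1 / √2))) (1 / √2) := by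
    simpa using ((hasStrictDerivAt_id (1 / √2)).pow 2).const_sub 1
  have h2 := (h1.sqrt (by rw [hval]; positivity)).const_add 1
  have h3 := (hasStrictDerivAt_id (1 / √2)).fun_div h2 (by positivity)
  refine HasStrictDerivAt.congr_deriv (f := zcF) h3 ?_
  simp only [id, hroot]
  field_simp
  ring_nf
  nlinarith

lemma zcF_one_div_sqrt_two : zcF (1 / √2) = √2 - 1 := by
  have hs2 : √2 ^ 2 = 2 := Real.sq_sqrt (by norm_num)
  have hs0 : 0 < √2 := by positivity
  have hval : 1 - (1 / √2) ^ 2 = (1 / √2) ^ 2 := by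
    rw [div_pow, hs2]; norm_num
  rw [zcF, hval, Real.sqrt_sq (by positivity)]
  field_simp
  linear_combination -hs2

lemma dC_pos : 0 < dC := by unfold dC; positivity

lemma dC'_pos : 0 < dC' := by unfold dC'; positivity

lemma two_mul_dC_mul : 2 * (√2 - 1) * (2 : ℝ) ^ (-(1 : ℝ) / 6) * dC = 1 := by
  have hs2 : √2 ^ 2 = 2 := Real.sq_sqrt (by norm_num)
  have h : (2 : ℝ) ^ (-(1 : ℝ) / 6) * (2 : ℝ) ^ (-(5 : ℝ) / 6) = 1 / 2 := by
    rw [← Real.rpow_add (by norm_num)]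
    norm_num [Real.rpow_neg_one]
  rw [dC]
  linear_combination (2 * (√2 - 1) * (1 + √2)) * h + hs2

lemma eventually_abs_mul_inv_lt (k M : ℝ) {ε : ℝ} (hε : 0 < ε) :
    ∀ᶠ m : ℝ in atTop, ∀ τ, |τ| ≤ M → |k * τ * m⁻¹| < ε := by
  filter_upwards [eventually_gt_atTop 0, eventually_gt_atTop (|k| * M / ε)] with m hm hm' τ hτ
  rw [div_lt_iff₀ hε] at hm'
  rw [abs_mul, abs_mul, abs_inv, abs_of_pos hm, ← div_eq_mul_inv, div_lt_iff₀ hm]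
  calc |k| * |τ| ≤ |k| * M := by gcongr
    _ < ε * m := by linarith

/-- First-order expansion of the difference of two critical points. -/
lemma zcF_sub_zcF_estimate (M : ℝ) {c : ℝ} (hc : 0 < c) :
    ∀ᶠ m : ℝ in atTop, ∀ τ τ', |τ| ≤ M → |τ'| ≤ M →
      |zcF (1 / √2 + (2 : ℝ) ^ (-(1 : ℝ) / 6) * τ * m⁻¹)
        - zcF (1 / √2 + (2 : ℝ) ^ (-(1 : ℝ) / 6) * τ' * m⁻¹) - (τ - τ') / (dC * m)| ≤ c / m := by
  set k := (2 : ℝ) ^ (-(1 : ℝ) / 6) with hk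
  have hk0 : 0 < k := by positivity
  have hc' : 0 < c / (2 * k * (|M| + 1)) := by positivity
  have ho := hasStrictDerivAt_zcF.hasStrictFDerivAt.isLittleO.def hc'
  rw [nhds_prod_eq, Metric.nhds_basis_ball.prod_self.eventually_iff] at ho
  obtain ⟨ε, hε, ho⟩ := ho
  filter_upwards [eventually_gt_atTop 0, eventually_abs_mul_inv_lt k M hε] with m hm hlt τ τ' hτ hτ'
  have hball : ∀ τ, |τ| ≤ M → 1 / √2 + k * τ * m⁻¹ ∈ Metric.ball (1 / √2) ε := by
    intro τ hτ
    rw [Metric.mem_ball, Real.dist_eq, add_sub_cancel_left]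
    exact hlt τ hτ
  have h := ho (x := (1 / √2 + k * τ * m⁻¹, 1 / √2 + k * τ' * m⁻¹)) ⟨hball τ hτ, hball τ' hτ'⟩
  have e1 : (1 / √2 + k * τ * m⁻¹) - (1 / √2 + k * τ' * m⁻¹) = k * (τ - τ') / m := by
    field_simp
    ring
  have e2 : k * (τ - τ') / m * (2 * (√2 - 1)) = (τ - τ') / (dC * m) := by
    have := dC_pos
    field_simp
    linear_combination (τ - τ') * two_mul_dC_mul
  simp only [ContinuousLinearMap.toSpanSingleton_apply, e1, smul_eq_mul, e2, Real.norm_eq_abs] at h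
  refine h.trans ?_
  rw [abs_div, abs_mul, abs_of_pos hk0, abs_of_pos hm]
  have e3 : |τ - τ'| ≤ 2 * (|M| + 1) := by
    have := abs_sub τ τ'
    have := le_abs_self M
    linarith
  calc c / (2 * k * (|M| + 1)) * (k * |τ - τ'| / m)
      ≤ c / (2 * k * (|M| + 1)) * (k * (2 * (|M| + 1)) / m) := by gcongr
    _ = c / m := by field_simp

lemma zcF_sub_estimate (M : ℝ) :
    ∀ᶠ m : ℝ in atTop, ∀ τ, |τ| ≤ M →
      |zcF (1 / √2 + (2 : ℝ) ^ (-(1 : ℝ) / 6) * τ * m⁻¹) - (√2 - 1)| ≤ (|M| / dC + 1) / m := by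
  filter_upwards [eventually_gt_atTop 0, zcF_sub_zcF_estimate |M| one_pos] with m hm h τ hτ
  have h1 := h τ 0 (hτ.trans (le_abs_self M)) (by simp)
  simp only [mul_zero, zero_mul, add_zero, zcF_one_div_sqrt_two, sub_zero] at h1
  have h2 : |τ / (dC * m)| ≤ |M| / (dC * m) := by
    have := dC_pos
    rw [abs_div, abs_of_pos (by positivity : 0 < dC * m)]
    exact div_le_div_of_nonneg_right (hτ.trans (le_abs_self M)) (by positivity)
  have h3 : (|M| / dC + 1) / m = |M| / (dC * m) + 1 / m := by
    have := dC_pos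
    field_simp
  rw [h3]
  calc _ ≤ |zcF (1 / √2 + (2 : ℝ) ^ (-(1 : ℝ) / 6) * τ * m⁻¹) - (√2 - 1) - τ / (dC * m)|
        + |τ / (dC * m)| := by
        have := abs_add_le (zcF (1 / √2 + (2 : ℝ) ^ (-(1 : ℝ) / 6) * τ * m⁻¹) - (√2 - 1)
          - τ / (dC * m)) (τ / (dC * m))
        rwa [sub_add_cancel] at this
    _ ≤ _ := by linarith

lemma norm_kernel {D D' P : ℝ} (hD : 0 < D) (hD' : 0 < D') (hP : 0 ≤ P) {w : ℂ} (hw : w ≠ 0)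
    (z f g : ℂ) :
    ‖Complex.I / (D : ℂ) * (w * Complex.I / (D' : ℂ)) / (w * (z - w)) * (f / g) * (P : ℂ)‖
      = 1 / (D * D' * ‖z - w‖) * (‖f‖ / ‖g‖ * P) := by
  have : ‖w‖ ≠ 0 := norm_ne_zero_iff.2 hw
  simp only [norm_mul, norm_div, Complex.norm_I, Complex.norm_real, Real.norm_of_nonneg hD.le,
    Real.norm_of_nonneg hD'.le, Real.norm_of_nonneg hP]
  field_simp

lemma integrable_inv_one_add_mul_sq {c : ℝ} (hc : 0 < c) :
    Integrable (fun t : ℝ => (1 + c * t ^ 2)⁻¹) := by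
  have h := integrable_inv_one_add_sq.comp_mul_left' (Real.sqrt_pos.2 hc).ne'
  simpa [mul_pow, Real.sq_sqrt hc.le] using h

lemma isBounded_components {K : Set (ℝ × ℝ × ℝ × ℝ)} (hK : IsCompact K) :
    ∃ M : ℝ, 0 ≤ M ∧ ∀ p ∈ K, |p.1| ≤ M ∧ |p.2.1| ≤ M ∧ |p.2.2.1| ≤ M ∧ |p.2.2.2| ≤ M := by
  obtain ⟨M, hM⟩ := hK.isBounded.exists_norm_le
  refine ⟨|M|, abs_nonneg M, fun p hp => ?_⟩
  have h := (hM p hp).trans (le_abs_self M)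
  simpa only [Prod.norm_def, sup_le_iff, Real.norm_eq_abs] using h

/-- The ratio of the two factors `F`, normalized by `(√2-1)^{x-y+2(s-r)}`, has Gaussian-type decay
along both contours. -/
lemma ratio_bound {M H : ℝ} (hM : 0 ≤ M) (hH : 0 < H) :
    ∃ C c, 0 < C ∧ 0 < c ∧ ∀ᶠ m : ℝ in atTop, ∀ τ τ' ξ ξ' : ℝ,
      |τ| ≤ M → |τ'| ≤ M → |ξ| ≤ M → |ξ'| ≤ M →
      let ρ := 1 / √2 + (2 : ℝ) ^ (-(1 : ℝ) / 6) * τ * m⁻¹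
      let ρ' := 1 / √2 + (2 : ℝ) ^ (-(1 : ℝ) / 6) * τ' * m⁻¹
      let r := m ^ 3 * (1 + ρ) / 2
      let s := m ^ 3 * (1 + ρ') / 2
      let x := m ^ 3 * alphaF ρ + (2 : ℝ) ^ (-(5 : ℝ) / 6) * ξ * m
      let y := m ^ 3 * alphaF ρ' + (2 : ℝ) ^ (-(5 : ℝ) / 6) * ξ' * m
      ∀ u φ : ℝ, |φ| ≤ Real.pi →
        ‖Fc (m ^ 3) s y ((zcF ρ' - H / m : ℝ) * Complex.exp (φ * Complex.I))‖
          / ‖Fc (m ^ 3) r x ((zcF ρ + H / m : ℝ) + u * Complex.I)‖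
          * (√2 - 1) ^ (x - y + 2 * (s - r))
        ≤ C * ((1 + c * m ^ 2 * u ^ 2)⁻¹ * (1 + c * m ^ 2 * φ ^ 2)⁻¹) := by
  set A := |M| / dC + 1
  have hA : 0 ≤ A := by have := dC_pos; positivity
  obtain ⟨C₁, c₁, hc₁, hv⟩ := vertical_estimate hA hM hH
  obtain ⟨C₂, c₂, hc₂, hw⟩ := circle_estimate hA hM hH
  have hρ2 : (1 / √2 : ℝ) < 3 / 4 ∧ 0 < 1 / √2 := by
    refine ⟨?_, by positivity⟩
    rw [div_lt_div_iff₀ (by positivity) (by norm_num)]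
    linarith [sqrt_two_sub_one_bounds.1]
  refine ⟨Real.exp (C₁ + C₂), min c₁ c₂, Real.exp_pos _, lt_min hc₁ hc₂, ?_⟩
  filter_upwards [hv, hw, zcF_sub_estimate M, eventually_gt_atTop 0,
    eventually_abs_mul_inv_lt ((2 : ℝ) ^ (-(1 : ℝ) / 6)) M (by norm_num : (0 : ℝ) < 1 / 4)]
    with m hv hw hz hm hlt τ τ' ξ ξ' hτ hτ' hξ hξ'
  intro ρ ρ' r s x y u φ hφ
  have hscale : ∀ ξ : ℝ, |ξ| ≤ M → |(2 : ℝ) ^ (-(5 : ℝ) / 6) * ξ * m| ≤ M * m := by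
    intro ξ hξ
    have h1 : (2 : ℝ) ^ (-(5 : ℝ) / 6) ≤ 1 :=
      Real.rpow_le_one_of_one_le_of_nonpos (by norm_num) (by norm_num)
    rw [abs_mul, abs_mul, abs_of_pos hm, abs_of_pos (by positivity : 0 < (2 : ℝ) ^ (-(5 : ℝ) / 6))]
    gcongr
    calc _ ≤ 1 * |ξ| := by gcongr
      _ ≤ M := by linarith
  have hv := hv _ _ (hz τ hτ) (hscale ξ hξ) u
  have hw := hw _ _ (hz τ' hτ') (hscale ξ' hξ') φ hφ
  have hrange : ∀ τ : ℝ, |τ| ≤ M → -1 < 1 / √2 + (2 : ℝ) ^ (-(1 : ℝ) / 6) * τ * m⁻¹ ∧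
      1 / √2 + (2 : ℝ) ^ (-(1 : ℝ) / 6) * τ * m⁻¹ < 1 := by
    intro τ hτ
    have := abs_lt.1 (hlt τ hτ)
    constructor <;> linarith
  have hpow : (√2 - 1) ^ (x - y + 2 * (s - r))
      = Real.exp (Real.log (√2 - 1) * (x - y + 2 * (s - r))) :=
    Real.rpow_def_of_pos (by linarith [sqrt_two_sub_one_bounds.1]) _
  rw [norm_Fc_eq (hrange τ' hτ').1 (hrange τ' hτ').2, norm_Fc_eq (hrange τ hτ).1 (hrange τ hτ).2,
    hpow, ← Real.exp_sub, ← Real.exp_add]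
  have hmin₁ : 0 < 1 + min c₁ c₂ * m ^ 2 * u ^ 2 := by
    have := lt_min hc₁ hc₂
    positivity
  have hmin₂ : 0 < 1 + min c₁ c₂ * m ^ 2 * φ ^ 2 := by
    have := lt_min hc₁ hc₂
    positivity
  have l1 : Real.log (1 + min c₁ c₂ * m ^ 2 * u ^ 2) ≤ Real.log (1 + c₁ * m ^ 2 * u ^ 2) := by
    gcongr
    exact min_le_left _ _
  have l2 : Real.log (1 + min c₁ c₂ * m ^ 2 * φ ^ 2) ≤ Real.log (1 + c₂ * m ^ 2 * φ ^ 2) := by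
    gcongr
    exact min_le_right _ _
  calc _ ≤ Real.exp ((C₁ + C₂) + (-Real.log (1 + min c₁ c₂ * m ^ 2 * u ^ 2)
        + -Real.log (1 + min c₁ c₂ * m ^ 2 * φ ^ 2))) := by
        refine Real.exp_le_exp.2 ?_
        simp only [r, s, x, y, ρ, ρ'] at hv hw ⊢
        linarith
    _ = _ := by
        rw [Real.exp_add (C₁ + C₂), Real.exp_add (-_), Real.exp_neg, Real.exp_neg, Real.exp_log hmin₁,
          Real.exp_log hmin₂]

/-- Claim 3.4: with the saddle-point contours `z(t) = z_c(ρ) + (η+it)/(dn^{1/3})` and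
`w(t') = (z_c(ρ') − η/(dn^{1/3}))e^{it'/(d'n^{1/3})}`, the contribution of the tail region
`Ω_n = {(t,t') : |t| ≥ n^{1/3−δ}, |t'| ≥ n^{1/3−δ}, |t'| ≤ πd'n^{1/3}}` to the double
contour integral tends to `0`, uniformly for `(τ, τ', ξ, ξ')` in a compact set. -/
theorem stmt_7 (δ η : ℝ) (hδ : 0 < δ) (hη : 0 < η)
    (K : Set (ℝ × ℝ × ℝ × ℝ)) (hK : IsCompact K)
    (hKτ : ∀ p ∈ K, 0 < p.1 - p.2.1 + 2 * η) :
    TendstoUniformlyOn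
      (fun (n : ℕ) (p : ℝ × ℝ × ℝ × ℝ) =>
        let τ := p.1
        let τ' := p.2.1
        let ξ := p.2.2.1
        let ξ' := p.2.2.2
        let ρ := 1 / Real.sqrt 2 + (2 : ℝ) ^ (-(1 : ℝ) / 6) * τ * (n : ℝ) ^ (-(1 : ℝ) / 3)
        let ρ' := 1 / Real.sqrt 2 + (2 : ℝ) ^ (-(1 : ℝ) / 6) * τ' * (n : ℝ) ^ (-(1 : ℝ) / 3)
        let r := (n : ℝ) * (1 + ρ) / 2
        let s := (n : ℝ) * (1 + ρ') / 2
        let x := (n : ℝ) * alphaF ρ + (2 : ℝ) ^ (-(5 : ℝ) / 6) * ξ * (n : ℝ) ^ ((1 : ℝ) / 3)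
        let y := (n : ℝ) * alphaF ρ' + (2 : ℝ) ^ (-(5 : ℝ) / 6) * ξ' * (n : ℝ) ^ ((1 : ℝ) / 3)
        let z : ℝ → ℂ := fun t =>
          ((zcF ρ : ℝ) : ℂ) + (((η : ℝ) : ℂ) + (t : ℂ) * Complex.I) /
            ((dC * (n : ℝ) ^ ((1 : ℝ) / 3) : ℝ) : ℂ)
        let zd : ℂ := Complex.I / ((dC * (n : ℝ) ^ ((1 : ℝ) / 3) : ℝ) : ℂ)
        let w : ℝ → ℂ := fun t' =>
          ((zcF ρ' - η / (dC * (n : ℝ) ^ ((1 : ℝ) / 3)) : ℝ) : ℂ) *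
            Complex.exp (Complex.I * (t' : ℂ) / ((dC' * (n : ℝ) ^ ((1 : ℝ) / 3) : ℝ) : ℂ))
        let wd : ℝ → ℂ := fun t' =>
          w t' * Complex.I / ((dC' * (n : ℝ) ^ ((1 : ℝ) / 3) : ℝ) : ℂ)
        ∫ q in {q : ℝ × ℝ | (n : ℝ) ^ ((1 : ℝ) / 3 - δ) ≤ |q.1| ∧
            (n : ℝ) ^ ((1 : ℝ) / 3 - δ) ≤ |q.2| ∧
            |q.2| ≤ Real.pi * dC' * (n : ℝ) ^ ((1 : ℝ) / 3)},
          zd * wd q.2 / (w q.2 * (z q.1 - w q.2)) *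
            (Fc (n : ℝ) s y (w q.2) / Fc (n : ℝ) r x (z q.1)) *
            (((Real.sqrt 2 - 1) ^ (x - y + 2 * (s - r)) : ℝ) : ℂ))
      (fun _ => (0 : ℂ)) atTop K := by
  obtain ⟨M, hM, hKM⟩ := isBounded_components hK
  obtain ⟨κ, hκ, hKκ⟩ := hK.exists_forall_le' (f := fun p => p.1 - p.2.1 + 2 * η)
    (by fun_prop) hKτ
  have hd := dC_pos
  have hd' := dC'_pos
  have hH : 0 < η / dC := by positivity
  obtain ⟨C, c, hC, hc, hratio⟩ := ratio_bound hM hH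
  have hint : Integrable (fun q : ℝ × ℝ =>
      (1 + c / dC ^ 2 * q.1 ^ 2)⁻¹ * (1 + c / dC' ^ 2 * q.2 ^ 2)⁻¹) :=
    (integrable_inv_one_add_mul_sq (by positivity)).mul_prod
      (integrable_inv_one_add_mul_sq (by positivity))
  set J := ∫ q : ℝ × ℝ, (1 + c / dC ^ 2 * q.1 ^ 2)⁻¹ * (1 + c / dC' ^ 2 * q.2 ^ 2)⁻¹ with hJ
  have htend : Tendsto (fun n : ℕ => (n : ℝ) ^ ((1 : ℝ) / 3)) atTop atTop :=
    (tendsto_rpow_atTop (by norm_num)).comp tendsto_natCast_atTop_atTop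
  rw [Metric.tendstoUniformlyOn_iff]
  intro ε hε
  filter_upwards [htend.eventually hratio, htend.eventually (zcF_sub_estimate M),
    htend.eventually (zcF_sub_zcF_estimate M (by positivity : 0 < κ / (2 * dC))),
    htend.eventually_gt_atTop 0, htend.eventually_gt_atTop (2 * C / (dC' * κ) * J / ε),
    htend.eventually_gt_atTop (10 * (|M| / dC + 1 + η / dC))]
    with n hratio hz hzz hm hmε hmb p hp
  have hn0 : (0 : ℝ) ≤ n := n.cast_nonneg
  have hcube : (n : ℝ) = ((n : ℝ) ^ ((1 : ℝ) / 3)) ^ 3 := by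
    rw [← Real.rpow_natCast, ← Real.rpow_mul hn0]
    norm_num
  have hinv : (n : ℝ) ^ (-(1 : ℝ) / 3) = ((n : ℝ) ^ ((1 : ℝ) / 3))⁻¹ := by
    rw [← Real.rpow_neg hn0]
    norm_num
  obtain ⟨hτ, hτ', hξ, hξ'⟩ := hKM p hp
  have hκp := hKκ p hp
  dsimp only at hκp ⊢
  rw [hinv]
  have hratio := hratio p.1 p.2.1 p.2.2.1 p.2.2.2 hτ hτ' hξ hξ'
  have hz' := abs_le.1 (hz p.2.1 hτ')
  have hzz := abs_le.1 (hzz p.1 p.2.1 hτ hτ')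
  dsimp only at hratio
  rw [← hcube] at hratio
  set m := (n : ℝ) ^ ((1 : ℝ) / 3) with hmdef
  set ρ := 1 / √2 + (2 : ℝ) ^ (-(1 : ℝ) / 6) * p.1 * m⁻¹ with hρ
  set ρ' := 1 / √2 + (2 : ℝ) ^ (-(1 : ℝ) / 6) * p.2.1 * m⁻¹ with hρ'
  set r := (n : ℝ) * (1 + ρ) / 2
  set s := (n : ℝ) * (1 + ρ') / 2
  set x := (n : ℝ) * alphaF ρ + (2 : ℝ) ^ (-(5 : ℝ) / 6) * p.2.2.1 * m
  set y := (n : ℝ) * alphaF ρ' + (2 : ℝ) ^ (-(5 : ℝ) / 6) * p.2.2.2 * m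
  have hb : 0 < zcF ρ' - η / dC / m := by
    have h1 : (|M| / dC + 1 + η / dC) / m ≤ 1 / 10 := by
      rw [div_le_iff₀ hm]
      linarith
    rw [add_div] at h1
    linarith [sqrt_two_sub_one_bounds.1, hz'.1]
  have hgap : κ / (2 * dC * m) ≤ (zcF ρ + η / dC / m) - (zcF ρ' - η / dC / m) := by
    have e1 : κ / (2 * dC) / m = κ / (2 * dC * m) := by field_simp
    have e2 : κ / (dC * m) ≤ (p.1 - p.2.1) / (dC * m) + 2 * (η / dC / m) := by
      have : (p.1 - p.2.1) / (dC * m) + 2 * (η / dC / m)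
          = (p.1 - p.2.1 + 2 * η) / (dC * m) := by field_simp
      rw [this]
      gcongr
    have e3 : κ / (dC * m) = 2 * (κ / (2 * dC * m)) := by field_simp
    linarith [hzz.1]
  rw [dist_zero_left]
  have hmeas : MeasurableSet {q : ℝ × ℝ | (n : ℝ) ^ ((1 : ℝ) / 3 - δ) ≤ |q.1| ∧
      (n : ℝ) ^ ((1 : ℝ) / 3 - δ) ≤ |q.2| ∧ |q.2| ≤ Real.pi * dC' * m} := by
    refine IsClosed.measurableSet ?_
    simp only [Set.ofPred_and]
    refine (isClosed_le ?_ ?_).inter ((isClosed_le ?_ ?_).inter (isClosed_le ?_ ?_)) <;> fun_prop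
  refine (norm_integral_le_of_norm_le (hint.const_mul (2 * C / (dC' * κ) / m)).integrableOn
    ((ae_restrict_iff' hmeas).2 (Eventually.of_forall ?_))).trans_lt ?_
  rotate_left
  · calc _ ≤ ∫ q : ℝ × ℝ, 2 * C / (dC' * κ) / m *
          ((1 + c / dC ^ 2 * q.1 ^ 2)⁻¹ * (1 + c / dC' ^ 2 * q.2 ^ 2)⁻¹) :=
          setIntegral_le_integral (hint.const_mul _)
            (Eventually.of_forall fun q => by simp only [Pi.zero_apply]; positivity)
      _ = 2 * C / (dC' * κ) * J / m := by
          rw [integral_const_mul, ← hJ]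
          ring
      _ < ε := by
          rw [div_lt_iff₀ hε] at hmε
          rw [div_lt_iff₀ hm]
          linarith
  · rintro ⟨t, t'⟩ ⟨-, -, ht'⟩
    dsimp only at ht' ⊢
    have ez : (zcF ρ : ℂ) + ((η : ℂ) + (t : ℂ) * Complex.I) / ((dC * m : ℝ) : ℂ)
        = ((zcF ρ + η / dC / m : ℝ) : ℂ) + ((t / (dC * m) : ℝ) : ℂ) * Complex.I := by
      push_cast
      ring
    have ew : ((zcF ρ' - η / (dC * m) : ℝ) : ℂ) *
          Complex.exp (Complex.I * (t' : ℂ) / ((dC' * m : ℝ) : ℂ))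
        = ((zcF ρ' - η / dC / m : ℝ) : ℂ) *
          Complex.exp (((t' / (dC' * m) : ℝ) : ℂ) * Complex.I) := by
      rw [div_div]
      congr 2
      push_cast
      ring
    have hφ : |t' / (dC' * m)| ≤ Real.pi := by
      rw [abs_div, abs_of_pos (by positivity : 0 < dC' * m), div_le_iff₀ (by positivity)]
      linarith
    have hR := hratio (t / (dC * m)) (t' / (dC' * m)) hφ
    rw [ez, ew]
    set z := ((zcF ρ + η / dC / m : ℝ) : ℂ) + ((t / (dC * m) : ℝ) : ℂ) * Complex.I with hzdef
    set w := ((zcF ρ' - η / dC / m : ℝ) : ℂ) *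
          Complex.exp (((t' / (dC' * m) : ℝ) : ℂ) * Complex.I) with hwdef
    have hwn : ‖w‖ = zcF ρ' - η / dC / m := by
      rw [hwdef, norm_mul, Complex.norm_exp_ofReal_mul_I, mul_one, Complex.norm_real,
        Real.norm_of_nonneg hb.le]
    have hw0 : w ≠ 0 := norm_pos_iff.1 (hwn ▸ hb)
    have hzn : zcF ρ + η / dC / m ≤ ‖z‖ := by
      have : z.re = zcF ρ + η / dC / m := by
        simp only [hzdef, Complex.add_re, Complex.ofReal_re, Complex.re_ofReal_mul, Complex.I_re,
          mul_zero, add_zero]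
      exact this ▸ Complex.re_le_norm z
    have hzw : κ / (2 * dC * m) ≤ ‖z - w‖ := by
      linarith [norm_sub_norm_le z w]
    have e1 : c * m ^ 2 * (t / (dC * m)) ^ 2 = c / dC ^ 2 * t ^ 2 := by field_simp
    have e2 : c * m ^ 2 * (t' / (dC' * m)) ^ 2 = c / dC' ^ 2 * t' ^ 2 := by field_simp
    rw [e1, e2] at hR
    have hP : 0 ≤ (√2 - 1) ^ (x - y + 2 * (s - r)) :=
      Real.rpow_nonneg (by linarith [sqrt_two_sub_one_bounds.1]) _
    rw [norm_kernel (by positivity) (by positivity) hP hw0]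
    calc _ ≤ 1 / (dC * m * (dC' * m) * (κ / (2 * dC * m))) *
          (C * ((1 + c / dC ^ 2 * t ^ 2)⁻¹ * (1 + c / dC' ^ 2 * t' ^ 2)⁻¹)) := by gcongr
      _ = _ := by field_simp
end

section
/- Fix real numbers τ < τ′ and ξ, ξ′. Let (r_n), (s_n), (x_n), (y_n) be sequences of integers with r_n < s_n such that τ_n := (2r_n − n(1+1/√2))·2^{1/6}n^{−2/3} → τ, τ′_n := (2s_n − n(1+1/√2))·2^{1/6}n^{−2/3} → τ′, ξ_n := (x_n − a_n(τ_n))/c_n → ξ and ξ′_n := (y_n − a_n(τ′_n))/c_n → ξ′ as n → ∞. Then lim_{n→∞} c_n·(√2−1)^{x_n−y_n+2(s_n−r_n)}·φ_{2r_n,2s_n}(x_n, y_n) = (4π(τ′−τ))^{−1/2}·exp(−(ξ′ − ξ + τ² − τ′²)²/(4(τ′−τ))). -/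
open Filter MeasureTheory

/-- The double contour integral `K̃_n(2r, x; 2s, y)` of the paper (weight `a = 1`),
with `γ` the circle `|w| = 1/3` (parametrized by `θ ↦ (1/3)e^{iθ}`, so `dw/w = i dθ`)
and `Γ` the vertical line `Re z = 1/2` (parametrized by `t ↦ 1/2 + it`, so `dz = i dt`);
by the cited contour-independence any admissible `0 < α₁ < α₂ < 1` gives the same value. -/
noncomputable def Ktilde (n r s x y : ℤ) : ℂ :=
  (1 / (2 * (Real.pi : ℂ) * Complex.I)) ^ 2 *
    ∫ t : ℝ,
      let z : ℂ := 1 / 2 + (t : ℂ) * Complex.I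
      (Complex.I / z) *
        ∫ θ in (-Real.pi)..Real.pi,
          let w : ℂ := 1 / 3 * Complex.exp ((θ : ℂ) * Complex.I)
          Complex.I *
            ((w ^ y * (1 - w) ^ (n - s) * (1 + 1 / w) ^ s) /
                (z ^ x * (1 - z) ^ (n - r) * (1 + 1 / z) ^ r) *
              (z / (z - w)))

/-- The transition function `φ_{2r,2s}(x,y)`: for `r < s` it is the contour integral
`(1/2πi) ∮_{|z|=α} z^{y−x+r−s}((1+z)/(1−z))^{s−r} dz/z` (here with `α = 1/2`;
the value is independent of `α ∈ (0,1)`), and it vanishes for `r ≥ s`. -/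
noncomputable def phiK (r s x y : ℤ) : ℂ :=
  if r < s then
    (1 / (2 * (Real.pi : ℂ) * Complex.I)) *
      ∫ θ in (-Real.pi)..Real.pi,
        let z : ℂ := 1 / 2 * Complex.exp ((θ : ℂ) * Complex.I)
        Complex.I * (z ^ (y - x + r - s) * ((1 + z) / (1 - z)) ^ (s - r))
  else 0

/-- The extended Krawtchouk kernel at weight `a = 1`:
`K_n(2r, x; 2s, y) = K̃_n(2r, x; 2s, y) − φ_{2r,2s}(x, y)`. -/
noncomputable def Kext (n r s x y : ℤ) : ℂ := Ktilde n r s x y - phiK r s x y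

/-- `c_n = 2^{-5/6} n^{1/3}`. -/
noncomputable def cC (n : ℕ) : ℝ := (2 : ℝ) ^ (-(5 : ℝ) / 6) * (n : ℝ) ^ ((1 : ℝ) / 3)

/-- `a_n(τ) = n/√2 − 2^{-5/6} τ² n^{1/3}`. -/
noncomputable def aC (n : ℕ) (τ : ℝ) : ℝ :=
  (n : ℝ) / Real.sqrt 2 - (2 : ℝ) ^ (-(5 : ℝ) / 6) * τ ^ 2 * (n : ℝ) ^ ((1 : ℝ) / 3)

/-- The rescaled time variable `τ = (2r − n(1+1/√2))·2^{1/6} n^{-2/3}`. -/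
noncomputable def tauC (n : ℕ) (r : ℤ) : ℝ :=
  (2 * (r : ℝ) - (n : ℝ) * (1 + 1 / Real.sqrt 2)) * (2 : ℝ) ^ ((1 : ℝ) / 6) *
    (n : ℝ) ^ (-(2 : ℝ) / 3)

/-- The rescaled space variable `ξ = (x − a_n(τ))/c_n`. -/
noncomputable def xiC (n : ℕ) (τ : ℝ) (x : ℤ) : ℝ := ((x : ℝ) - aC n τ) / cC n

open Complex in
/-- The integral of a function over circles centred at the origin does not depend on the radius as
long as the function is holomorphic between them. -/
theorem integral_circleMap_eq_of_annulus {f : ℂ → ℂ} {r R : ℝ} (hr : 0 < r) (hrR : r ≤ R)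
    (hf : ∀ z, r ≤ ‖z‖ → ‖z‖ ≤ R → DifferentiableAt ℂ f z) :
    ∫ θ in (-Real.pi)..Real.pi, f (circleMap 0 R θ) =
      ∫ θ in (-Real.pi)..Real.pi, f (circleMap 0 r θ) := by
  have key : ∀ ρ : ℝ, 0 < ρ → (∮ z in C(0, ρ), (z - 0)⁻¹ • f z) =
      I * ∫ θ in (-Real.pi)..Real.pi, f (circleMap 0 ρ θ) := by
    intro ρ hρ
    have hper : Function.Periodic (fun θ => f (circleMap 0 ρ θ)) (2 * Real.pi) :=
      (periodic_circleMap 0 ρ).comp f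
    have h := hper.intervalIntegral_add_eq (-Real.pi) 0
    rw [show -Real.pi + 2 * Real.pi = Real.pi by ring, zero_add] at h
    rw [h, circleIntegral, ← intervalIntegral.integral_const_mul]
    refine intervalIntegral.integral_congr fun θ _ => ?_
    have h0 : circleMap 0 ρ θ ≠ 0 := circleMap_ne_center hρ.ne'
    simp only [deriv_circleMap, sub_zero, smul_eq_mul]
    field_simp
  have h := circleIntegral_sub_center_inv_smul_eq_of_differentiable_on_annulus_off_countable
    (c := 0) (f := f) hr hrR Set.countable_empty
    (fun z hz => (hf z (by simpa using hz.2) (by simpa using hz.1)).continuousAt.continuousWithinAt)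
    (fun z hz => hf z (by simpa using (not_le.1 (by simpa using hz.1.2)).le)
      (by simpa using (mem_ball_zero_iff.1 hz.1.1).le))
  rw [key R (hr.trans_le hrR), key r hr] at h
  exact mul_left_cancel₀ I_ne_zero h

open Complex in
theorem tendsto_one_add_pow_exp_of_tendsto_mul {ι : Type*} {l : Filter ι} {w : ι → ℂ} {m : ι → ℕ}
    {t : ℂ} (hw : Tendsto w l (nhds 0)) (h : Tendsto (fun i => (m i : ℂ) * w i) l (nhds t)) :
    Tendsto (fun i => (1 + w i) ^ m i) l (nhds (exp t)) := by
  have hsmall : ∀ᶠ i in l, ‖w i‖ < 1 / 2 := by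
    exact hw.norm.eventually (gt_mem_nhds (by norm_num))
  have hdiff : Tendsto (fun i => (m i : ℂ) * (log (1 + w i) - w i)) l (nhds 0) := by
    refine squeeze_zero_norm' (a := fun i => ‖(m i : ℂ) * w i‖ * ‖w i‖) ?_
      (by simpa using h.norm.mul hw.norm)
    filter_upwards [hsmall] with i hi
    have h1 := norm_log_one_add_sub_self_le (z := w i) (by linarith)
    have h2 : (1 - ‖w i‖)⁻¹ ≤ 2 := by
      rw [inv_le_comm₀ (by linarith) (by norm_num)]
      linarith
    have h3 : ‖log (1 + w i) - w i‖ ≤ ‖w i‖ ^ 2 :=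
      h1.trans (by nlinarith [sq_nonneg ‖w i‖])
    rw [norm_mul, norm_mul, mul_assoc]
    gcongr
    rwa [← sq]
  have hlog : Tendsto (fun i => (m i : ℂ) * log (1 + w i)) l (nhds t) := by
    refine (by simpa using hdiff.add h : Tendsto _ l (nhds t)).congr fun i => ?_
    ring
  refine (hlog.cexp).congr' ?_
  filter_upwards [hsmall] with i hi
  have hne : 1 + w i ≠ 0 := by
    intro h0
    have : w i = -1 := by linear_combination h0
    rw [this] at hi
    norm_num at hi
  rw [exp_nat_mul, exp_log hne]

open Complex in
/-- A local limit theorem: the Fourier coefficients of a high power of a function whose modulus has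
a nondegenerate maximum at `0` are asymptotically Gaussian. -/
theorem tendsto_mul_integral_exp_mul_pow {ι : Type*} {l : Filter ι} [l.IsCountablyGenerated]
    {G : ℝ → ℂ} (hG : Continuous G) {κ : ℝ} (hκ : 0 < κ)
    (hGκ : ∀ θ, |θ| ≤ Real.pi → ‖G θ‖ ≤ Real.exp (-κ * θ ^ 2))
    {b : ℂ} (hGb : Tendsto (fun θ : ℝ => (G θ - 1) / (θ : ℂ) ^ 2) (nhdsWithin 0 {0}ᶜ) (nhds (-b)))
    {c : ι → ℝ} {m : ι → ℕ} {k : ι → ℤ} {L d : ℝ} (hL : 0 < L) (hc : Tendsto c l atTop)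
    (hm : Tendsto (fun i => (m i : ℝ) / c i ^ 2) l (nhds L))
    (hk : Tendsto (fun i => (k i : ℝ) / c i) l (nhds d)) :
    Tendsto
      (fun i => (c i : ℂ) * ∫ θ in (-Real.pi)..Real.pi, exp (I * k i * θ) * G θ ^ m i) l
      (nhds (∫ u : ℝ, exp (I * d * u) * exp (-(L * b) * u ^ 2))) := by
  have hc0 : ∀ᶠ i in l, 0 < c i := hc.eventually_gt_atTop 0
  set F : ι → ℝ → ℂ := fun i => Set.indicator (Set.Ioc (-Real.pi * c i) (Real.pi * c i))
    fun u => exp (I * k i * (u / c i : ℝ)) * G (u / c i) ^ m i with hF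
  have hlim : Tendsto (fun i => ∫ u, F i u) l
      (nhds (∫ u : ℝ, exp (I * d * u) * exp (-(L * b) * u ^ 2))) := by
    refine tendsto_integral_filter_of_dominated_convergence
      (fun u => Real.exp (-(κ * (L / 2)) * u ^ 2)) ?_ ?_
      (integrable_exp_neg_mul_sq (by positivity)) ?_
    · refine Eventually.of_forall fun i => ?_
      refine AEStronglyMeasurable.indicator ?_ measurableSet_Ioc
      exact (by fun_prop : Continuous _).aestronglyMeasurable
    · filter_upwards [hc0, hm.eventually (lt_mem_nhds (half_lt_self hL))] with i hi hmi
      refine Eventually.of_forall fun u => ?_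
      simp only [hF]
      by_cases hu : u ∈ Set.Ioc (-Real.pi * c i) (Real.pi * c i)
      · rw [Set.indicator_of_mem hu, norm_mul, norm_pow,
          show I * k i * (u / c i : ℝ) = ((k i * (u / c i) : ℝ) : ℂ) * I by push_cast; ring,
          norm_exp_ofReal_mul_I, one_mul]
        have hθ : |u / c i| ≤ Real.pi := by
          rw [abs_le, le_div_iff₀ hi, div_le_iff₀ hi]
          exact ⟨hu.1.le, hu.2⟩
        calc ‖G (u / c i)‖ ^ m i ≤ Real.exp (-κ * (u / c i) ^ 2) ^ m i := by
              gcongr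
              exact hGκ _ hθ
          _ = Real.exp (-(κ * (m i / c i ^ 2)) * u ^ 2) := by
              rw [← Real.exp_nat_mul]
              congr 1
              field_simp
          _ ≤ _ := by
              gcongr
      · rw [Set.indicator_of_notMem hu, norm_zero]
        positivity
    · have h0 : ∀ᵐ u : ℝ, u ≠ 0 := by simp [ae_iff]
      filter_upwards [h0] with u hu
      have hθ : Tendsto (fun i => u / c i) l (nhdsWithin 0 {0}ᶜ) := by
        refine tendsto_nhdsWithin_iff.2 ⟨hc.const_div_atTop u, ?_⟩
        filter_upwards [hc0] with i hi
        simp [hu, hi.ne']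
      have hq := hGb.comp hθ
      have hw : Tendsto (fun i => G (u / c i) - 1) l (nhds 0) := by
        have hsq : Tendsto (fun i => ((u / c i : ℝ) : ℂ) ^ 2) l (nhds 0) := by
          have := ((continuous_ofReal.tendsto 0).comp (hc.const_div_atTop u)).pow 2
          simpa using this
        have := hq.mul hsq
        rw [mul_zero] at this
        refine this.congr' ?_
        filter_upwards [hc0] with i hi
        have : ((u / c i : ℝ) : ℂ) ≠ 0 := by exact_mod_cast div_ne_zero hu hi.ne'
        simp only [Function.comp]
        field_simp
      have hmw : Tendsto (fun i => (m i : ℂ) * (G (u / c i) - 1)) l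
          (nhds (-(L * b) * u ^ 2)) := by
        have h1 : Tendsto (fun i => (((m i : ℝ) / c i ^ 2 : ℝ) : ℂ)) l (nhds (L : ℂ)) :=
          (continuous_ofReal.tendsto L).comp hm
        have h2 := (h1.mul hq).mul_const ((u : ℂ) ^ 2)
        rw [show (L : ℂ) * -b * (u : ℂ) ^ 2 = -(L * b) * u ^ 2 by ring] at h2
        refine h2.congr' ?_
        filter_upwards [hc0] with i hi
        have h3 : (c i : ℂ) ≠ 0 := by exact_mod_cast hi.ne'
        have h4 : (u : ℂ) ≠ 0 := by exact_mod_cast hu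
        simp only [Function.comp]
        push_cast
        field_simp
      have hpow := tendsto_one_add_pow_exp_of_tendsto_mul hw hmw
      have hexp : Tendsto (fun i => exp (I * k i * (u / c i : ℝ))) l (nhds (exp (I * d * u))) := by
        have h1 : Tendsto (fun i => (((k i : ℝ) / c i : ℝ) : ℂ)) l (nhds (d : ℂ)) :=
          (continuous_ofReal.tendsto d).comp hk
        refine (((h1.const_mul I).mul_const (u : ℂ)).cexp).congr fun i => ?_
        congr 1
        push_cast
        ring
      refine (hexp.mul hpow).congr' ?_
      filter_upwards [hc.eventually_gt_atTop (|u| / Real.pi), hc0] with i hi hi0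
      have hlt : |u| < Real.pi * c i := by
        rwa [div_lt_iff₀ Real.pi_pos, mul_comm] at hi
      simp only [hF]
      have hu' : u ∈ Set.Ioc (-Real.pi * c i) (Real.pi * c i) :=
        ⟨by linarith [(abs_lt.1 hlt).1], (abs_lt.1 hlt).2.le⟩
      rw [Set.indicator_of_mem hu', add_sub_cancel]
  refine hlim.congr' ?_
  filter_upwards [hc0] with i hi
  have hpi := Real.pi_pos
  simp only [hF]
  rw [integral_indicator measurableSet_Ioc,
    ← intervalIntegral.integral_of_le (by nlinarith),
    intervalIntegral.integral_comp_div (fun θ : ℝ => exp (I * k i * θ) * G θ ^ m i) hi.ne',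
    mul_div_cancel_right₀ _ hi.ne', mul_div_cancel_right₀ _ hi.ne', real_smul]

/-- The integrand of the transition function at the critical radius `√2 - 1`, normalized to take
the value `1` at angle `0`. -/
noncomputable def criticalSymbol (θ : ℝ) : ℂ :=
  ((Real.sqrt 2 - 1 : ℝ) : ℂ) * (1 + circleMap 0 (Real.sqrt 2 - 1) θ) /
    (Complex.exp (θ * Complex.I) * (1 - circleMap 0 (Real.sqrt 2 - 1) θ))

theorem sqrt_two_sub_one_pos : 0 < Real.sqrt 2 - 1 := by
  have : (1 : ℝ) < Real.sqrt 2 := Real.lt_sqrt_of_sq_lt (by norm_num)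
  linarith

theorem sqrt_two_sub_one_lt_half : Real.sqrt 2 - 1 < 1 / 2 := by
  have : Real.sqrt 2 < 3 / 2 := (Real.sqrt_lt' (by norm_num)).2 (by norm_num)
  linarith

theorem sqrt_two_sub_one_sq : (Real.sqrt 2 - 1) ^ 2 = 1 - 2 * (Real.sqrt 2 - 1) := by
  have : Real.sqrt 2 ^ 2 = 2 := Real.sq_sqrt (by norm_num)
  linear_combination this

theorem one_sub_circleMap_ne_zero {ρ : ℝ} (h0 : 0 ≤ ρ) (h1 : ρ < 1) (θ : ℝ) :
    1 - circleMap 0 ρ θ ≠ 0 := by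
  intro h
  have : ‖circleMap 0 ρ θ‖ = 1 := by rw [← sub_eq_zero.1 h, norm_one]
  rw [norm_circleMap_zero, abs_of_nonneg h0] at this
  exact h1.ne this

theorem continuous_criticalSymbol : Continuous criticalSymbol := by
  unfold criticalSymbol
  refine Continuous.div (by fun_prop) (by fun_prop) fun θ => ?_
  exact mul_ne_zero (Complex.exp_ne_zero _) (one_sub_circleMap_ne_zero sqrt_two_sub_one_pos.le
    (by linarith [sqrt_two_sub_one_lt_half]) θ)

open Complex in
theorem criticalSymbol_sub_one (θ : ℝ) :
    criticalSymbol θ - 1 = ((Real.sqrt 2 - 1 : ℝ) : ℂ) * (exp (θ * I) - 1) ^ 2 /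
      (exp (θ * I) * (1 - circleMap 0 (Real.sqrt 2 - 1) θ)) := by
  have h1 := one_sub_circleMap_ne_zero sqrt_two_sub_one_pos.le
    (by linarith [sqrt_two_sub_one_lt_half]) θ
  have h2 : (((Real.sqrt 2 - 1 : ℝ) : ℂ)) ^ 2 = 1 - 2 * ((Real.sqrt 2 - 1 : ℝ) : ℂ) := by
    exact_mod_cast sqrt_two_sub_one_sq
  have h3 := exp_ne_zero (θ * I)
  rw [criticalSymbol, div_sub_one (mul_ne_zero h3 h1)]
  congr 1
  simp only [circleMap, zero_add]
  linear_combination (exp (θ * I)) * h2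

open Complex in
theorem tendsto_criticalSymbol_sub_one_div_sq :
    Tendsto (fun θ : ℝ => (criticalSymbol θ - 1) / (θ : ℂ) ^ 2) (nhdsWithin 0 {0}ᶜ)
      (nhds (-((1 / Real.sqrt 2 : ℝ) : ℂ))) := by
  have hd : HasDerivAt (fun θ : ℝ => exp (θ * I)) I 0 := by
    have h := (((hasDerivAt_id (0 : ℝ)).ofReal_comp).mul_const I).cexp
    simpa using h
  have hs : Tendsto (fun θ : ℝ => (exp (θ * I) - 1) / (θ : ℂ)) (nhdsWithin 0 {0}ᶜ) (nhds I) := by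
    refine (hasDerivAt_iff_tendsto_slope.1 hd).congr fun θ => ?_
    simp [slope_def_module, div_eq_inv_mul]
  set ρ : ℝ := Real.sqrt 2 - 1 with hρ
  have hden : ∀ θ : ℝ, exp (θ * I) * (1 - circleMap 0 ρ θ) ≠ 0 := fun θ =>
    mul_ne_zero (exp_ne_zero _) (one_sub_circleMap_ne_zero sqrt_two_sub_one_pos.le
      (by linarith [sqrt_two_sub_one_lt_half]) θ)
  have hcont : Continuous fun θ : ℝ => (ρ : ℂ) / (exp (θ * I) * (1 - circleMap 0 ρ θ)) :=
    Continuous.div (by fun_prop) (by fun_prop) hden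
  have hq : Tendsto (fun θ : ℝ => (ρ : ℂ) / (exp (θ * I) * (1 - circleMap 0 ρ θ)))
      (nhdsWithin 0 {0}ᶜ) (nhds ((ρ : ℂ) / (1 - ρ))) := by
    have := (hcont.tendsto 0).mono_left (nhdsWithin_le_nhds (s := {0}ᶜ))
    simpa [circleMap] using this
  have hval : (ρ : ℂ) / (1 - ρ) * I ^ 2 = -((1 / Real.sqrt 2 : ℝ) : ℂ) := by
    have h2 : Real.sqrt 2 ≠ 0 := by positivity
    have h3 : 1 - ρ ≠ 0 := by linarith [sqrt_two_sub_one_lt_half]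
    have : ρ / (1 - ρ) = 1 / Real.sqrt 2 := by
      rw [div_eq_div_iff h3 h2, hρ]
      linear_combination Real.sq_sqrt (show (0 : ℝ) ≤ 2 by norm_num)
    rw [I_sq, ← this]
    push_cast
    ring
  rw [← hval]
  refine (hq.mul (hs.pow 2)).congr fun θ => ?_
  rw [criticalSymbol_sub_one, div_pow]
  ring

open Complex in
theorem norm_criticalSymbol_le (θ : ℝ) (hθ : |θ| ≤ Real.pi) :
    ‖criticalSymbol θ‖ ≤ Real.exp (-((Real.sqrt 2 - 1) / Real.pi ^ 2) * θ ^ 2) := by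
  have hpos := sqrt_two_sub_one_pos
  have hsq := sqrt_two_sub_one_sq
  have hne := one_sub_circleMap_ne_zero sqrt_two_sub_one_pos.le
    (by linarith [sqrt_two_sub_one_lt_half]) θ
  set ρ : ℝ := Real.sqrt 2 - 1 with hρ
  have hsc := Real.sin_sq_add_cos_sq θ
  have hplus : ‖1 + circleMap 0 ρ θ‖ ^ 2 = 1 + ρ ^ 2 + 2 * ρ * Real.cos θ := by
    rw [← normSq_eq_norm_sq, normSq_apply]
    simp [circleMap, exp_ofReal_mul_I_re, exp_ofReal_mul_I_im]
    linear_combination ρ ^ 2 * hsc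
  have hminus : ‖1 - circleMap 0 ρ θ‖ ^ 2 = 1 + ρ ^ 2 - 2 * ρ * Real.cos θ := by
    rw [← normSq_eq_norm_sq, normSq_apply]
    simp [circleMap, exp_ofReal_mul_I_re, exp_ofReal_mul_I_im]
    linear_combination ρ ^ 2 * hsc
  have hmpos : 0 < ‖1 - circleMap 0 ρ θ‖ ^ 2 := by positivity
  have hcos := Real.cos_le_one_sub_mul_cos_sq hθ
  have hcos1 := Real.cos_le_one θ
  have hcos2 := Real.neg_one_le_cos θ
  have hnorm : ‖criticalSymbol θ‖ ^ 2 ≤ 1 - ρ * (1 - Real.cos θ) := by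
    rw [criticalSymbol, ← hρ, norm_div, norm_mul, norm_mul, norm_exp_ofReal_mul_I, one_mul,
      div_pow, mul_pow, hplus, norm_real, Real.norm_eq_abs, sq_abs, div_le_iff₀ hmpos, hminus]
    have ht : 0 ≤ 1 - Real.cos θ := by linarith
    have ht2 : 0 ≤ 1 - ρ * (1 - Real.cos θ) := by
      nlinarith [sqrt_two_sub_one_lt_half]
    have e : (1 - ρ * (1 - Real.cos θ)) * (1 + ρ ^ 2 - 2 * ρ * Real.cos θ) -
        ρ ^ 2 * (1 + ρ ^ 2 + 2 * ρ * Real.cos θ) =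
        2 * ρ * (1 - Real.cos θ) * (1 - ρ * (1 - Real.cos θ)) := by
      linear_combination (-(1 - ρ * (1 - Real.cos θ)) - ρ ^ 2) * hsq
    have : 0 ≤ 2 * ρ * (1 - Real.cos θ) * (1 - ρ * (1 - Real.cos θ)) := by positivity
    linarith
  refine le_of_sq_le_sq ?_ (Real.exp_pos _).le
  rw [← Real.exp_nat_mul]
  refine hnorm.trans (le_trans ?_ (Real.add_one_le_exp _))
  have := mul_le_mul_of_nonneg_left hcos hpos.le
  push_cast
  linear_combination this

open Complex in
theorem zpow_mul_phiK (r s x y : ℤ) (hrs : r < s) :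
    (((Real.sqrt 2 - 1 : ℝ) : ℂ)) ^ (x - y + 2 * (s - r)) * phiK r s x y =
      1 / (2 * Real.pi) * ∫ θ in (-Real.pi)..Real.pi,
        exp (I * (y - x : ℤ) * θ) * criticalSymbol θ ^ (s - r).toNat := by
  have hpos := sqrt_two_sub_one_pos
  obtain ⟨m, hm⟩ : ∃ m : ℕ, s - r = m := ⟨(s - r).toNat, by omega⟩
  have h := integral_circleMap_eq_of_annulus
    (f := fun z => z ^ (y - x + r - s) * ((1 + z) / (1 - z)) ^ (s - r))
    sqrt_two_sub_one_pos sqrt_two_sub_one_lt_half.le fun z hz1 hz2 => by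
      have hz0 : z ≠ 0 := norm_pos_iff.1 (hpos.trans_le hz1)
      have hz : 1 - z ≠ 0 := by
        intro h
        rw [← sub_eq_zero.1 h] at hz2
        norm_num at hz2
      rw [hm]
      simp only [zpow_natCast]
      refine DifferentiableAt.mul (differentiableAt_zpow.2 (Or.inl hz0)) ?_
      refine DifferentiableAt.pow (DifferentiableAt.div ?_ ?_ hz) _ <;> fun_prop
  have hρ : ((Real.sqrt 2 - 1 : ℝ) : ℂ) ≠ 0 := by exact_mod_cast hpos.ne'
  have hpt : ∀ θ : ℝ, exp (I * (y - x : ℤ) * θ) * criticalSymbol θ ^ (s - r).toNat =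
      ((Real.sqrt 2 - 1 : ℝ) : ℂ) ^ (x - y + 2 * (s - r)) *
        (circleMap 0 (Real.sqrt 2 - 1) θ ^ (y - x + r - s) *
          ((1 + circleMap 0 (Real.sqrt 2 - 1) θ) / (1 - circleMap 0 (Real.sqrt 2 - 1) θ)) ^
            (s - r)) := by
    intro θ
    have h1 := one_sub_circleMap_ne_zero hpos.le (by linarith [sqrt_two_sub_one_lt_half]) θ
    have he := exp_ne_zero (θ * I)
    have hz : circleMap 0 (Real.sqrt 2 - 1) θ = ((Real.sqrt 2 - 1 : ℝ) : ℂ) * exp (θ * I) := by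
      simp [circleMap]
    rw [criticalSymbol, show I * (y - x : ℤ) * θ = (y - x : ℤ) * (θ * I) by ring, exp_int_mul,
      hm, Int.toNat_natCast, zpow_natCast, show y - x + r - s = (y - x) - m by omega,
      show x - y + 2 * (m : ℤ) = m + m - (y - x) by ring, zpow_sub₀ hρ, zpow_add₀ hρ,
      zpow_natCast]
    generalize (1 - circleMap 0 (Real.sqrt 2 - 1) θ) = A at *
    generalize (1 + circleMap 0 (Real.sqrt 2 - 1) θ) = B at *
    rw [hz, zpow_sub₀ (mul_ne_zero hρ he), mul_zpow, zpow_natCast, div_pow, div_pow, mul_pow,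
      mul_pow, mul_pow]
    have hρk := zpow_ne_zero (y - x) hρ
    generalize (((Real.sqrt 2 - 1 : ℝ) : ℂ)) ^ (y - x) = R at *
    field_simp
  simp_rw [hpt]
  rw [phiK, if_pos hrs, intervalIntegral.integral_const_mul, intervalIntegral.integral_const_mul,
    ← h]
  simp only [circleMap, zero_add, ofReal_div, ofReal_one, ofReal_ofNat]
  field_simp

theorem sub_div_cC_sq {n : ℕ} (hn : 0 < n) (r s : ℤ) :
    ((s : ℝ) - r) / cC n ^ 2 = Real.sqrt 2 * (tauC n s - tauC n r) := by
  have hn' : (0 : ℝ) < n := by exact_mod_cast hn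
  have hc : 0 < cC n := by unfold cC; positivity
  have h : cC n ^ 2 * (Real.sqrt 2 * (2 * (2 : ℝ) ^ ((1 : ℝ) / 6) * (n : ℝ) ^ (-(2 : ℝ) / 3))) =
      1 := by
    have h2 : (2 : ℝ) ^ (-(5 : ℝ) / 6) * (2 : ℝ) ^ (-(5 : ℝ) / 6) * (2 : ℝ) ^ ((1 : ℝ) / 2) *
        (2 : ℝ) ^ (1 : ℝ) * (2 : ℝ) ^ ((1 : ℝ) / 6) = 1 := by
      simp only [← Real.rpow_add (show (0 : ℝ) < 2 by norm_num)]
      norm_num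
    have h3 : (n : ℝ) ^ ((1 : ℝ) / 3) * (n : ℝ) ^ ((1 : ℝ) / 3) * (n : ℝ) ^ (-(2 : ℝ) / 3) = 1 := by
      simp only [← Real.rpow_add hn']
      norm_num
    rw [Real.rpow_one] at h2
    rw [cC, Real.sqrt_eq_rpow]
    linear_combination (n : ℝ) ^ ((1 : ℝ) / 3) * (n : ℝ) ^ ((1 : ℝ) / 3) *
      (n : ℝ) ^ (-(2 : ℝ) / 3) * h2 + h3
  rw [div_eq_iff (by positivity), tauC, tauC]
  linear_combination (-((s : ℝ) - r)) * h

theorem sub_div_cC {n : ℕ} (hn : 0 < n) (τ τ' : ℝ) (x y : ℤ) :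
    ((y : ℝ) - x) / cC n = xiC n τ' y - xiC n τ x + τ ^ 2 - τ' ^ 2 := by
  have hn' : (0 : ℝ) < n := by exact_mod_cast hn
  have hc : cC n ≠ 0 := by unfold cC; positivity
  have ha : ∀ t, aC n t = (n : ℝ) / Real.sqrt 2 - cC n * t ^ 2 := fun t => by
    rw [aC, cC]
    ring
  rw [xiC, xiC, ha, ha]
  field_simp
  ring

theorem tendsto_cC_atTop : Tendsto cC atTop atTop := by
  refine Tendsto.const_mul_atTop (by positivity) ?_
  exact (tendsto_rpow_atTop (by norm_num)).comp tendsto_natCast_atTop_atTop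

theorem integral_exp_mul_gaussian_eq_heatKernel {T : ℝ} (hT : 0 < T) (d : ℝ) :
    1 / (2 * Real.pi) * ∫ u : ℝ, Complex.exp (Complex.I * d * u) * Complex.exp (-T * u ^ 2) =
      (((Real.sqrt (4 * Real.pi * T))⁻¹ * Real.exp (-d ^ 2 / (4 * T)) : ℝ) : ℂ) := by
  have hpi := Real.pi_pos
  rw [fourierIntegral_gaussian (by simpa using hT)]
  have h : (Real.sqrt (4 * Real.pi * T))⁻¹ = 1 / (2 * Real.pi) * Real.sqrt (Real.pi / T) := by
    rw [show 4 * Real.pi * T = (2 * Real.pi) ^ 2 / (Real.pi / T) by field_simp; norm_num,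
      Real.sqrt_div (by positivity), Real.sqrt_sq (by positivity), inv_div]
    ring
  have h2 : ((Real.pi : ℂ) / T) ^ (1 / 2 : ℂ) = (Real.sqrt (Real.pi / T) : ℝ) := by
    rw [Real.sqrt_eq_rpow, Complex.ofReal_cpow (by positivity)]
    push_cast
    rfl
  rw [h, h2]
  push_cast
  ring

/-- Convergence (3.30): under the edge scaling, the transition-function part of the
extended Krawtchouk kernel converges to a Gaussian heat kernel:
`c_n (√2−1)^{x−y+2(s−r)} φ_{2r,2s}(x,y) → (4π(τ'−τ))^{−1/2} e^{−(ξ'−ξ+τ²−τ'²)²/(4(τ'−τ))}`. -/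
theorem stmt_11 (τ τ' ξ ξ' : ℝ) (hττ' : τ < τ')
    (r s x y : ℕ → ℤ) (hrs : ∀ n, r n < s n)
    (hτ : Tendsto (fun n : ℕ => tauC n (r n)) atTop (nhds τ))
    (hτ' : Tendsto (fun n : ℕ => tauC n (s n)) atTop (nhds τ'))
    (hξ : Tendsto (fun n : ℕ => xiC n (tauC n (r n)) (x n)) atTop (nhds ξ))
    (hξ' : Tendsto (fun n : ℕ => xiC n (tauC n (s n)) (y n)) atTop (nhds ξ')) :
    Tendsto
      (fun n : ℕ =>
        ((cC n : ℝ) : ℂ) *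
          (((Real.sqrt 2 - 1 : ℝ) : ℂ)) ^ (x n - y n + 2 * (s n - r n)) *
          phiK (r n) (s n) (x n) (y n))
      atTop
      (nhds
        ((((Real.sqrt (4 * Real.pi * (τ' - τ)))⁻¹ *
          Real.exp (-(ξ' - ξ + τ ^ 2 - τ' ^ 2) ^ 2 / (4 * (τ' - τ))) : ℝ) : ℂ))) := by
  set T : ℝ := τ' - τ with hTdef
  have hT : 0 < T := sub_pos.2 hττ'
  have hm : Tendsto (fun n => (((s n - r n).toNat : ℕ) : ℝ) / cC n ^ 2) atTop
      (nhds (Real.sqrt 2 * T)) := by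
    refine ((hτ'.sub hτ).const_mul (Real.sqrt 2)).congr' ?_
    filter_upwards [eventually_gt_atTop 0] with n hn
    rw [← sub_div_cC_sq hn]
    congr 1
    have h := Int.toNat_of_nonneg (sub_nonneg.2 (hrs n).le)
    exact_mod_cast h.symm
  have hk : Tendsto (fun n => ((y n - x n : ℤ) : ℝ) / cC n) atTop
      (nhds (ξ' - ξ + τ ^ 2 - τ' ^ 2)) := by
    refine (((hξ'.sub hξ).add (hτ.pow 2)).sub (hτ'.pow 2)).congr' ?_
    filter_upwards [eventually_gt_atTop 0] with n hn
    rw [← sub_div_cC hn]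
    push_cast
    rfl
  have h := (tendsto_mul_integral_exp_mul_pow continuous_criticalSymbol
    (div_pos sqrt_two_sub_one_pos (by positivity)) norm_criticalSymbol_le
    tendsto_criticalSymbol_sub_one_div_sq (by positivity) tendsto_cC_atTop hm hk).const_mul
      (1 / (2 * (Real.pi : ℂ)))
  have hLb : ((Real.sqrt 2 * T : ℝ) : ℂ) * ((1 / Real.sqrt 2 : ℝ) : ℂ) = T := by
    rw [← Complex.ofReal_mul]
    congr 1
    field_simp
  rw [hLb, integral_exp_mul_gaussian_eq_heatKernel hT] at h
  refine h.congr fun n => ?_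
  rw [mul_assoc ((cC n : ℝ) : ℂ), zpow_mul_phiK _ _ _ _ (hrs n)]
  ring
end

section
/- Let ℓ, ℓ′, u, u′ be integers with ℓ > ℓ′. For each positive integer N set n = 2N−1, x = 2ℓ − u + 1, x′ = 2ℓ′ − u′ + 1. Then lim_{N→∞} K_{2N−1}(2(ℓ+N), x; 2(ℓ′+N), x′) = (1/(2πi)) ∫_{γ₊} (dw/w) · w^{u−u′} · ((1−w)/(w(1+w)))^{ℓ−ℓ′}, where γ₊ is the right half of the unit circle, parametrized t ↦ e^{it}, −π/2 ≤ t ≤ π/2. -/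
open Filter MeasureTheory

/-- The extended Krawtchouk kernel `K_n(2r, x; 2s, y)` at weight `a = 1`, given by the
double contour integral with `γ` the circle `|w| = 1/3` and `Γ` the vertical line
`Re z = α₂`, where `α₂ = 1/2` if `r ≥ s` and `α₂ = −1/2` if `r < s` (by the cited
contour-independence any admissible contours give the same value). -/
noncomputable def Kbulk (n r s x y : ℤ) : ℂ :=
  let α₂ : ℝ := if s ≤ r then 1 / 2 else -(1 / 2)
  (1 / (2 * (Real.pi : ℂ) * Complex.I)) ^ 2 *
    ∫ t : ℝ,
      let z : ℂ := (α₂ : ℂ) + (t : ℂ) * Complex.I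
      (Complex.I / z) *
        ∫ θ in (-Real.pi)..Real.pi,
          let w : ℂ := 1 / 3 * Complex.exp ((θ : ℂ) * Complex.I)
          Complex.I *
            ((w ^ y * (1 - w) ^ (n - s) * (1 + 1 / w) ^ s) /
                (z ^ x * (1 - z) ^ (n - r) * (1 + 1 / z) ^ r) *
              (z / (z - w)))

open Topology Polynomial

/-- A holomorphic function on the slit plane has a primitive there. -/
lemma exists_primitive_slitPlane {f : ℂ → ℂ} (hf : DifferentiableOn ℂ f Complex.slitPlane) :
    ∃ F : ℂ → ℂ, ∀ z ∈ Complex.slitPlane, HasDerivAt F (f z) z := by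
  set s : Set ℂ := {z | z.im ∈ Set.Ioo (-Real.pi) Real.pi} with hs
  have hconv : Convex ℝ s := (convex_Ioo (-Real.pi) Real.pi).linear_preimage Complex.imLm
  have hopen : IsOpen s := isOpen_Ioo.preimage Complex.continuous_im
  have hexp : ∀ z ∈ s, Complex.exp z ∈ Complex.slitPlane := fun z hz => by
    rw [Complex.mem_slitPlane_iff_arg, ← Complex.log_im, Complex.log_exp hz.1 hz.2.le]
    exact ⟨hz.2.ne, Complex.exp_ne_zero z⟩
  obtain ⟨G, hG⟩ := hconv.exists_forall_hasDerivWithinAt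
    (f := fun z => f (Complex.exp z) * Complex.exp z)
    ((hf.comp Complex.differentiable_exp.differentiableOn hexp).mul
      Complex.differentiable_exp.differentiableOn)
  refine ⟨fun z => G (Complex.log z), fun z hz => ?_⟩
  have hlog : Complex.log z ∈ s := by
    have h := Complex.mem_slitPlane_iff_arg.1 hz
    exact ⟨by simpa using Complex.neg_pi_lt_log_im z,
      by simpa [Complex.log_im] using lt_of_le_of_ne (Complex.arg_le_pi z) h.1⟩
  have h1 := ((hG _ hlog).hasDerivAt (hopen.mem_nhds hlog)).comp z (Complex.hasDerivAt_log hz)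
  convert! h1 using 1
  have hz0 := Complex.slitPlane_ne_zero hz
  simp only [Complex.exp_log hz0]
  field_simp

lemma integrable_of_norm_le_div_sq {g : ℝ → ℂ} (hg : Continuous g) {C : ℝ}
    (hC : ∀ t, 1 ≤ |t| → ‖g t‖ ≤ C / t ^ 2) : Integrable g := by
  obtain ⟨B, hB⟩ := isCompact_Icc.exists_bound_of_continuousOn
    (s := Set.Icc (-1 : ℝ) 1) hg.continuousOn
  have hB0 : 0 ≤ B := (norm_nonneg _).trans (hB 0 (by norm_num))
  have hC0 : 0 ≤ C := by simpa using (norm_nonneg _).trans (hC 1 (by norm_num))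
  refine (integrable_inv_one_add_sq.const_mul (2 * (B + C))).mono' hg.aestronglyMeasurable
    (Eventually.of_forall fun t => ?_)
  rw [← div_eq_mul_inv, le_div_iff₀ (by positivity)]
  rcases le_total |t| 1 with h | h
  · have h2 : t ^ 2 ≤ 1 := (sq_le_one_iff_abs_le_one t).2 h
    nlinarith [hB t (abs_le.1 h), norm_nonneg (g t)]
  · have h2 : 1 ≤ t ^ 2 := (one_le_sq_iff_one_le_abs t).2 h
    have h3 := hC t h
    rw [le_div_iff₀ (by positivity)] at h3
    nlinarith [norm_nonneg (g t)]

lemma integral_vertical_line_eq {φ h : ℂ → ℂ} {C : ℝ}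
    (hφ : DifferentiableOn ℂ φ Complex.slitPlane)
    (hh : DifferentiableOn ℂ h {z | |z.re| < 1})
    (hC : ∀ z : ℂ, 0 ≤ z.re → z.re ≤ 1 / 2 → 1 ≤ |z.im| → ‖φ z - h z‖ ≤ C / z.im ^ 2) :
    ∫ t : ℝ, Complex.I * (φ (1 / 2 + t * Complex.I) - h (1 / 2 + t * Complex.I)) =
      (∫ t in (-(Real.pi / 2))..(Real.pi / 2),
        Complex.I * Complex.exp (Complex.I * t) * φ (Complex.exp (Complex.I * t)))
      - (∫ y in (-1 : ℝ)..1, Complex.I * h (y * Complex.I))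
      + (∫ y in Set.Ioi (1 : ℝ), Complex.I * (φ (y * Complex.I) - h (y * Complex.I)))
      + ∫ y in Set.Ioi (1 : ℝ),
          Complex.I * (φ ((-y : ℝ) * Complex.I) - h ((-y : ℝ) * Complex.I)) := by
  obtain ⟨Φ, hΦ⟩ := exists_primitive_slitPlane hφ
  have hsopen : IsOpen {z : ℂ | |z.re| < 1} :=
    isOpen_lt (continuous_abs.comp Complex.continuous_re) continuous_const
  have hsconv : Convex ℝ {z : ℂ | |z.re| < 1} := by
    simp only [abs_lt]
    exact (convex_Ioo (-1 : ℝ) 1).linear_preimage Complex.reLm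
  obtain ⟨Ψ, hΨ'⟩ := hsconv.exists_forall_hasDerivWithinAt hh
  have hΨ : ∀ z : ℂ, |z.re| < 1 → HasDerivAt Ψ (h z) z := fun z hz =>
    (hΨ' z hz).hasDerivAt (hsopen.mem_nhds hz)
  have hcφ : ∀ z ∈ Complex.slitPlane, ContinuousAt φ z := fun z hz =>
    (hφ.differentiableAt (Complex.isOpen_slitPlane.mem_nhds hz)).continuousAt
  have hch : ∀ z : ℂ, |z.re| < 1 → ContinuousAt h z := fun z hz =>
    (hh.differentiableAt (hsopen.mem_nhds hz)).continuousAt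
  -- affine paths
  have hpath : ∀ (c v : ℂ) (t : ℝ), HasDerivAt (fun t : ℝ => c + t * v) v t := fun c v t => by
    simpa using ((Complex.ofRealCLM.hasDerivAt (x := t)).mul_const v).const_add c
  have hcpath : ∀ (c v : ℂ), Continuous (fun t : ℝ => c + t * v) := fun c v => by fun_prop
  have hcf : ∀ (c v : ℂ) (t : ℝ), c + t * v ∈ Complex.slitPlane → |(c + t * v).re| < 1 →
      ContinuousAt (fun t : ℝ => v * (φ (c + t * v) - h (c + t * v))) t := fun c v t h1 h2 =>
    continuousAt_const.mul
      ((ContinuousAt.comp (f := fun t : ℝ => c + t * v) (hcφ _ h1) (hcpath c v).continuousAt).sub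
      (ContinuousAt.comp (f := fun t : ℝ => c + t * v) (hch _ h2) (hcpath c v).continuousAt))
  have hF : ∀ (c v : ℂ) (a b : ℝ),
      (∀ t ∈ Set.uIcc a b, c + t * v ∈ Complex.slitPlane ∧ |(c + t * v).re| < 1) →
      ∫ t in a..b, v * (φ (c + t * v) - h (c + t * v)) =
        (Φ (c + b * v) - Ψ (c + b * v)) - (Φ (c + a * v) - Ψ (c + a * v)) := by
    intro c v a b hab
    refine intervalIntegral.integral_eq_sub_of_hasDerivAt
      (f := fun t : ℝ => Φ (c + t * v) - Ψ (c + t * v)) (fun t ht => ?_) ?_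
    · have := ((hΦ _ (hab t ht).1).scomp t (hpath c v t)).sub
        ((hΨ _ (hab t ht).2).scomp t (hpath c v t))
      convert! this using 1
      simp only [smul_eq_mul]
      ring
    · refine ContinuousOn.intervalIntegrable fun t ht => ContinuousAt.continuousWithinAt ?_
      exact hcf c v t (hab t ht).1 (hab t ht).2
  have hmem : ∀ z : ℂ, 0 ≤ z.re → z.re ≤ 1 / 2 → (z.re = 0 → z.im ≠ 0) →
      z ∈ Complex.slitPlane ∧ |z.re| < 1 := by
    intro z h0 h1 h3
    refine ⟨?_, abs_lt.2 ⟨by linarith, by linarith⟩⟩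
    rcases h0.eq_or_lt with h | h
    · exact Or.inr (h3 h.symm)
    · exact Or.inl h
  -- the arc
  have harc : (∫ t in (-(Real.pi / 2))..(Real.pi / 2),
        Complex.I * Complex.exp (Complex.I * t) * φ (Complex.exp (Complex.I * t))) =
      Φ Complex.I - Φ (-Complex.I) := by
    have hslit : ∀ t ∈ Set.uIcc (-(Real.pi / 2)) (Real.pi / 2),
        Complex.exp (Complex.I * t) ∈ Complex.slitPlane := fun t ht => by
      rw [Set.uIcc_of_le (by linarith [Real.pi_pos])] at ht
      rw [mul_comm, Complex.mem_slitPlane_iff_arg, Complex.arg_exp_mul_I,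
        (toIocMod_eq_self _).2 ⟨by linarith [ht.1, Real.pi_pos], by linarith [ht.2, Real.pi_pos]⟩]
      exact ⟨by linarith [ht.2, Real.pi_pos], Complex.exp_ne_zero _⟩
    have hd : ∀ t : ℝ, HasDerivAt (fun t : ℝ => Complex.exp (Complex.I * t))
        (Complex.I * Complex.exp (Complex.I * t)) t := fun t => by
      have := ((Complex.ofRealCLM.hasDerivAt (x := t)).const_mul Complex.I).cexp
      simpa [mul_comm] using this
    rw [intervalIntegral.integral_eq_sub_of_hasDerivAt
      (f := fun t : ℝ => Φ (Complex.exp (Complex.I * t)))]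
    · congr 2
      · rw [mul_comm]; push_cast; exact Complex.exp_pi_div_two_mul_I
      · rw [mul_comm]; push_cast; rw [neg_mul, Complex.exp_neg, Complex.exp_pi_div_two_mul_I,
          Complex.inv_I]
    · intro t ht
      exact (hΦ _ (hslit t ht)).scomp t (hd t)
    · refine ContinuousOn.intervalIntegrable fun t ht => ContinuousAt.continuousWithinAt ?_
      exact (by fun_prop : Continuous fun t : ℝ => Complex.I * Complex.exp (Complex.I * t)).continuousAt.mul
        (ContinuousAt.comp (f := fun t : ℝ => Complex.exp (Complex.I * t)) (hcφ _ (hslit t ht))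
          (hd t).continuousAt)
  have hseg : (∫ y in (-1 : ℝ)..1, Complex.I * h (y * Complex.I)) =
      Ψ Complex.I - Ψ (-Complex.I) := by
    have hd : ∀ t : ℝ, HasDerivAt (fun t : ℝ => (t : ℂ) * Complex.I) Complex.I t := fun t => by
      simpa using hpath 0 Complex.I t
    rw [intervalIntegral.integral_eq_sub_of_hasDerivAt (f := fun t : ℝ => Ψ (t * Complex.I))]
    · simp
    · intro t ht
      exact (hΨ _ (by simp)).scomp t (hd t)
    · refine ContinuousOn.intervalIntegrable fun t ht => ContinuousAt.continuousWithinAt ?_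
      exact continuousAt_const.mul
        (ContinuousAt.comp (f := fun t : ℝ => (t : ℂ) * Complex.I) (hch _ (by simp))
          (hd t).continuousAt)
  have hline : Integrable fun t : ℝ =>
      Complex.I * (φ (1 / 2 + t * Complex.I) - h (1 / 2 + t * Complex.I)) := by
    refine integrable_of_norm_le_div_sq (C := C) ?_ fun t ht => ?_
    · rw [continuous_iff_continuousAt]
      intro t
      have := hmem (1 / 2 + t * Complex.I) (by simp) (by simp)
        (by simp)
      exact hcf _ _ t this.1 this.2
    · have := hC (1 / 2 + t * Complex.I) (by simp) (by simp) (by simpa using ht)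
      simpa using this
  have hvert : ∀ ε : ℝ, |ε| = 1 → IntegrableOn
      (fun y : ℝ => (ε * Complex.I) * (φ (0 + y * (ε * Complex.I)) - h (0 + y * (ε * Complex.I))))
      (Set.Ioi 1) := by
    intro ε hε
    have hε2 : ε ^ 2 = 1 := by rw [← sq_abs, hε, one_pow]
    have hε0 : ε ≠ 0 := by rintro rfl; simp at hε
    refine ((integrable_inv_one_add_sq.const_mul (2 * C)).integrableOn).mono' ?_ ?_
    · refine ContinuousOn.aestronglyMeasurable (fun t ht => ContinuousAt.continuousWithinAt ?_)
        measurableSet_Ioi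
      have ht0 : t ≠ 0 := (zero_lt_one.trans ht).ne'
      have := hmem (0 + t * (ε * Complex.I)) (by simp) (by simp)
        (by simp [hε0, ht0])
      exact hcf _ _ t this.1 this.2
    · refine (ae_restrict_iff' measurableSet_Ioi).2 (Eventually.of_forall fun t ht => ?_)
      have ht : 1 < t := ht
      have := hC (0 + t * (ε * Complex.I)) (by simp) (by simp)
        (by simp [abs_mul, hε, abs_of_pos (zero_lt_one.trans ht), ht.le])
      have h2 : ((0 + t * (ε * Complex.I) : ℂ)).im ^ 2 = t ^ 2 := by simp [mul_pow, hε2]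
      rw [h2, le_div_iff₀ (by positivity)] at this
      rw [norm_mul, norm_mul, Complex.norm_real, Real.norm_eq_abs, hε, Complex.norm_I, one_mul,
        one_mul, ← div_eq_mul_inv, le_div_iff₀ (by positivity)]
      have h3 : (1 : ℝ) + t ^ 2 ≤ 2 * t ^ 2 := by nlinarith
      linarith [mul_le_mul_of_nonneg_left h3
        (norm_nonneg (φ (0 + t * (ε * Complex.I)) - h (0 + t * (ε * Complex.I))))]
  have hhor : ∀ ε : ℝ, |ε| = 1 → Tendsto (fun T : ℝ =>
      (Φ (1 / 2 + T * (ε * Complex.I)) - Ψ (1 / 2 + T * (ε * Complex.I))) -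
        (Φ (T * (ε * Complex.I)) - Ψ (T * (ε * Complex.I)))) atTop (𝓝 0) := by
    intro ε hε
    have hε2 : ε ^ 2 = 1 := by rw [← sq_abs, hε, one_pow]
    have hε0 : ε ≠ 0 := by rintro rfl; simp at hε
    have hlim : Tendsto (fun T : ℝ => C / T ^ 2 * |(1 / 2 : ℝ) - 0|) atTop (𝓝 0) := by
      simpa using ((tendsto_pow_atTop (α := ℝ) two_ne_zero).const_div_atTop C).mul_const
        |(1 / 2 : ℝ) - 0|
    refine squeeze_zero_norm' ?_ hlim
    filter_upwards [eventually_ge_atTop 1] with T hT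
    have hT0 : T ≠ 0 := (zero_lt_one.trans_le hT).ne'
    have hre : ∀ x ∈ Set.uIcc (0 : ℝ) (1 / 2), 0 ≤ x ∧ x ≤ 1 / 2 := fun x hx => by
      rwa [Set.uIcc_of_le (by norm_num)] at hx
    have := hF (T * (ε * Complex.I)) 1 0 (1 / 2) fun x hx =>
      hmem _ (by simpa using (hre x hx).1) (by simpa using (hre x hx).2)
        (by simp [hT0, hε0])
    have e : ((1 / 2 : ℂ) + T * (ε * Complex.I)) =
      T * (ε * Complex.I) + ((1 / 2 : ℝ) : ℂ) * 1 := by push_cast; ring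
    simp only [Complex.ofReal_zero, zero_mul, add_zero] at this
    rw [e, ← this]
    refine intervalIntegral.norm_integral_le_of_norm_le_const fun x hx => ?_
    have hx' := hre x (Set.uIoc_subset_uIcc hx)
    have := hC (T * (ε * Complex.I) + x * 1) (by simpa using hx'.1) (by simpa using hx'.2)
      (by simp [abs_mul, hε, abs_of_pos (zero_lt_one.trans_le hT), hT])
    have h2 : ((T * (ε * Complex.I) + x * 1 : ℂ)).im ^ 2 = T ^ 2 := by simp [mul_pow, hε2]
    rwa [h2, ← one_mul ‖_‖, ← norm_one (α := ℂ), ← norm_mul] at this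
  have hA := intervalIntegral_tendsto_integral hline tendsto_neg_atTop_atBot tendsto_id
  have hU := intervalIntegral_tendsto_integral_Ioi 1 (hvert 1 (by simp)) tendsto_id
  have hD := intervalIntegral_tendsto_integral_Ioi 1 (hvert (-1) (by simp)) tendsto_id
  have key := ((((hhor 1 (by simp)).sub (hhor (-1) (by simp))).add hU).sub hD).add_const
    ((Φ Complex.I - Φ (-Complex.I)) - (Ψ Complex.I - Ψ (-Complex.I)))
  have hEq := tendsto_nhds_unique (hA.congr' ?_) key
  · rw [hEq, harc, hseg]
    have hneg : (∫ y in Set.Ioi (1 : ℝ), (((-1 : ℝ) : ℂ) * Complex.I) *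
        (φ (0 + y * (((-1 : ℝ) : ℂ) * Complex.I)) - h (0 + y * (((-1 : ℝ) : ℂ) * Complex.I)))) =
        -∫ y in Set.Ioi (1 : ℝ),
          Complex.I * (φ ((-y : ℝ) * Complex.I) - h ((-y : ℝ) * Complex.I)) := by
      rw [← integral_neg]
      congr 1
      ext y
      push_cast
      ring_nf
    rw [hneg]
    simp only [Complex.ofReal_one, one_mul, zero_add]
    ring
  · filter_upwards [eventually_ge_atTop 1] with T hT
    have h0 : ∀ t ∈ Set.uIcc (1 : ℝ) T, t ≠ 0 := fun t ht => by
      rw [Set.uIcc_of_le hT] at ht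
      exact (zero_lt_one.trans_le ht.1).ne'
    have h1 := hF (1 / 2) Complex.I (-T) T fun t _ => hmem _ (by simp) (by simp)
      (by simp)
    have h2 := fun (ε : ℝ) (hε : ε ≠ 0) => hF 0 (ε * Complex.I) 1 T fun t ht =>
      hmem _ (by simp) (by simp) (by simp [hε, h0 t ht])
    simp only [id]
    rw [h1, h2 1 one_ne_zero, h2 (-1) (by norm_num)]
    push_cast
    simp only [one_mul, zero_add, neg_mul, mul_neg]
    ring


/-- The part of the Laurent polynomial `Q(z) / z ^ M` with negative exponents. -/
noncomputable def laurentNeg (Q : ℂ[X]) (M : ℕ) (z : ℂ) : ℂ :=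
  ∑ k ∈ Finset.range M, Q.coeff k * (z ^ k / z ^ M)

/-- The part of the Laurent polynomial `Q(z) / z ^ M` with nonnegative exponents. -/
noncomputable def laurentPos (Q : ℂ[X]) (M : ℕ) (z : ℂ) : ℂ :=
  ∑ k ∈ Finset.range (Q.natDegree + 1), Q.coeff (M + k) * z ^ k

lemma eval_div_pow_eq (Q : ℂ[X]) (M : ℕ) {z : ℂ} (hz : z ≠ 0) :
    Q.eval z / z ^ M = laurentNeg Q M z + laurentPos Q M z := by
  rw [eval_eq_sum_range' (n := M + (Q.natDegree + 1)) (by omega), Finset.sum_range_add,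
    laurentNeg, laurentPos, add_div, Finset.sum_div, Finset.sum_div]
  congr 1
  · exact Finset.sum_congr rfl fun k _ => mul_div_assoc _ _ _
  · refine Finset.sum_congr rfl fun k _ => ?_
    rw [pow_add]
    field_simp

lemma differentiable_laurentPos (Q : ℂ[X]) (M : ℕ) : Differentiable ℂ (laurentPos Q M) := by
  unfold laurentPos
  fun_prop

lemma sq_sum_coeff_le (Q : ℂ[X]) (s : Finset ℕ) :
    ∑ k ∈ s, ‖Q.coeff k‖ ^ 2 ≤ ∑ k ∈ Q.support, ‖Q.coeff k‖ ^ 2 := by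
  rw [← Finset.sum_filter_add_sum_filter_not s (· ∈ Q.support)]
  rw [Finset.sum_eq_zero (s := s.filter (· ∉ Q.support)), add_zero]
  · exact Finset.sum_le_sum_of_subset_of_nonneg
      (fun k hk => (Finset.mem_filter.1 hk).2) fun _ _ _ => by positivity
  · intro k hk
    simp [notMem_support_iff.1 (Finset.mem_filter.1 hk).2]

lemma norm_laurentNeg_le (Q : ℂ[X]) (M : ℕ) {z : ℂ} (hz : 1 < ‖z‖) :
    ‖laurentNeg Q M z‖ ≤ √(∑ k ∈ Q.support, ‖Q.coeff k‖ ^ 2) / √(‖z‖ ^ 2 - 1) := by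
  have hz1 : 0 < ‖z‖ ^ 2 - 1 := by nlinarith
  have h1 : ‖laurentNeg Q M z‖ ≤
      ∑ k ∈ Finset.range M, ‖Q.coeff k‖ * (‖z‖ ^ k / ‖z‖ ^ M) :=
    (norm_sum_le _ _).trans_eq (by simp)
  have h2 : ∑ k ∈ Finset.range M, (‖z‖ ^ k / ‖z‖ ^ M) ^ 2 ≤ (‖z‖ ^ 2 - 1)⁻¹ := by
    have : ∀ k, (‖z‖ ^ k / ‖z‖ ^ M) ^ 2 = (‖z‖ ^ 2) ^ k / (‖z‖ ^ 2) ^ M := fun k => by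
      rw [div_pow, ← pow_mul, ← pow_mul, ← pow_mul, ← pow_mul, mul_comm k, mul_comm M]
    simp only [this]
    rw [← Finset.sum_div, geom_sum_eq (by linarith), div_div, inv_eq_one_div,
      div_le_div_iff₀ (by positivity) hz1]
    have : 0 < (‖z‖ ^ 2) ^ M := by positivity
    nlinarith
  refine h1.trans ((Real.sum_mul_le_sqrt_mul_sqrt _ _ _).trans ?_)
  rw [div_eq_mul_inv, ← Real.sqrt_inv]
  exact mul_le_mul (Real.sqrt_le_sqrt (sq_sum_coeff_le Q _)) (Real.sqrt_le_sqrt h2)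
    (Real.sqrt_nonneg _) (Real.sqrt_nonneg _)

lemma norm_laurentPos_le (Q : ℂ[X]) (M : ℕ) {z : ℂ} (hz : ‖z‖ < 1) :
    ‖laurentPos Q M z‖ ≤ √(∑ k ∈ Q.support, ‖Q.coeff k‖ ^ 2) / √(1 - ‖z‖ ^ 2) := by
  have hz1 : 0 < 1 - ‖z‖ ^ 2 := by nlinarith [norm_nonneg z]
  have h1 : ‖laurentPos Q M z‖ ≤
      ∑ k ∈ Finset.range (Q.natDegree + 1), ‖Q.coeff (M + k)‖ * ‖z‖ ^ k :=
    (norm_sum_le _ _).trans_eq (by simp)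
  have h2 : ∑ k ∈ Finset.range (Q.natDegree + 1), (‖z‖ ^ k) ^ 2 ≤ (1 - ‖z‖ ^ 2)⁻¹ := by
    have : ∀ k, (‖z‖ ^ k) ^ 2 = (‖z‖ ^ 2) ^ k := fun k => by
      rw [← pow_mul, ← pow_mul, mul_comm k]
    simp only [this]
    rw [geom_sum_eq (by linarith), ← neg_div_neg_eq, inv_eq_one_div,
      div_le_div_iff₀ (by linarith) hz1]
    have : 0 ≤ (‖z‖ ^ 2) ^ (Q.natDegree + 1) := by positivity
    nlinarith
  have h3 : ∑ k ∈ Finset.range (Q.natDegree + 1), ‖Q.coeff (M + k)‖ ^ 2 ≤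
      ∑ k ∈ Q.support, ‖Q.coeff k‖ ^ 2 := by
    refine le_trans (le_of_eq ?_) (sq_sum_coeff_le Q
      ((Finset.range (Q.natDegree + 1)).map (addLeftEmbedding M)))
    rw [Finset.sum_map]
    rfl
  refine h1.trans ((Real.sum_mul_le_sqrt_mul_sqrt _ _ _).trans ?_)
  rw [div_eq_mul_inv, ← Real.sqrt_inv]
  exact mul_le_mul (Real.sqrt_le_sqrt h3) (Real.sqrt_le_sqrt h2)
    (Real.sqrt_nonneg _) (Real.sqrt_nonneg _)

lemma norm_laurentNeg_le_sum (Q : ℂ[X]) (M : ℕ) {z : ℂ} (hz : 1 ≤ ‖z‖) :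
    ‖laurentNeg Q M z‖ ≤ ∑ k ∈ Finset.range M, ‖Q.coeff k‖ := by
  refine (norm_sum_le _ _).trans (Finset.sum_le_sum fun k hk => ?_)
  rw [norm_mul, norm_div, norm_pow, norm_pow]
  refine mul_le_of_le_one_right (norm_nonneg _) (div_le_one_of_le₀ ?_ (by positivity))
  exact pow_le_pow_right₀ hz (Finset.mem_range.1 hk).le

lemma circleIntegral_inv_pow_mul_inv_sub {R : ℝ} (hR : 0 < R) {z : ℂ} (hz : R < ‖z‖) (j : ℕ) :
    (∮ w in C(0, R), (w ^ (j + 1))⁻¹ * (z - w)⁻¹) =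
      2 * Real.pi * Complex.I * (z ^ (j + 1))⁻¹ := by
  have hz0 : z ≠ 0 := norm_pos_iff.1 (hR.trans hz)
  have hw0 : ∀ w ∈ Metric.sphere (0 : ℂ) R, w ≠ 0 := fun w hw => by
    rw [mem_sphere_zero_iff_norm] at hw
    exact norm_pos_iff.1 (hw ▸ hR)
  have hzw : ∀ w ∈ Metric.closedBall (0 : ℂ) R, z - w ≠ 0 := fun w hw h => by
    rw [mem_closedBall_zero_iff, ← sub_eq_zero.1 h] at hw
    linarith
  have hcont : ∀ i : ℕ, ContinuousOn (fun w : ℂ => (w ^ i)⁻¹) (Metric.sphere 0 R) := fun i =>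
    (continuous_pow i).continuousOn.inv₀ fun w hw => pow_ne_zero _ (hw0 w hw)
  have hcont' : ContinuousOn (fun w : ℂ => (z - w)⁻¹) (Metric.sphere 0 R) :=
    (by fun_prop : Continuous fun w : ℂ => z - w).continuousOn.inv₀ fun w hw =>
      hzw w (Metric.sphere_subset_closedBall hw)
  have hstep : ∀ i : ℕ, (∮ w in C(0, R), (w ^ (i + 1))⁻¹ * (z - w)⁻¹) =
      z⁻¹ * ((∮ w in C(0, R), (w ^ (i + 1))⁻¹) + ∮ w in C(0, R), (w ^ i)⁻¹ * (z - w)⁻¹) := by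
    intro i
    rw [← circleIntegral.integral_add (f := fun w => (w ^ (i + 1))⁻¹)
      (g := fun w => (w ^ i)⁻¹ * (z - w)⁻¹) ((hcont _).circleIntegrable hR.le)
      (((hcont i).mul hcont').circleIntegrable hR.le), ← circleIntegral.integral_const_mul]
    refine circleIntegral.integral_congr hR.le fun w hw => ?_
    have h1 := hw0 w hw
    have h2 := hzw w (Metric.sphere_subset_closedBall hw)
    field_simp
    ring
  induction j with
  | zero =>
    rw [hstep]
    have h0 : (∮ w in C(0, R), (w ^ 0)⁻¹ * (z - w)⁻¹) = 0 := by
      refine DiffContOnCl.circleIntegral_eq_zero hR.le (DifferentiableOn.diffContOnCl ?_)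
      intro w hw
      have := hzw w (Metric.closure_ball_subset_closedBall hw)
      have h' : DifferentiableAt ℂ (fun w : ℂ => (w ^ 0)⁻¹ * (z - w)⁻¹) w := by
        simp only [pow_zero, inv_one, one_mul]
        exact (by fun_prop : DifferentiableAt ℂ (fun w : ℂ => z - w) w).inv this
      exact h'.differentiableWithinAt
    have h1 := circleIntegral.integral_sub_center_inv (0 : ℂ) hR.ne'
    simp only [sub_zero] at h1
    simp only [zero_add, pow_one] at h0 ⊢
    rw [h0, h1]
    ring
  | succ j ih =>
    rw [hstep, ih]
    have h1 := circleIntegral.integral_sub_zpow_of_ne (n := -(j + 2 : ℕ)) (by omega) 0 0 R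
    simp only [sub_zero, zpow_neg, zpow_natCast] at h1
    rw [h1, pow_succ z (j + 1), mul_inv]
    ring

lemma circleIntegral_eval_div_pow_mul_inv_sub (Q : ℂ[X]) (M : ℕ) {R : ℝ} (hR : 0 < R) {z : ℂ}
    (hz : R < ‖z‖) :
    (∮ w in C(0, R), Q.eval w / w ^ M * (z - w)⁻¹) =
      2 * Real.pi * Complex.I * laurentNeg Q M z := by
  have hw0 : ∀ w ∈ Metric.sphere (0 : ℂ) R, w ≠ 0 := fun w hw => by
    rw [mem_sphere_zero_iff_norm] at hw
    exact norm_pos_iff.1 (hw ▸ hR)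
  have hz0 : z ≠ 0 := norm_pos_iff.1 (hR.trans hz)
  have hzw : ∀ w ∈ Metric.closedBall (0 : ℂ) R, z - w ≠ 0 := fun w hw h => by
    rw [mem_closedBall_zero_iff, ← sub_eq_zero.1 h] at hw
    linarith
  have hcont' : ContinuousOn (fun w : ℂ => (z - w)⁻¹) (Metric.sphere 0 R) :=
    (by fun_prop : Continuous fun w : ℂ => z - w).continuousOn.inv₀ fun w hw =>
      hzw w (Metric.sphere_subset_closedBall hw)
  have hterm : ∀ k ∈ Finset.range M, CircleIntegrable
      (fun w : ℂ => Q.coeff k * ((w ^ k / w ^ M) * (z - w)⁻¹)) 0 R := fun k _ =>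
    (continuousOn_const.mul (((continuous_pow k).continuousOn.div (continuous_pow M).continuousOn
      fun w hw => pow_ne_zero _ (hw0 w hw)).mul hcont')).circleIntegrable hR.le
  have hpos : (∮ w in C(0, R), laurentPos Q M w * (z - w)⁻¹) = 0 := by
    refine DiffContOnCl.circleIntegral_eq_zero hR.le (DifferentiableOn.diffContOnCl ?_)
    intro w hw
    have := hzw w (Metric.closure_ball_subset_closedBall hw)
    exact ((differentiable_laurentPos Q M w).mul
      ((by fun_prop : DifferentiableAt ℂ (fun w : ℂ => z - w) w).inv this)).differentiableWithinAt
  have hneg : (∮ w in C(0, R), laurentNeg Q M w * (z - w)⁻¹) =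
      2 * Real.pi * Complex.I * laurentNeg Q M z := by
    simp only [laurentNeg, Finset.sum_mul, mul_assoc (Q.coeff _)]
    rw [circleIntegral.integral_fun_sum hterm, Finset.mul_sum]
    refine Finset.sum_congr rfl fun k hk => ?_
    obtain ⟨j, rfl⟩ := Nat.exists_eq_add_of_lt (Finset.mem_range.1 hk)
    have hdiv : ∀ w : ℂ, w ≠ 0 → w ^ k / w ^ (k + j + 1) = (w ^ (j + 1))⁻¹ := fun w hw => by
      rw [add_assoc, pow_add]
      field_simp
    rw [circleIntegral.integral_const_mul, hdiv z hz0,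
      circleIntegral.integral_congr hR.le (g := fun w => (w ^ (j + 1))⁻¹ * (z - w)⁻¹)
        (fun w hw => by simp only [hdiv w (hw0 w hw)]),
      circleIntegral_inv_pow_mul_inv_sub hR hz]
    ring
  rw [circleIntegral.integral_congr hR.le
    (g := fun w => laurentNeg Q M w * (z - w)⁻¹ + laurentPos Q M w * (z - w)⁻¹)
    (fun w hw => by simp only [eval_div_pow_eq Q M (hw0 w hw), add_mul]),
    circleIntegral.integral_add, hneg, hpos, add_zero]
  · have := CircleIntegrable.fun_sum _ hterm
    simpa only [laurentNeg, Finset.sum_mul, mul_assoc (Q.coeff _)] using this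
  · exact ((differentiable_laurentPos Q M).continuous.continuousOn.mul hcont').circleIntegrable
      hR.le


lemma tendsto_integral_sin_pow_zero :
    Tendsto (fun j : ℕ => ∫ θ in (0 : ℝ)..2 * Real.pi, (Real.sin θ ^ 2) ^ j) atTop (𝓝 0) := by
  have h : Tendsto (fun j : ℕ => ∫ θ in (0 : ℝ)..2 * Real.pi, (Real.sin θ ^ 2) ^ j) atTop
      (𝓝 (∫ _ in (0 : ℝ)..2 * Real.pi, (0 : ℝ))) := by
    refine intervalIntegral.tendsto_integral_filter_of_dominated_convergence (fun _ => (1 : ℝ))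
      (Eventually.of_forall fun j => (by fun_prop : Continuous fun θ : ℝ =>
        (Real.sin θ ^ 2) ^ j).aestronglyMeasurable)
      (Eventually.of_forall fun j => Eventually.of_forall fun θ _ => ?_)
      intervalIntegrable_const ?_
    · rw [Real.norm_of_nonneg (by positivity)]
      exact pow_le_one₀ (sq_nonneg _) (Real.sin_sq_le_one θ)
    · have hcount : {θ : ℝ | Real.cos θ = 0}.Countable := by
        have : {θ : ℝ | Real.cos θ = 0} = Set.range fun k : ℤ => (2 * k + 1) * Real.pi / 2 := by
          ext θ
          exact Real.cos_eq_zero_iff.trans (exists_congr fun k => eq_comm)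
        rw [this]
        exact Set.countable_range _
      filter_upwards [hcount.ae_notMem volume] with θ hθ _
      refine tendsto_pow_atTop_nhds_zero_of_lt_one (sq_nonneg _) ?_
      have : Real.cos θ ≠ 0 := hθ
      nlinarith [Real.sin_sq_add_cos_sq θ, sq_pos_of_ne_zero this]
  simpa using h

/-- The `ℓ²` norm of the coefficients of `(1 - X) ^ (a + j) * (1 + X) ^ (b + j)` is `o(2 ^ j)`. -/
lemma tendsto_l2_coeff_div_two_pow (a b : ℕ) :
    Tendsto (fun j : ℕ => √(∑ k ∈ ((1 - X) ^ (a + j) * (1 + X) ^ (b + j) : ℂ[X]).support,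
      ‖((1 - X) ^ (a + j) * (1 + X) ^ (b + j) : ℂ[X]).coeff k‖ ^ 2) / 2 ^ j) atTop (𝓝 0) := by
  have hlim : Tendsto (fun j : ℕ => √((2 * Real.pi)⁻¹ * (4 ^ (a + b) *
      ∫ θ in (0 : ℝ)..2 * Real.pi, (Real.sin θ ^ 2) ^ j))) atTop (𝓝 0) := by
    have := (Real.continuous_sqrt.tendsto _).comp
      ((tendsto_integral_sin_pow_zero.const_mul ((4 : ℝ) ^ (a + b))).const_mul (2 * Real.pi)⁻¹)
    simpa [Function.comp_def] using this
  refine squeeze_zero (fun j => by positivity) (fun j => ?_) hlim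
  rw [sum_sq_norm_coeff_eq_circleAverage, Real.circleAverage_def, div_le_iff₀ (by positivity),
    show (2 : ℝ) ^ j = √((2 ^ j) ^ 2) from (Real.sqrt_sq (by positivity)).symm,
    ← Real.sqrt_mul (mul_nonneg (by positivity) (mul_nonneg (by positivity)
      (intervalIntegral.integral_nonneg (by positivity) fun _ _ => by positivity)))]
  refine Real.sqrt_le_sqrt ?_
  rw [smul_eq_mul, mul_assoc]
  refine mul_le_mul_of_nonneg_left ?_ (by positivity)
  rw [mul_right_comm, ← intervalIntegral.integral_const_mul]
  refine intervalIntegral.integral_mono_on (by positivity) ?_ ?_ fun θ _ => ?_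
  · refine Continuous.intervalIntegrable ?_ _ _
    exact ((Polynomial.continuous _).comp (continuous_circleMap 0 1)).norm.pow 2
  · exact Continuous.intervalIntegrable (by fun_prop) _ _
  · have hw : circleMap 0 1 θ = Real.cos θ + Real.sin θ * Complex.I := by
      simp [circleMap, Complex.exp_mul_I]
    have h1 : ‖1 - circleMap 0 1 θ‖ ^ 2 = 2 * (1 - Real.cos θ) := by
      rw [hw, Complex.sq_norm, Complex.normSq_apply]
      simp only [Complex.sub_re, Complex.add_re, Complex.mul_re, Complex.sub_im, Complex.add_im,
        Complex.mul_im, Complex.ofReal_re, Complex.ofReal_im, Complex.I_re, Complex.I_im,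
        Complex.one_re, Complex.one_im]
      nlinarith [Real.sin_sq_add_cos_sq θ]
    have h2 : ‖1 + circleMap 0 1 θ‖ ^ 2 = 2 * (1 + Real.cos θ) := by
      rw [hw, Complex.sq_norm, Complex.normSq_apply]
      simp only [Complex.add_re, Complex.mul_re, Complex.add_im,
        Complex.mul_im, Complex.ofReal_re, Complex.ofReal_im, Complex.I_re, Complex.I_im,
        Complex.one_re, Complex.one_im]
      nlinarith [Real.sin_sq_add_cos_sq θ]
    have hc1 := Real.cos_le_one θ
    have hc2 := Real.neg_one_le_cos θ
    have h3 : ‖((1 - X) ^ (a + j) * (1 + X) ^ (b + j) : ℂ[X]).eval (circleMap 0 1 θ)‖ ^ 2 =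
        (2 * (1 - Real.cos θ)) ^ (a + j) * (2 * (1 + Real.cos θ)) ^ (b + j) := by
      simp only [eval_mul, eval_pow, eval_sub, eval_add, eval_one, eval_X, norm_mul, norm_pow]
      rw [mul_pow, pow_right_comm, pow_right_comm _ (b + j), h1, h2]
    rw [h3, Real.sin_sq, pow_add, pow_add, pow_add]
    have e : ∀ c : ℝ, (2 * (1 - c)) ^ a * (2 * (1 - c)) ^ j * ((2 * (1 + c)) ^ b *
        (2 * (1 + c)) ^ j) = (2 * (1 - c)) ^ a * (2 * (1 + c)) ^ b *
          ((2 ^ j) ^ 2 * (1 - c ^ 2) ^ j) := fun c => by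
      rw [mul_mul_mul_comm, ← mul_pow (2 * (1 - c)) _ j, pow_right_comm, ← mul_pow (2 ^ 2) _ j]
      ring_nf
    rw [e, mul_assoc _ ((2 ^ j) ^ 2), ← mul_assoc]
    have h4 : 0 ≤ (2 ^ j) ^ 2 * (1 - Real.cos θ ^ 2) ^ j :=
      mul_nonneg (by positivity) (pow_nonneg (by nlinarith) _)
    rw [mul_assoc]
    refine mul_le_mul_of_nonneg_right ?_ h4
    exact mul_le_mul (pow_le_pow_left₀ (by linarith) (by linarith) _)
      (pow_le_pow_left₀ (by linarith) (by linarith) _) (pow_nonneg (by linarith) _)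
      (by positivity)

lemma integrableOn_Ioi_inv_mul_sqrt :
    IntegrableOn (fun y : ℝ => (y * √(y ^ 2 - 1))⁻¹) (Set.Ioi 1) := by
  refine integrableOn_Ioi_deriv_of_nonneg (g := fun y : ℝ => -Real.arcsin y⁻¹) (l := 0) ?_ ?_ ?_ ?_
  · exact ((Real.continuous_arcsin.continuousAt).comp
      (continuousAt_inv₀ one_ne_zero)).neg.continuousWithinAt
  · intro y hy
    have hy : 1 < y := hy
    have hy0 : 0 < y := by linarith
    have hi : y⁻¹ < 1 := inv_lt_one_of_one_lt₀ hy
    have hi0 : 0 < y⁻¹ := inv_pos.2 hy0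
    have := ((Real.hasDerivAt_arcsin (by linarith) hi.ne).comp y (hasDerivAt_inv hy0.ne')).neg
    convert! this using 1
    have hs : √(1 - y⁻¹ ^ 2) = √(y ^ 2 - 1) / y := by
      have hy2 : y ^ 2 - 1 = y ^ 2 * (1 - y⁻¹ ^ 2) := by field_simp
      rw [hy2, Real.sqrt_mul (sq_nonneg y), Real.sqrt_sq hy0.le]
      field_simp
    have : 0 < √(y ^ 2 - 1) := Real.sqrt_pos.2 (by nlinarith)
    rw [hs]
    field_simp
  · intro y hy
    have hy : 1 < y := hy
    positivity
  · have := ((Real.continuous_arcsin.tendsto 0).comp (tendsto_inv_atTop_zero (𝕜 := ℝ))).neg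
    simpa using this

lemma intervalIntegrable_inv_sqrt_one_sub_sq :
    IntervalIntegrable (fun y : ℝ => (√(1 - y ^ 2))⁻¹) volume (-1) 1 := by
  refine intervalIntegral.intervalIntegrable_deriv_of_nonneg (g := Real.arcsin)
    Real.continuous_arcsin.continuousOn (fun y hy => ?_) fun y _ => by positivity
  norm_num at hy
  simpa using Real.hasDerivAt_arcsin hy.1.ne' hy.2.ne

/-- The reciprocal factor `z ^ m / ((1 - z) ^ a * (1 + z) ^ b)` of the kernel. -/
noncomputable def lineFactor (a b m : ℕ) (z : ℂ) : ℂ := z ^ m / ((1 - z) ^ a * (1 + z) ^ b)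

lemma norm_lineFactor_mul_I_le {a b m : ℕ} (j : ℕ) (hm : m + 2 ≤ a + b) (y : ℝ) :
    ‖lineFactor (a + j) (b + j) (m + j) (y * Complex.I)‖ ≤ (2 ^ j)⁻¹ * (1 + y ^ 2)⁻¹ := by
  set R := √(1 + y ^ 2) with hR
  have hR2 : R ^ 2 = 1 + y ^ 2 := Real.sq_sqrt (by positivity)
  have hR1 : 1 ≤ R := by rw [hR, Real.one_le_sqrt]; nlinarith [sq_nonneg y]
  have hyR : |y| ≤ R := Real.abs_le_sqrt (by linarith)
  have h1 : ‖1 - (y : ℂ) * Complex.I‖ = R := by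
    have : (1 - (y : ℂ) * Complex.I) = (1 : ℝ) + (-y : ℝ) * Complex.I := by push_cast; ring
    rw [this, Complex.norm_add_mul_I, hR]
    ring_nf
  have h2 : ‖1 + (y : ℂ) * Complex.I‖ = R := by
    have : (1 + (y : ℂ) * Complex.I) = (1 : ℝ) + (y : ℝ) * Complex.I := by push_cast; ring
    rw [this, Complex.norm_add_mul_I, hR]
    ring_nf
  have h3 : 2 * |y| ≤ R ^ 2 := by
    rw [hR2, ← sq_abs]
    nlinarith [sq_nonneg (|y| - 1)]
  rw [lineFactor, norm_div, norm_mul, norm_pow, norm_pow, norm_pow, h1, h2, norm_mul,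
    Complex.norm_I, mul_one, Complex.norm_real, Real.norm_eq_abs, ← hR2, ← mul_inv,
    inv_eq_one_div, div_le_div_iff₀ (by positivity) (by positivity), one_mul]
  calc |y| ^ (m + j) * (2 ^ j * R ^ 2) = |y| ^ m * R ^ 2 * (2 * |y|) ^ j := by
        rw [mul_pow, pow_add]; ring
    _ ≤ R ^ m * R ^ 2 * (R ^ 2) ^ j := by gcongr
    _ = R ^ (m + 2) * (R ^ 2) ^ j := by rw [pow_add]
    _ ≤ R ^ (a + b) * (R ^ 2) ^ j := by gcongr
    _ = R ^ (a + j) * R ^ (b + j) := by ring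

lemma norm_lineFactor_le {a b m : ℕ} (hm : m + 2 ≤ a + b) {z : ℂ} (h0 : 0 ≤ z.re)
    (h1 : z.re ≤ 1 / 2) (hy : 1 ≤ |z.im|) : ‖lineFactor a b m z‖ ≤ 2 ^ m / z.im ^ 2 := by
  have h2 : |z.im| ≤ ‖1 - z‖ := by simpa using Complex.abs_im_le_norm (1 - z)
  have h3 : |z.im| ≤ ‖1 + z‖ := by simpa using Complex.abs_im_le_norm (1 + z)
  have h4 : ‖z‖ ≤ 2 * |z.im| := by
    have := Complex.norm_le_abs_re_add_abs_im z
    rw [abs_of_nonneg h0] at this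
    linarith
  have hy0 : 0 < |z.im| := by linarith
  have h5 : 0 < ‖1 - z‖ := hy0.trans_le h2
  have h6 : 0 < ‖1 + z‖ := hy0.trans_le h3
  rw [lineFactor, norm_div, norm_mul, norm_pow, norm_pow, norm_pow, ← sq_abs,
    div_le_div_iff₀ (by positivity) (by positivity)]
  calc ‖z‖ ^ m * |z.im| ^ 2 ≤ (2 * |z.im|) ^ m * |z.im| ^ 2 := by gcongr
    _ = 2 ^ m * |z.im| ^ (m + 2) := by ring
    _ ≤ 2 ^ m * |z.im| ^ (a + b) := by gcongr
    _ = 2 ^ m * (|z.im| ^ a * |z.im| ^ b) := by rw [pow_add]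
    _ ≤ 2 ^ m * (‖1 - z‖ ^ a * ‖1 + z‖ ^ b) := by gcongr


lemma inner_integral_eq {n r s x y : ℤ} {a b d m M : ℕ} (hns : n - s = (a + d : ℕ)) (hs : s = b)
    (hnr : n - r = a) (hr : r = (b + d : ℕ)) (hM : (M : ℤ) = b - y + 1)
    (hm : (m : ℤ) = (b + d : ℕ) - x) {z : ℂ} (hz : 1 / 3 < ‖z‖) :
    (∫ θ in (-Real.pi)..Real.pi,
      let w : ℂ := 1 / 3 * Complex.exp ((θ : ℂ) * Complex.I)
      Complex.I * ((w ^ y * (1 - w) ^ (n - s) * (1 + 1 / w) ^ s) /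
        (z ^ x * (1 - z) ^ (n - r) * (1 + 1 / z) ^ r) * (z / (z - w)))) =
      2 * Real.pi * Complex.I * z * (lineFactor a (b + d) m z *
        laurentNeg ((1 - X) ^ (a + d) * (1 + X) ^ b) M z) := by
  have hz0 : z ≠ 0 := norm_pos_iff.1 ((by norm_num : (0 : ℝ) < 1 / 3).trans hz)
  have hcirc := circleIntegral_eval_div_pow_mul_inv_sub ((1 - X) ^ (a + d) * (1 + X) ^ b) M
    (by norm_num : (0 : ℝ) < 1 / 3) hz
  set Q : ℂ[X] := (1 - X) ^ (a + d) * (1 + X) ^ b with hQ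
  have hzx : z ^ x = z ^ (b + d) / z ^ m := by
    rw [← zpow_natCast z m, hm, ← zpow_natCast, ← zpow_sub₀ hz0]
    congr 1
    ring
  have hpt : ∀ θ : ℝ,
      (let w : ℂ := 1 / 3 * Complex.exp ((θ : ℂ) * Complex.I)
      Complex.I * ((w ^ y * (1 - w) ^ (n - s) * (1 + 1 / w) ^ s) /
        (z ^ x * (1 - z) ^ (n - r) * (1 + 1 / z) ^ r) * (z / (z - w)))) =
      z * lineFactor a (b + d) m z * (deriv (circleMap 0 (1 / 3)) θ •
        (Q.eval (circleMap 0 (1 / 3) θ) / circleMap 0 (1 / 3) θ ^ M *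
          (z - circleMap 0 (1 / 3) θ)⁻¹)) := by
    intro θ
    have hw : 1 / 3 * Complex.exp ((θ : ℂ) * Complex.I) = circleMap 0 (1 / 3) θ := by
      simp [circleMap]
    have hw0 : circleMap 0 (1 / 3) θ ≠ 0 := circleMap_ne_center (by norm_num)
    simp only [hw, deriv_circleMap]
    set w := circleMap 0 (1 / 3) θ
    have hwy : w ^ y = w ^ b * w / w ^ M := by
      rw [← zpow_natCast w M, hM, ← pow_succ, ← zpow_natCast, ← zpow_sub₀ hw0]
      congr 1
      push_cast
      ring
    have e1 : 1 + 1 / w = (1 + w) / w := by field_simp; ring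
    have e2 : 1 + 1 / z = (1 + z) / z := by field_simp; ring
    rw [hwy, hzx, hns, hnr, hs, hr, e1, e2]
    simp only [zpow_natCast, hQ, lineFactor, eval_mul, eval_pow, eval_sub, eval_add, eval_one,
      eval_X, smul_eq_mul, div_pow]
    field_simp
  have hper : Function.Periodic (fun θ => deriv (circleMap 0 (1 / 3)) θ •
        (Q.eval (circleMap 0 (1 / 3) θ) / circleMap 0 (1 / 3) θ ^ M *
          (z - circleMap 0 (1 / 3) θ)⁻¹)) (2 * Real.pi) := fun θ => by
    simp only [deriv_circleMap, periodic_circleMap 0 (1 / 3) θ]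
  have hshift := hper.intervalIntegral_add_eq (-Real.pi) 0
  rw [zero_add, show -Real.pi + 2 * Real.pi = Real.pi by ring] at hshift
  simp only [hpt]
  rw [intervalIntegral.integral_const_mul, hshift]
  rw [circleIntegral] at hcirc
  rw [hcirc]
  ring

lemma Kbulk_eq {n r s x y : ℤ} {a b d m M : ℕ} (hns : n - s = (a + d : ℕ)) (hs : s = b)
    (hnr : n - r = a) (hr : r = (b + d : ℕ)) (hM : (M : ℤ) = b - y + 1)
    (hm : (m : ℤ) = (b + d : ℕ) - x) :
    Kbulk n r s x y = 1 / (2 * (Real.pi : ℂ) * Complex.I) *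
      ∫ t : ℝ, Complex.I * (lineFactor a (b + d) m (1 / 2 + t * Complex.I) *
        laurentNeg ((1 - X) ^ (a + d) * (1 + X) ^ b) M (1 / 2 + t * Complex.I)) := by
  have hle : s ≤ r := by rw [hs, hr]; push_cast; linarith
  have hpt : ∀ t : ℝ, 1 / 3 < ‖(1 / 2 : ℂ) + t * Complex.I‖ := fun t => by
    have := Complex.abs_re_le_norm ((1 / 2 : ℂ) + t * Complex.I)
    have h2 : ((1 / 2 : ℂ) + t * Complex.I).re = 1 / 2 := by simp
    rw [h2, abs_of_pos (by norm_num)] at this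
    linarith
  have hcast : (((1 / 2 : ℝ) : ℝ) : ℂ) = 1 / 2 := by push_cast; rfl
  unfold Kbulk
  simp only [if_pos hle, hcast]
  rw [sq, mul_assoc, ← integral_const_mul]
  congr 2
  ext t
  have hz0 : (1 / 2 : ℂ) + t * Complex.I ≠ 0 :=
    norm_pos_iff.1 ((by norm_num : (0 : ℝ) < 1 / 3).trans (hpt t))
  have := inner_integral_eq hns hs hnr hr hM hm (hpt t)
  simp only at this
  rw [this]
  generalize (1 / 2 : ℂ) + t * Complex.I = z at hz0
  field_simp

/-- The limiting integrand (divided by `w`). -/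
noncomputable def arcIntegrand (p : ℤ) (d : ℕ) (z : ℂ) : ℂ :=
  z ^ p * ((1 - z) / (z * (1 + z))) ^ d

lemma differentiableOn_arcIntegrand (p : ℤ) (d : ℕ) :
    DifferentiableOn ℂ (arcIntegrand p d) Complex.slitPlane := by
  intro z hz
  have hz0 := Complex.slitPlane_ne_zero hz
  have hz1 : 1 + z ≠ 0 := fun h => by
    rw [show z = -1 by linear_combination h] at hz
    norm_num [Complex.mem_slitPlane_iff] at hz
  refine DifferentiableAt.differentiableWithinAt ?_
  exact (differentiableAt_zpow.2 (Or.inl hz0)).mul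
    (((by fun_prop : DifferentiableAt ℂ (fun z : ℂ => 1 - z) z).div
      (by fun_prop : DifferentiableAt ℂ (fun z : ℂ => z * (1 + z)) z)
      (mul_ne_zero hz0 hz1)).pow d)

lemma one_sub_ne_zero_and_one_add_ne_zero {z : ℂ} (hz : |z.re| < 1) : 1 - z ≠ 0 ∧ 1 + z ≠ 0 := by
  have := abs_lt.1 hz
  constructor <;> intro h <;> have h' := congrArg Complex.re h <;>
    simp only [Complex.sub_re, Complex.add_re, Complex.one_re, Complex.zero_re] at h' <;> linarith

lemma lineFactor_mul_laurentNeg (a b d m M : ℕ) {z : ℂ} (hz0 : z ≠ 0) (hz : |z.re| < 1) :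
    lineFactor a (b + d) m z * laurentNeg ((1 - X) ^ (a + d) * (1 + X) ^ b) M z =
      arcIntegrand (m - M + d) d z -
        lineFactor a (b + d) m z * laurentPos ((1 - X) ^ (a + d) * (1 + X) ^ b) M z := by
  obtain ⟨h1, h2⟩ := one_sub_ne_zero_and_one_add_ne_zero hz
  rw [eq_sub_iff_add_eq, ← mul_add, ← eval_div_pow_eq _ _ hz0]
  simp only [lineFactor, arcIntegrand, eval_mul, eval_pow, eval_sub, eval_add, eval_one, eval_X]
  rw [zpow_add₀ hz0, zpow_sub₀ hz0, zpow_natCast, zpow_natCast, zpow_natCast, pow_add, pow_add,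
    div_pow, mul_pow]
  field_simp

lemma integral_line_eq {a b d m M : ℕ} (hm : m + 2 ≤ a + (b + d)) :
    let Q : ℂ[X] := (1 - X) ^ (a + d) * (1 + X) ^ b
    let f : ℂ → ℂ := fun z => lineFactor a (b + d) m z * laurentNeg Q M z
    let h : ℂ → ℂ := fun z => lineFactor a (b + d) m z * laurentPos Q M z
    ∫ t : ℝ, Complex.I * f (1 / 2 + t * Complex.I) =
      (∫ t in (-(Real.pi / 2))..(Real.pi / 2), Complex.I * Complex.exp (Complex.I * t) *
        arcIntegrand (m - M + d) d (Complex.exp (Complex.I * t)))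
      - (∫ y in (-1 : ℝ)..1, Complex.I * h (y * Complex.I))
      + (∫ y in Set.Ioi (1 : ℝ), Complex.I * f (y * Complex.I))
      + ∫ y in Set.Ioi (1 : ℝ), Complex.I * f ((-y : ℝ) * Complex.I) := by
  intro Q f h
  have hfh : ∀ z : ℂ, z ≠ 0 → |z.re| < 1 → f z = arcIntegrand (m - M + d) d z - h z :=
    fun z h0 h1 => lineFactor_mul_laurentNeg a b d m M h0 h1
  have hh : DifferentiableOn ℂ h {z | |z.re| < 1} := fun z hz => by
    obtain ⟨h1, h2⟩ := one_sub_ne_zero_and_one_add_ne_zero hz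
    refine DifferentiableAt.differentiableWithinAt (DifferentiableAt.mul ?_
      (differentiable_laurentPos Q M z))
    exact DifferentiableAt.div (by fun_prop) (by fun_prop)
      (mul_ne_zero (pow_ne_zero _ h1) (pow_ne_zero _ h2))
  have key := integral_vertical_line_eq (C := 2 ^ m * ∑ k ∈ Finset.range M, ‖Q.coeff k‖)
    (differentiableOn_arcIntegrand (m - M + d) d) hh fun z h0 h1 hy => by
      have hz0 : z ≠ 0 := by rintro rfl; norm_num at hy
      rw [← hfh z hz0 (abs_lt.2 ⟨by linarith, by linarith⟩), norm_mul, mul_div_right_comm]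
      exact mul_le_mul (norm_lineFactor_le hm h0 h1 hy)
        (norm_laurentNeg_le_sum Q M (hy.trans (Complex.abs_im_le_norm z))) (norm_nonneg _)
        (by positivity)
  have hne : ∀ y ∈ Set.Ioi (1 : ℝ), y ≠ 0 := fun y hy => (zero_lt_one.trans hy).ne'
  have e1 : ∀ t : ℝ, f (1 / 2 + t * Complex.I) =
      arcIntegrand (m - M + d) d (1 / 2 + t * Complex.I) - h (1 / 2 + t * Complex.I) := fun t =>
    hfh _ (by simp [Complex.ext_iff]) (by simp; norm_num)
  have e2 : ∀ y : ℝ, y ≠ 0 → f (y * Complex.I) =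
      arcIntegrand (m - M + d) d (y * Complex.I) - h (y * Complex.I) := fun y hy =>
    hfh _ (by simp [hy]) (by simp)
  simp only [e1]
  rw [key]
  congr 1
  · congr 1
    exact setIntegral_congr_fun measurableSet_Ioi fun y hy => by simp only [e2 y (hne y hy)]
  · exact setIntegral_congr_fun measurableSet_Ioi fun y hy => by
      simp only [e2 (-y) (neg_ne_zero.2 (hne y hy))]

lemma norm_integral_Ioi_le {a b m : ℕ} (j M : ℕ) (Q : ℂ[X]) (hm : m + 2 ≤ a + b) {ε : ℝ}
    (hε : |ε| = 1) :
    ‖∫ y in Set.Ioi (1 : ℝ), Complex.I *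
      (lineFactor (a + j) (b + j) (m + j) ((ε * y : ℝ) * Complex.I) *
        laurentNeg Q M ((ε * y : ℝ) * Complex.I))‖ ≤
      √(∑ k ∈ Q.support, ‖Q.coeff k‖ ^ 2) / 2 ^ j *
        ∫ y in Set.Ioi (1 : ℝ), (y * √(y ^ 2 - 1))⁻¹ := by
  rw [← integral_const_mul]
  refine norm_integral_le_of_norm_le (integrableOn_Ioi_inv_mul_sqrt.const_mul _)
    ((ae_restrict_iff' measurableSet_Ioi).2 (Eventually.of_forall fun y hy => ?_))
  have hy : 1 < y := hy
  have hε2 : (ε * y) ^ 2 = y ^ 2 := by rw [mul_pow, ← sq_abs, hε]; ring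
  have hn : ‖((ε * y : ℝ) : ℂ) * Complex.I‖ = y := by
    rw [norm_mul, Complex.norm_I, mul_one, Complex.norm_real, Real.norm_eq_abs, abs_mul, hε,
      one_mul, abs_of_pos (by linarith)]
  have h1 := norm_lineFactor_mul_I_le j hm (ε * y)
  have h2 := norm_laurentNeg_le Q M (z := ((ε * y : ℝ) : ℂ) * Complex.I) (by rwa [hn])
  rw [hn] at h2
  rw [hε2] at h1
  have h3 : (1 + y ^ 2)⁻¹ ≤ y⁻¹ := inv_anti₀ (by linarith) (by nlinarith)
  rw [norm_mul, Complex.norm_I, one_mul, norm_mul]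
  calc _ ≤ ((2 ^ j)⁻¹ * y⁻¹) * (√(∑ k ∈ Q.support, ‖Q.coeff k‖ ^ 2) / √(y ^ 2 - 1)) := by
        refine mul_le_mul (h1.trans ?_) h2 (norm_nonneg _) (by positivity)
        gcongr
    _ = _ := by rw [mul_inv]; ring

lemma norm_integral_segment_le {a b m : ℕ} (j M : ℕ) (Q : ℂ[X]) (hm : m + 2 ≤ a + b) :
    ‖∫ y in (-1 : ℝ)..1, Complex.I * (lineFactor (a + j) (b + j) (m + j) (y * Complex.I) *
        laurentPos Q M (y * Complex.I))‖ ≤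
      √(∑ k ∈ Q.support, ‖Q.coeff k‖ ^ 2) / 2 ^ j *
        ∫ y in (-1 : ℝ)..1, (√(1 - y ^ 2))⁻¹ := by
  rw [← intervalIntegral.integral_const_mul]
  refine intervalIntegral.norm_integral_le_of_norm_le (by norm_num) ?_
    (intervalIntegrable_inv_sqrt_one_sub_sq.const_mul _)
  filter_upwards [(Set.countable_singleton (1 : ℝ)).ae_notMem volume] with y hy1 hy
  have hy2 : |y| < 1 := abs_lt.2 ⟨hy.1, lt_of_le_of_ne hy.2 hy1⟩
  have hn : ‖(y : ℂ) * Complex.I‖ = |y| := by simp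
  have h1 := norm_lineFactor_mul_I_le j hm y
  have h2 := norm_laurentPos_le Q M (z := (y : ℂ) * Complex.I) (by rwa [hn])
  rw [hn, sq_abs] at h2
  have h3 : (1 + y ^ 2)⁻¹ ≤ 1 := inv_le_one_of_one_le₀ (by nlinarith [sq_nonneg y])
  rw [norm_mul, Complex.norm_I, one_mul, norm_mul]
  calc _ ≤ ((2 ^ j)⁻¹ * 1) * (√(∑ k ∈ Q.support, ‖Q.coeff k‖ ^ 2) / √(1 - y ^ 2)) := by
        refine mul_le_mul (h1.trans ?_) h2 (norm_nonneg _) (by positivity)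
        gcongr
    _ = _ := by ring

lemma tendsto_integral_line {a b d m : ℕ} (M : ℕ) (hm : m + 2 ≤ a + (b + d)) :
    Tendsto (fun j : ℕ => ∫ t : ℝ, Complex.I *
      (lineFactor (a + j) (b + j + d) (m + j) (1 / 2 + t * Complex.I) *
        laurentNeg ((1 - X) ^ (a + j + d) * (1 + X) ^ (b + j)) (M + j) (1 / 2 + t * Complex.I)))
      atTop (𝓝 (∫ t in (-(Real.pi / 2))..(Real.pi / 2), Complex.I * Complex.exp (Complex.I * t) *
        arcIntegrand (m - M + d) d (Complex.exp (Complex.I * t)))) := by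
  have hS : ∀ c : ℝ, Tendsto (fun j : ℕ =>
      √(∑ k ∈ ((1 - X) ^ (a + j + d) * (1 + X) ^ (b + j) : ℂ[X]).support,
      ‖((1 - X) ^ (a + j + d) * (1 + X) ^ (b + j) : ℂ[X]).coeff k‖ ^ 2) / 2 ^ j * c)
      atTop (𝓝 0) := fun c => by
    have := (tendsto_l2_coeff_div_two_pow (a + d) b).mul_const c
    simpa only [zero_mul, add_right_comm a d] using this
  have hb : ∀ j, b + j + d = b + d + j := fun j => add_right_comm _ _ _
  have h1 := squeeze_zero_norm (fun j => norm_integral_segment_le j (M + j)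
    ((1 - X) ^ (a + j + d) * (1 + X) ^ (b + j)) hm) (hS _)
  have h2 := squeeze_zero_norm (fun j => norm_integral_Ioi_le (ε := 1) j (M + j)
    ((1 - X) ^ (a + j + d) * (1 + X) ^ (b + j)) hm (by simp)) (hS _)
  have h3 := squeeze_zero_norm (fun j => norm_integral_Ioi_le (ε := -1) j (M + j)
    ((1 - X) ^ (a + j + d) * (1 + X) ^ (b + j)) hm (by simp)) (hS _)
  have key := ((h1.const_sub (∫ t in (-(Real.pi / 2))..(Real.pi / 2),
    Complex.I * Complex.exp (Complex.I * t) *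
        arcIntegrand (m - M + d) d (Complex.exp (Complex.I * t)))).add h2).add h3
  simp only [sub_zero, add_zero, one_mul, neg_mul] at key
  refine key.congr fun j => ?_
  rw [integral_line_eq (by omega)]
  simp only [hb, Nat.cast_add, add_sub_add_right_eq_sub]

/-- The bulk-limit computation (4.10): for `ℓ > ℓ'`,
`K_{2N−1}(2(ℓ+N), 2ℓ−u+1; 2(ℓ'+N), 2ℓ'−u'+1)` converges, as `N → ∞`, to
`(1/2πi) ∫_{γ₊} (dw/w) w^{u−u'} ((1−w)/(w(1+w)))^{ℓ−ℓ'}`, where `γ₊` is the right half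
of the unit circle, parametrized by `t ↦ e^{it}`, `−π/2 ≤ t ≤ π/2` (so `dw/w = i dt`). -/
theorem stmt_13 (ℓ ℓ' u u' : ℤ) (h : ℓ' < ℓ) :
    Tendsto
      (fun N : ℕ =>
        Kbulk (2 * (N : ℤ) - 1) (ℓ + N) (ℓ' + N) (2 * ℓ - u + 1) (2 * ℓ' - u' + 1))
      atTop
      (nhds
        (1 / (2 * (Real.pi : ℂ) * Complex.I) *
          ∫ t in (-(Real.pi / 2))..(Real.pi / 2),
            let w : ℂ := Complex.exp (Complex.I * (t : ℂ))
            Complex.I * (w ^ (u - u') * ((1 - w) / (w * (1 + w))) ^ (ℓ - ℓ')))) := by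
  obtain ⟨N₀, hN₀⟩ : ∃ N₀ : ℕ, (N₀ : ℤ) = |ℓ| + |ℓ'| + |u| + |u'| + 2 :=
    ⟨_, Int.toNat_of_nonneg (by positivity)⟩
  have bℓ := abs_le.1 (le_refl |ℓ|)
  have bℓ' := abs_le.1 (le_refl |ℓ'|)
  have bu := abs_le.1 (le_refl |u|)
  have bu' := abs_le.1 (le_refl |u'|)
  have nonneg := And.intro (abs_nonneg ℓ) (And.intro (abs_nonneg ℓ')
    (And.intro (abs_nonneg u) (abs_nonneg u')))
  obtain ⟨d, hd⟩ := Int.eq_ofNat_of_zero_le (sub_nonneg.2 h.le)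
  obtain ⟨a, ha⟩ := Int.eq_ofNat_of_zero_le (show 0 ≤ (N₀ : ℤ) - 1 - ℓ by omega)
  obtain ⟨b, hb⟩ := Int.eq_ofNat_of_zero_le (show 0 ≤ (N₀ : ℤ) + ℓ' by omega)
  obtain ⟨m, hm⟩ := Int.eq_ofNat_of_zero_le (show 0 ≤ (N₀ : ℤ) - ℓ + u - 1 by omega)
  obtain ⟨M, hM⟩ := Int.eq_ofNat_of_zero_le (show 0 ≤ (N₀ : ℤ) - ℓ' + u' by omega)
  rw [← tendsto_add_atTop_iff_nat N₀]
  have key := (tendsto_integral_line (a := a) (b := b) (d := d) (m := m) M (by omega)).const_mul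
    (1 / (2 * (Real.pi : ℂ) * Complex.I))
  convert key using 2 with j
  · refine Kbulk_eq ?_ ?_ ?_ ?_ ?_ ?_ <;> push_cast <;> omega
  · refine congrArg _ (intervalIntegral.integral_congr fun t _ => ?_)
    have hw := Complex.exp_ne_zero (Complex.I * t)
    have hp : u - u' = 1 + ((m : ℤ) - M + d) := by omega
    simp only [arcIntegrand]
    rw [hp, hd, zpow_add₀ hw, zpow_one, zpow_natCast]
    ring
end

section
/- Let x, y be integers with x + y odd and x + y ≥ 1. Then P(x + iy) = (i^{x−1}/(2πi)) ∫_{γ₊} w^{(x−y+1)/2} (w−1)^{(x+y−1)/2} (w+1)^{−(x+y+1)/2} (dw/w), where γ₊ is the right half of the unit circle, parametrized t ↦ e^{it}, −π/2 ≤ t ≤ π/2. (Here (x−y+1)/2, (x+y±1)/2 are integers since x+y is odd.) -/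
open MeasureTheory

/-- The Kasteleyn coupling function of the Burton–Pemantle measure:
`P(x+iy) = (1/4π²) ∫_{−π}^{π} ∫_{−π}^{π} e^{i(xθ−yφ)}/(2i sin θ + 2 sin φ) dθ dφ`. -/
noncomputable def Pcoup (x y : ℤ) : ℂ :=
  1 / (4 * (Real.pi : ℂ) ^ 2) *
    ∫ θ in (-Real.pi)..Real.pi, ∫ φ in (-Real.pi)..Real.pi,
      Complex.exp (Complex.I * ((x : ℂ) * (θ : ℂ) - (y : ℂ) * (φ : ℂ))) /
        (2 * Complex.I * ((Real.sin θ : ℝ) : ℂ) + 2 * ((Real.sin φ : ℝ) : ℂ))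

theorem integral_exp_I_mul_of_diffContOnCl {f : ℂ → ℂ} (hf : DiffContOnCl ℂ f (Metric.ball 0 1)) :
    ∫ θ in (-Real.pi)..Real.pi, f (Complex.exp (Complex.I * (θ : ℂ))) = 2 * Real.pi * f 0 := by
  have hper : Function.Periodic (fun θ : ℝ => f (Complex.exp (Complex.I * (θ : ℂ))))
      (2 * Real.pi) := fun θ => by
    have : Complex.I * ((θ + 2 * Real.pi : ℝ) : ℂ) =
        Complex.I * (θ : ℂ) + 2 * Real.pi * Complex.I := by push_cast; ring
    simp only [this, Complex.exp_periodic _]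
  have hshift := hper.intervalIntegral_add_eq (-Real.pi) 0
  rw [show -Real.pi + 2 * Real.pi = Real.pi by ring, zero_add] at hshift
  rw [hshift]
  have havg := DiffContOnCl.circleAverage (c := (0 : ℂ)) (R := 1) (f := f) (by simpa using hf)
  rw [Real.circleAverage_def] at havg
  have hπ : (Real.pi : ℂ) ≠ 0 := by exact_mod_cast Real.pi_ne_zero
  rw [← havg, Complex.real_smul]
  simp only [circleMap, Complex.ofReal_one, one_mul, zero_add, mul_comm _ Complex.I]
  push_cast
  field_simp

theorem integral_pow_div_of_norm_lt {A B : ℂ} (h : ‖A‖ < ‖B‖) (n : ℕ) (hn : n ≠ 0) :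
    ∫ θ in (-Real.pi)..Real.pi, Complex.exp (Complex.I * (θ : ℂ)) ^ n /
      (A * Complex.exp (Complex.I * (θ : ℂ)) ^ 2 - B) = 0 := by
  have hne : ∀ z ∈ Metric.closedBall (0 : ℂ) 1, A * z ^ 2 - B ≠ 0 := by
    intro z hz h0
    have hz' : ‖z‖ ≤ 1 := by simpa using hz
    have h1 : ‖A‖ * ‖z‖ ^ 2 = ‖B‖ := by
      rw [← norm_pow, ← norm_mul, sub_eq_zero.mp h0]
    have h2 : ‖z‖ ^ 2 ≤ 1 := pow_le_one₀ (norm_nonneg _) hz'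
    nlinarith [norm_nonneg A]
  have hd : DifferentiableOn ℂ (fun z : ℂ => z ^ n / (A * z ^ 2 - B)) (Metric.closedBall 0 1) :=
    DifferentiableOn.div (by fun_prop) (by fun_prop) hne
  have := integral_exp_I_mul_of_diffContOnCl
    (DifferentiableOn.diffContOnCl (hd.mono Metric.closure_ball_subset_closedBall))
  simpa [hn] using this

theorem integral_pow_div_of_lt_norm {A B : ℂ} (h : ‖B‖ < ‖A‖) (k : ℕ) :
    ∫ θ in (-Real.pi)..Real.pi, Complex.exp (Complex.I * (θ : ℂ)) ^ (2 * (k + 1)) /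
      (A * Complex.exp (Complex.I * (θ : ℂ)) ^ 2 - B) = 2 * Real.pi * (B ^ k / A ^ (k + 1)) := by
  have hA : A ≠ 0 := norm_pos_iff.mp ((norm_nonneg _).trans_lt h)
  have hu : ∀ θ : ℝ, ‖Complex.exp (Complex.I * (θ : ℂ))‖ = 1 := fun θ => by
    rw [mul_comm]; exact Complex.norm_exp_ofReal_mul_I θ
  have hne : ∀ θ : ℝ, A * Complex.exp (Complex.I * (θ : ℂ)) ^ 2 - B ≠ 0 := by
    intro θ h0
    have h1 : ‖A * Complex.exp (Complex.I * (θ : ℂ)) ^ 2‖ = ‖B‖ := by rw [sub_eq_zero.mp h0]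
    rw [norm_mul, norm_pow, hu] at h1
    linarith
  have hstep : ∀ k : ℕ, ∫ θ in (-Real.pi)..Real.pi,
      Complex.exp (Complex.I * (θ : ℂ)) ^ (2 * (k + 1)) /
        (A * Complex.exp (Complex.I * (θ : ℂ)) ^ 2 - B) =
      2 * Real.pi * (0 ^ (2 * k) / A) + B / A * ∫ θ in (-Real.pi)..Real.pi,
        Complex.exp (Complex.I * (θ : ℂ)) ^ (2 * k) /
          (A * Complex.exp (Complex.I * (θ : ℂ)) ^ 2 - B) := by
    intro k
    have hd : Differentiable ℂ (fun z : ℂ => z ^ (2 * k) / A) := by fun_prop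
    rw [← integral_exp_I_mul_of_diffContOnCl hd.diffContOnCl,
      ← intervalIntegral.integral_const_mul, ← intervalIntegral.integral_add]
    · refine intervalIntegral.integral_congr fun θ _ => ?_
      have := hne θ
      field_simp
      ring
    · exact Continuous.intervalIntegrable (by fun_prop) _ _
    · exact Continuous.intervalIntegrable
        (continuous_const.mul (Continuous.div (by fun_prop) (by fun_prop) hne)) _ _
  induction k with
  | zero =>
    have h0 : ∫ θ in (-Real.pi)..Real.pi, Complex.exp (Complex.I * (θ : ℂ)) ^ (2 * 0) /
        (A * Complex.exp (Complex.I * (θ : ℂ)) ^ 2 - B) = 0 := by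
      have hflip := intervalIntegral.integral_comp_neg (a := -Real.pi) (b := Real.pi)
        (fun θ : ℝ => Complex.exp (Complex.I * (θ : ℂ)) ^ (2 * 0) /
          (A * Complex.exp (Complex.I * (θ : ℂ)) ^ 2 - B))
      rw [neg_neg] at hflip
      rw [← hflip, ← neg_zero, ← integral_pow_div_of_norm_lt h 2 two_ne_zero,
        ← intervalIntegral.integral_neg]
      refine intervalIntegral.integral_congr fun θ _ => ?_
      have h1 := hne (-θ)
      simp only [Complex.ofReal_neg, mul_neg, Complex.exp_neg, mul_zero, pow_zero] at h1 ⊢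
      have hz := Complex.exp_ne_zero (Complex.I * (θ : ℂ))
      generalize Complex.exp (Complex.I * (θ : ℂ)) = z at *
      have h2 : B * z ^ 2 - A ≠ 0 := by
        intro h0
        apply h1
        field_simp
        linear_combination -h0
      have h3 : A * z⁻¹ ^ 2 - B = -(B * z ^ 2 - A) / z ^ 2 := by field_simp; ring
      rw [h3]
      field_simp
    rw [hstep, h0]
    simp
  | succ k ih =>
    rw [hstep, ih]
    have h0 : (0 : ℂ) ^ (2 * (k + 1)) = 0 := by simp
    rw [h0]
    field_simp
    ring

theorem intervalIntegrable_abs_sin_rpow (a b : ℝ) :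
    IntervalIntegrable (fun θ : ℝ => |Real.sin θ| ^ (-(1 / 2) : ℝ)) volume a b := by
  have hper : Function.Periodic (fun θ : ℝ => |Real.sin θ| ^ (-(1 / 2) : ℝ)) Real.pi := fun θ => by
    simp [Real.sin_add_pi]
  have hhalf : IntervalIntegrable (fun θ : ℝ => |Real.sin θ| ^ (-(1 / 2) : ℝ)) volume
      0 (Real.pi / 2) := by
    have h0 : IntervalIntegrable (fun θ : ℝ => (2 / Real.pi) ^ (-(1 / 2) : ℝ) *
        θ ^ (-(1 / 2) : ℝ)) volume 0 (Real.pi / 2) :=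
      (intervalIntegral.intervalIntegrable_rpow' (by norm_num)).const_mul _
    refine h0.mono_fun' (Measurable.aestronglyMeasurable (by fun_prop)) ?_
    filter_upwards [ae_restrict_mem measurableSet_uIoc] with θ hθ
    rw [Set.uIoc_of_le (by positivity)] at hθ
    have h1 := Real.mul_le_sin hθ.1.le hθ.2
    have h2 : 0 < 2 / Real.pi * θ := mul_pos (by positivity) hθ.1
    rw [← Real.mul_rpow (by positivity) hθ.1.le, abs_of_nonneg (h2.le.trans h1),
      Real.norm_of_nonneg (Real.rpow_nonneg (h2.le.trans h1) _)]
    exact Real.rpow_le_rpow_of_nonpos h2 h1 (by norm_num)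
  have hhalf' : IntervalIntegrable (fun θ : ℝ => |Real.sin θ| ^ (-(1 / 2) : ℝ)) volume
      (Real.pi / 2) Real.pi := by
    have := hhalf.comp_sub_left Real.pi
    simp only [Real.sin_pi_sub, sub_zero, sub_half] at this
    exact this.symm
  exact hper.intervalIntegrable₀ Real.pi_ne_zero (hhalf.trans hhalf') a b

theorem norm_exp_div_le (x y : ℤ) {θ φ : ℝ} (hθ : Real.sin θ ≠ 0) (hφ : Real.sin φ ≠ 0) :
    ‖Complex.exp (Complex.I * ((x : ℂ) * (θ : ℂ) - (y : ℂ) * (φ : ℂ))) /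
        (2 * Complex.I * ((Real.sin θ : ℝ) : ℂ) + 2 * ((Real.sin φ : ℝ) : ℂ))‖ ≤
      |Real.sin θ| ^ (-(1 / 2) : ℝ) * |Real.sin φ| ^ (-(1 / 2) : ℝ) := by
  have h1 : ‖Complex.exp (Complex.I * ((x : ℂ) * (θ : ℂ) - (y : ℂ) * (φ : ℂ)))‖ = 1 := by
    rw [mul_comm, ← Complex.norm_exp_ofReal_mul_I (x * θ - y * φ)]
    push_cast; rfl
  have hs : 0 < |Real.sin θ| * |Real.sin φ| := by positivity
  rw [norm_div, h1, ← Real.mul_rpow (abs_nonneg _) (abs_nonneg _), Real.rpow_neg hs.le, one_div,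
    ← Real.sqrt_eq_rpow]
  refine inv_anti₀ (Real.sqrt_pos.mpr hs) ?_
  rw [Complex.norm_def]
  refine Real.sqrt_le_sqrt ?_
  simp only [Complex.normSq_apply, Complex.add_re, Complex.mul_re, Complex.add_im, Complex.mul_im,
    Complex.ofReal_re, Complex.ofReal_im, Complex.I_re, Complex.I_im, Complex.re_ofNat,
    Complex.im_ofNat]
  nlinarith [sq_nonneg (|Real.sin θ| - |Real.sin φ|), sq_abs (Real.sin θ), sq_abs (Real.sin φ)]

theorem ae_sin_ne_zero : ∀ᵐ θ : ℝ, Real.sin θ ≠ 0 := by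
  have hc : {θ : ℝ | Real.sin θ = 0}.Countable := by
    refine (Set.countable_range fun n : ℤ => (n : ℝ) * Real.pi).mono fun θ hθ => ?_
    exact Real.sin_eq_zero_iff.mp hθ
  simpa [ae_iff] using hc.measure_zero volume

theorem integrableOn_coupling_kernel (x y : ℤ) :
    IntegrableOn (Function.uncurry fun ψ θ : ℝ =>
      Complex.exp (Complex.I * ((x : ℂ) * (θ : ℂ) - (y : ℂ) * ((ψ - θ : ℝ) : ℂ))) /
        (2 * Complex.I * ((Real.sin θ : ℝ) : ℂ) + 2 * ((Real.sin (ψ - θ) : ℝ) : ℂ)))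
      (Set.uIoc (-Real.pi) Real.pi ×ˢ Set.uIoc (-Real.pi) Real.pi) := by
  have hf : Integrable ((Set.Ioc (-Real.pi) Real.pi).indicator
      fun θ : ℝ => |Real.sin θ| ^ (-(1 / 2) : ℝ)) := by
    rw [integrable_indicator_iff measurableSet_Ioc,
      ← intervalIntegrable_iff_integrableOn_Ioc_of_le (by linarith [Real.pi_pos])]
    exact intervalIntegrable_abs_sin_rpow _ _
  have hg : Integrable ((Set.Ioc (-(3 * Real.pi)) (3 * Real.pi)).indicator
      fun θ : ℝ => |Real.sin θ| ^ (-(1 / 2) : ℝ)) := by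
    rw [integrable_indicator_iff measurableSet_Ioc,
      ← intervalIntegrable_iff_integrableOn_Ioc_of_le (by linarith [Real.pi_pos])]
    exact intervalIntegrable_abs_sin_rpow _ _
  have hconv := hf.convolution_integrand (ContinuousLinearMap.mul ℝ ℝ) hg
  rw [← Measure.volume_eq_prod] at hconv
  have hfst : ∀ᵐ p : ℝ × ℝ, Real.sin p.2 ≠ 0 :=
    Measure.quasiMeasurePreserving_snd.ae ae_sin_ne_zero
  have hsub : ∀ᵐ p : ℝ × ℝ, Real.sin (p.1 - p.2) ≠ 0 :=
    (quasiMeasurePreserving_sub_of_right_invariant volume volume).ae ae_sin_ne_zero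
  rw [Set.uIoc_of_le (by linarith [Real.pi_pos])]
  refine hconv.integrableOn.mono' (Measurable.aestronglyMeasurable (by
    unfold Function.uncurry; fun_prop)) ?_
  filter_upwards [ae_restrict_mem (measurableSet_Ioc.prod measurableSet_Ioc),
    ae_restrict_of_ae hfst, ae_restrict_of_ae hsub] with p hp h1 h2
  obtain ⟨⟨hp1, hp2⟩, hp3, hp4⟩ := hp
  refine (norm_exp_div_le x y h1 h2).trans_eq ?_
  have hmem : p.1 - p.2 ∈ Set.Ioc (-(3 * Real.pi)) (3 * Real.pi) := by
    constructor <;> linarith [Real.pi_pos]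
  rw [ContinuousLinearMap.mul_apply', Set.indicator_of_mem (Set.mem_Ioc.mpr ⟨hp3, hp4⟩),
    Set.indicator_of_mem hmem]

theorem exp_div_eq_pow_div (x y : ℤ) (n : ℕ) (h : x + y + 1 = n) (θ ψ : ℝ) :
    Complex.exp (Complex.I * ((x : ℂ) * (θ : ℂ) - (y : ℂ) * ((ψ - θ : ℝ) : ℂ))) /
        (2 * Complex.I * ((Real.sin θ : ℝ) : ℂ) + 2 * ((Real.sin (ψ - θ) : ℝ) : ℂ)) =
      Complex.exp (Complex.I * (ψ : ℂ)) ^ (-y) * (Complex.exp (Complex.I * (θ : ℂ)) ^ n /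
        ((1 + Complex.I * (Complex.exp (Complex.I * (ψ : ℂ)))⁻¹) *
          Complex.exp (Complex.I * (θ : ℂ)) ^ 2 -
          (1 + Complex.I * Complex.exp (Complex.I * (ψ : ℂ))))) := by
  have hnum : Complex.exp (Complex.I * ((x : ℂ) * (θ : ℂ) - (y : ℂ) * ((ψ - θ : ℝ) : ℂ))) =
      Complex.exp (Complex.I * (ψ : ℂ)) ^ (-y) * Complex.exp (Complex.I * (θ : ℂ)) ^ n /
        Complex.exp (Complex.I * (θ : ℂ)) := by
    have hc : (x : ℂ) + y + 1 = n := by exact_mod_cast h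
    rw [← Complex.exp_int_mul, ← Complex.exp_nat_mul, ← Complex.exp_add, ← Complex.exp_sub, ← hc]
    congr 1
    push_cast
    ring
  have hden : 2 * Complex.I * ((Real.sin θ : ℝ) : ℂ) + 2 * ((Real.sin (ψ - θ) : ℝ) : ℂ) =
      ((1 + Complex.I * (Complex.exp (Complex.I * (ψ : ℂ)))⁻¹) *
          Complex.exp (Complex.I * (θ : ℂ)) ^ 2 -
          (1 + Complex.I * Complex.exp (Complex.I * (ψ : ℂ)))) /
        Complex.exp (Complex.I * (θ : ℂ)) := by
    rw [Complex.ofReal_sin, Complex.ofReal_sin, Complex.sin, Complex.sin]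
    have h1 : Complex.exp (-(θ : ℂ) * Complex.I) = (Complex.exp (Complex.I * (θ : ℂ)))⁻¹ := by
      rw [← Complex.exp_neg]; ring_nf
    have h2 : Complex.exp (-((ψ - θ : ℝ) : ℂ) * Complex.I) =
        Complex.exp (Complex.I * (θ : ℂ)) * (Complex.exp (Complex.I * (ψ : ℂ)))⁻¹ := by
      rw [← Complex.exp_neg, ← Complex.exp_add]; push_cast; ring_nf
    have h3 : Complex.exp (((ψ - θ : ℝ) : ℂ) * Complex.I) =
        Complex.exp (Complex.I * (ψ : ℂ)) * (Complex.exp (Complex.I * (θ : ℂ)))⁻¹ := by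
      rw [← Complex.exp_neg, ← Complex.exp_add]; push_cast; ring_nf
    rw [h1, h2, h3, mul_comm (θ : ℂ) Complex.I]
    have hz := Complex.exp_ne_zero (Complex.I * (θ : ℂ))
    have hm := Complex.exp_ne_zero (Complex.I * (ψ : ℂ))
    field_simp
    linear_combination (1 - Complex.exp (Complex.I * (θ : ℂ)) ^ 2) *
      Complex.exp (Complex.I * (ψ : ℂ)) * Complex.I_sq
  rw [hnum, hden, div_div_div_cancel_right₀ (Complex.exp_ne_zero _), mul_div_assoc]

theorem normSq_one_add_I_mul_exp (ψ : ℝ) :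
    Complex.normSq (1 + Complex.I * Complex.exp (Complex.I * (ψ : ℂ))) = 2 - 2 * Real.sin ψ := by
  rw [mul_comm Complex.I (ψ : ℂ), Complex.exp_mul_I, ← Complex.ofReal_cos, ← Complex.ofReal_sin]
  simp only [Complex.normSq_apply, Complex.add_re, Complex.add_im, Complex.mul_re, Complex.mul_im,
    Complex.one_re, Complex.one_im, Complex.I_re, Complex.I_im, Complex.ofReal_re,
    Complex.ofReal_im]
  nlinarith [Real.sin_sq_add_cos_sq ψ]

theorem normSq_one_add_I_mul_exp_inv (ψ : ℝ) :
    Complex.normSq (1 + Complex.I * (Complex.exp (Complex.I * (ψ : ℂ)))⁻¹) =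
      2 + 2 * Real.sin ψ := by
  have := normSq_one_add_I_mul_exp (-ψ)
  rw [Real.sin_neg, Complex.ofReal_neg, mul_neg, Complex.exp_neg] at this
  linarith

theorem integral_coupling_kernel_of_sin_neg (x y : ℤ) (k : ℕ) (h : x + y = 2 * k + 1) {ψ : ℝ}
    (hψ : Real.sin ψ < 0) :
    ∫ θ in (-Real.pi)..Real.pi,
      Complex.exp (Complex.I * ((x : ℂ) * (θ : ℂ) - (y : ℂ) * ((ψ - θ : ℝ) : ℂ))) /
        (2 * Complex.I * ((Real.sin θ : ℝ) : ℂ) + 2 * ((Real.sin (ψ - θ) : ℝ) : ℂ)) = 0 := by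
  simp only [exp_div_eq_pow_div x y (2 * (k + 1)) (by push_cast; linarith)]
  rw [intervalIntegral.integral_const_mul, integral_pow_div_of_norm_lt _ _ (by omega), mul_zero]
  rw [Complex.norm_def, Complex.norm_def, normSq_one_add_I_mul_exp, normSq_one_add_I_mul_exp_inv]
  exact Real.sqrt_lt_sqrt (by linarith [Real.neg_one_le_sin ψ]) (by linarith)

theorem integral_coupling_kernel_of_sin_pos (x y : ℤ) (k : ℕ) (h : x + y = 2 * k + 1) {ψ : ℝ}
    (hψ : 0 < Real.sin ψ) :
    ∫ θ in (-Real.pi)..Real.pi,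
      Complex.exp (Complex.I * ((x : ℂ) * (θ : ℂ) - (y : ℂ) * ((ψ - θ : ℝ) : ℂ))) /
        (2 * Complex.I * ((Real.sin θ : ℝ) : ℂ) + 2 * ((Real.sin (ψ - θ) : ℝ) : ℂ)) =
      Complex.exp (Complex.I * (ψ : ℂ)) ^ (-y) * (2 * Real.pi *
        ((1 + Complex.I * Complex.exp (Complex.I * (ψ : ℂ))) ^ k /
          (1 + Complex.I * (Complex.exp (Complex.I * (ψ : ℂ)))⁻¹) ^ (k + 1))) := by
  simp only [exp_div_eq_pow_div x y (2 * (k + 1)) (by push_cast; linarith)]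
  rw [intervalIntegral.integral_const_mul, integral_pow_div_of_lt_norm]
  rw [Complex.norm_def, Complex.norm_def, normSq_one_add_I_mul_exp, normSq_one_add_I_mul_exp_inv]
  exact Real.sqrt_lt_sqrt (by linarith [Real.sin_le_one ψ]) (by linarith)

theorem integral_coupling_eq_shift (x y : ℤ) (θ : ℝ) :
    ∫ φ in (-Real.pi)..Real.pi,
      Complex.exp (Complex.I * ((x : ℂ) * (θ : ℂ) - (y : ℂ) * (φ : ℂ))) /
        (2 * Complex.I * ((Real.sin θ : ℝ) : ℂ) + 2 * ((Real.sin φ : ℝ) : ℂ)) =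
    ∫ ψ in (-Real.pi)..Real.pi,
      Complex.exp (Complex.I * ((x : ℂ) * (θ : ℂ) - (y : ℂ) * ((ψ - θ : ℝ) : ℂ))) /
        (2 * Complex.I * ((Real.sin θ : ℝ) : ℂ) + 2 * ((Real.sin (ψ - θ) : ℝ) : ℂ)) := by
  have hper : Function.Periodic (fun φ : ℝ =>
      Complex.exp (Complex.I * ((x : ℂ) * (θ : ℂ) - (y : ℂ) * (φ : ℂ))) /
        (2 * Complex.I * ((Real.sin θ : ℝ) : ℂ) + 2 * ((Real.sin φ : ℝ) : ℂ)))
      (2 * Real.pi) := fun φ => by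
    have : Complex.I * ((x : ℂ) * (θ : ℂ) - (y : ℂ) * ((φ + 2 * Real.pi : ℝ) : ℂ)) =
        Complex.I * ((x : ℂ) * (θ : ℂ) - (y : ℂ) * (φ : ℂ)) -
          (y : ℂ) * (2 * Real.pi * Complex.I) := by push_cast; ring
    simp only [this, Complex.exp_periodic.sub_int_mul_eq, Real.sin_add_two_pi]
  rw [intervalIntegral.integral_comp_sub_right (fun φ : ℝ =>
      Complex.exp (Complex.I * ((x : ℂ) * (θ : ℂ) - (y : ℂ) * (φ : ℂ))) /
        (2 * Complex.I * ((Real.sin θ : ℝ) : ℂ) + 2 * ((Real.sin φ : ℝ) : ℂ)))]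
  have := hper.intervalIntegral_add_eq (-Real.pi) (-Real.pi - θ)
  rwa [show -Real.pi + 2 * Real.pi = Real.pi by ring,
    show -Real.pi - θ + 2 * Real.pi = Real.pi - θ by ring] at this

/-- Formula (4.12): for integers `x, y` with `x + y` odd and `x + y ≥ 1`,
`P(x+iy) = (i^{x−1}/2πi) ∫_{γ₊} w^{(x−y+1)/2}(w−1)^{(x+y−1)/2}(w+1)^{−(x+y+1)/2} dw/w`,
where `γ₊` is the right half of the unit circle, parametrized by `t ↦ e^{it}`,
`−π/2 ≤ t ≤ π/2` (so `dw/w = i dt`). -/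
theorem stmt_15 (x y : ℤ) (hodd : Odd (x + y)) (hge : 1 ≤ x + y) :
    Pcoup x y =
      Complex.I ^ (x - 1) * (1 / (2 * (Real.pi : ℂ) * Complex.I)) *
        ∫ t in (-(Real.pi / 2))..(Real.pi / 2),
          let w : ℂ := Complex.exp (Complex.I * (t : ℂ))
          Complex.I *
            (w ^ ((x - y + 1) / 2) * (w - 1) ^ ((x + y - 1) / 2) *
              (w + 1) ^ (-((x + y + 1) / 2))) := by
  obtain ⟨j, hj⟩ := hodd
  obtain ⟨k, rfl⟩ := Int.eq_ofNat_of_zero_le (show 0 ≤ j by omega)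
  have hk : x + y = 2 * k + 1 := hj
  have hle : -Real.pi ≤ Real.pi := by linarith [Real.pi_pos]
  have hint := integrableOn_coupling_kernel x y
  have hH : IntervalIntegrable (fun ψ : ℝ => ∫ θ in (-Real.pi)..Real.pi,
      Complex.exp (Complex.I * ((x : ℂ) * (θ : ℂ) - (y : ℂ) * ((ψ - θ : ℝ) : ℂ))) /
        (2 * Complex.I * ((Real.sin θ : ℝ) : ℂ) + 2 * ((Real.sin (ψ - θ) : ℝ) : ℂ)))
      volume (-Real.pi) Real.pi := by
    have hprod := hint
    rw [IntegrableOn, Measure.volume_eq_prod, ← Measure.prod_restrict] at hprod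
    have := hprod.integral_prod_left
    rw [Set.uIoc_of_le hle] at this
    rw [intervalIntegrable_iff_integrableOn_Ioc_of_le hle]
    simpa only [IntegrableOn, Function.uncurry, intervalIntegral.integral_of_le hle] using this
  have hzero : (0 : ℝ) ∈ Set.uIcc (-Real.pi) Real.pi := by
    rw [Set.uIcc_of_le hle]
    constructor <;> linarith [Real.pi_pos]
  rw [Pcoup]
  simp only [integral_coupling_eq_shift x y]
  rw [← intervalIntegral_intervalIntegral_swap hint,
    ← intervalIntegral.integral_add_adjacent_intervals (b := 0)
      (hH.mono_set (Set.uIcc_subset_uIcc_left hzero))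
      (hH.mono_set (Set.uIcc_subset_uIcc_right hzero)),
    intervalIntegral.integral_congr_Ioo_of_le (by linarith [Real.pi_pos]) fun ψ hψ =>
      integral_coupling_kernel_of_sin_neg x y k hk
        (Real.sin_neg_of_neg_of_neg_pi_lt hψ.2 hψ.1),
    intervalIntegral.integral_zero, zero_add,
    intervalIntegral.integral_congr_Ioo_of_le Real.pi_pos.le fun ψ hψ =>
      integral_coupling_kernel_of_sin_pos x y k hk (Real.sin_pos_of_mem_Ioo hψ)]
  have hshift := intervalIntegral.integral_comp_add_right (a := -(Real.pi / 2)) (b := Real.pi / 2)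
    (fun ψ : ℝ => Complex.exp (Complex.I * (ψ : ℂ)) ^ (-y) * (2 * Real.pi *
        ((1 + Complex.I * Complex.exp (Complex.I * (ψ : ℂ))) ^ k /
          (1 + Complex.I * (Complex.exp (Complex.I * (ψ : ℂ)))⁻¹) ^ (k + 1)))) (Real.pi / 2)
  rw [neg_add_cancel, add_halves] at hshift
  rw [← hshift, ← intervalIntegral.integral_const_mul, ← intervalIntegral.integral_const_mul]
  refine intervalIntegral.integral_congr fun t _ => ?_
  have hm : Complex.exp (Complex.I * ((t + Real.pi / 2 : ℝ) : ℂ)) =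
      Complex.I * Complex.exp (Complex.I * (t : ℂ)) := by
    have harg : Complex.I * ((t + Real.pi / 2 : ℝ) : ℂ) =
        Real.pi / 2 * Complex.I + Complex.I * (t : ℂ) := by push_cast; ring
    rw [harg, Complex.exp_add, Complex.exp_pi_div_two_mul_I]
  have hw := Complex.exp_ne_zero (Complex.I * (t : ℂ))
  simp only [hm]
  generalize Complex.exp (Complex.I * (t : ℂ)) = w at hw
  have hA : 1 + Complex.I * (Complex.I * w)⁻¹ = (w + 1) / w := by
    field_simp [Complex.I_ne_zero]
  have hB : 1 + Complex.I * (Complex.I * w) = Complex.I ^ 2 * (w - 1) := by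
    linear_combination Complex.I_sq
  have hπ : (Real.pi : ℂ) ≠ 0 := by exact_mod_cast Real.pi_ne_zero
  rw [hA, hB, show (x - y + 1) / 2 = (k + 1 : ℕ) + -y by omega,
    show (x + y - 1) / 2 = (k : ℕ) by omega, show (x + y + 1) / 2 = (k + 1 : ℕ) by omega,
    show x - 1 = (2 * k : ℕ) + -y by omega, zpow_add₀ hw, zpow_add₀ Complex.I_ne_zero,
    zpow_neg (w + 1), mul_zpow, zpow_natCast, zpow_natCast, zpow_natCast, zpow_natCast, mul_pow,
    div_pow, ← pow_mul, div_div_eq_mul_div, div_eq_mul_inv _ ((w + 1) ^ (k + 1))]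
  field_simp [Complex.I_ne_zero]
  ring
end
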